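/- Let N = m + n > 3 with integers 1 < n ≤ m, let R > 0, and let q ≥ p > 2 be real exponents. Let a, b : closure(A_R) → ℝ be continuous with 0 < a₀ ≤ a(x) ≤ A₀ and 0 < b₀ ≤ b(x) ≤ B₀ for constants a₀, A₀, b₀, B₀, and suppose a(x) = â(s(x), t(x)) and b(x) = b̂(s(x), t(x)) for continuously differentiable functions â, b̂ satisfying s·∂ₜâ − t·∂ₛâ ≤ 0 and s·∂ₜb̂ − t·∂ₛb̂ ≤ 0 on {(s,t) ∈ ℝ² : s ≥ 0, t ≥ 0, s² + t² > R²}. Assume either n ≤ (p+1)/(p−1), or n > (p+1)/(p−1) together with 1/p + 1/q > 1 − 2/(n+1). Then there exist functions u, v : ℝ^N → ℝ that are C² on A_R, continuous on closure(A_R), strictly positive on A_R, vanish on the boundary sphere {|x| = R}, satisfy −Δu(x) + u(x) = a(x)·v(x)^{p−1} and −Δv(x) + v(x) = b(x)·u(x)^{q−1} at every x ∈ A_R, and such that each of u and v is of the form û(s(x), t(x)) for a function û with s·∂ₜû − t·∂ₛû ≤ 0 (i.e., u and v are invariant under O(m) × O(n) and nonincreasing in the polar angle θ = arctan(t/s)).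 -/

import Mathlib

open Set

/-- The Laplacian of `f : ℝ^N → ℝ` at `x`: the sum of the second partial derivatives
in the coordinate directions. -/
noncomputable def lap {N : ℕ} (f : EuclideanSpace ℝ (Fin N) → ℝ)
    (x : EuclideanSpace ℝ (Fin N)) : ℝ :=
  ∑ i : Fin N,
    fderiv ℝ (fun y => fderiv ℝ f y (EuclideanSpace.single i 1)) x
      (EuclideanSpace.single i 1)

/-- `sVar k x` is the Euclidean norm of the first `k` coordinates of `x ∈ ℝ^N`. -/
noncomputable def sVar {N : ℕ} (k : ℕ) (x : EuclideanSpace ℝ (Fin N)) : ℝ :=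
  Real.sqrt (∑ i : Fin N, if (i : ℕ) < k then x i ^ 2 else 0)

/-- `tVar k x` is the Euclidean norm of the last `N - k` coordinates of `x ∈ ℝ^N`. -/
noncomputable def tVar {N : ℕ} (k : ℕ) (x : EuclideanSpace ℝ (Fin N)) : ℝ :=
  Real.sqrt (∑ i : Fin N, if (i : ℕ) < k then 0 else x i ^ 2)

abbrev Eu (N : ℕ) : Type := EuclideanSpace ℝ (Fin N)


open Set Filter Topology
open scoped NNReal

section A1
variable {N : ℕ}


theorem lap_congr {f g : (Eu N) → ℝ} {x : Eu N} (h : f =ᶠ[𝓝 x] g) : lap f x = lap g x := by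
  unfold lap
  refine Finset.sum_congr rfl fun i _ => ?_
  have : (fun y => fderiv ℝ f y (EuclideanSpace.single i 1)) =ᶠ[𝓝 x]
      (fun y => fderiv ℝ g y (EuclideanSpace.single i 1)) := by
    filter_upwards [h.eventually_nhds] with y hy
    rw [Filter.EventuallyEq.fderiv_eq hy]
  rw [this.fderiv_eq]

theorem cd2_diff {f : (Eu N) → ℝ} {x : Eu N} (hf : ContDiffAt ℝ 2 f x) :
    ∀ᶠ y in 𝓝 x, DifferentiableAt ℝ f y := by
  have := hf.eventually (by simp)
  filter_upwards [this] with y hy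
  exact hy.differentiableAt (by simp)

theorem cd2_diff2 {f : (Eu N) → ℝ} {x : Eu N} (hf : ContDiffAt ℝ 2 f x) (e : Eu N) :
    DifferentiableAt ℝ (fun y => fderiv ℝ f y e) x := by
  have h1 : ContDiffAt ℝ 1 (fderiv ℝ f) x := hf.fderiv_right (by norm_num)
  have h2 : DifferentiableAt ℝ (fderiv ℝ f) x := h1.differentiableAt (by simp)
  exact h2.clm_apply (differentiableAt_const e)

theorem lap_add {f g : (Eu N) → ℝ} {x : Eu N} (hf : ContDiffAt ℝ 2 f x) (hg : ContDiffAt ℝ 2 g x) :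
    lap (fun y => f y + g y) x = lap f x + lap g x := by
  unfold lap
  rw [← Finset.sum_add_distrib]
  refine Finset.sum_congr rfl fun i _ => ?_
  have : (fun y => fderiv ℝ (fun y => f y + g y) y (EuclideanSpace.single i 1)) =ᶠ[𝓝 x]
      (fun y => fderiv ℝ f y (EuclideanSpace.single i 1)
        + fderiv ℝ g y (EuclideanSpace.single i 1)) := by
    filter_upwards [cd2_diff hf, cd2_diff hg] with y h1 h2
    rw [fderiv_fun_add h1 h2]; rfl
  rw [this.fderiv_eq, fderiv_fun_add (cd2_diff2 hf _) (cd2_diff2 hg _)]; rfl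

theorem lap_const_mul {f : (Eu N) → ℝ} {x : Eu N} (c : ℝ) (hf : ContDiffAt ℝ 2 f x) :
    lap (fun y => c * f y) x = c * lap f x := by
  unfold lap
  rw [Finset.mul_sum]
  refine Finset.sum_congr rfl fun i _ => ?_
  have : (fun y => fderiv ℝ (fun y => c * f y) y (EuclideanSpace.single i 1)) =ᶠ[𝓝 x]
      (fun y => c * fderiv ℝ f y (EuclideanSpace.single i 1)) := by
    filter_upwards [cd2_diff hf] with y h1
    rw [fderiv_const_mul h1]; rfl
  rw [this.fderiv_eq, fderiv_const_mul (cd2_diff2 hf _)]; rfl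

theorem lap_neg {f : (Eu N) → ℝ} {x : Eu N} (hf : ContDiffAt ℝ 2 f x) :
    lap (fun y => - f y) x = - lap f x := by
  have := lap_const_mul (-1) hf
  simpa using this

theorem lap_sub {f g : (Eu N) → ℝ} {x : Eu N} (hf : ContDiffAt ℝ 2 f x) (hg : ContDiffAt ℝ 2 g x) :
    lap (fun y => f y - g y) x = lap f x - lap g x := by
  have h1 := lap_add hf hg.neg
  have h2 := lap_neg hg
  simp only [sub_eq_add_neg]
  rw [← h2]; exact h1

theorem lap_const (c : ℝ) (x : Eu N) : lap (fun _ => c) x = 0 := by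
  unfold lap; simp

theorem hasFDerivAt_normsq (c y : Eu N) :
    HasFDerivAt (fun y : Eu N => ‖y - c‖ ^ 2) (2 • innerSL ℝ (y - c)) y := by
  have := ((hasFDerivAt_id y).sub_const c).norm_sq
  simpa using this

theorem fderiv_radial {F : ℝ → ℝ} {F1 : ℝ} (c y : Eu N) (h : HasDerivAt F F1 (‖y - c‖ ^ 2)) :
    HasFDerivAt (fun y => F (‖y - c‖ ^ 2)) (F1 • (2 • innerSL ℝ (y - c))) y :=
  h.comp_hasFDerivAt y (hasFDerivAt_normsq c y)

theorem dd_radial {F F1 : ℝ → ℝ} {F2 : ℝ} (c x e : Eu N)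
    (h : ∀ᶠ t in 𝓝 (‖x - c‖ ^ 2), HasDerivAt F (F1 t) t) (h2 : HasDerivAt F1 F2 (‖x - c‖ ^ 2)) :
    fderiv ℝ (fun y => fderiv ℝ (fun y => F (‖y - c‖ ^ 2)) y e) x e
      = 4 * F2 * (inner ℝ (x - c) e) ^ 2 + 2 * F1 (‖x - c‖ ^ 2) * ‖e‖ ^ 2 := by
  have hc : Tendsto (fun y : Eu N => ‖y - c‖ ^ 2) (𝓝 x) (𝓝 (‖x - c‖ ^ 2)) :=
    (hasFDerivAt_normsq c x).continuousAt
  have : (fun y => fderiv ℝ (fun y => F (‖y - c‖ ^ 2)) y e) =ᶠ[𝓝 x]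
      (fun y => F1 (‖y - c‖ ^ 2) * (2 * inner ℝ (y - c) e)) := by
    filter_upwards [hc.eventually h] with y hy
    rw [(fderiv_radial c y hy).fderiv]
    simp only [ContinuousLinearMap.smul_apply, innerSL_apply_apply, smul_eq_mul, nsmul_eq_mul]
    push_cast; ring
  rw [this.fderiv_eq]
  have h3 : HasFDerivAt (fun y : Eu N => inner ℝ (y - c) e) (innerSL ℝ e) x := by
    have : (fun y : Eu N => inner ℝ (y - c) e) = fun y => (innerSL ℝ e) (y - c) := by
      funext y; simp [real_inner_comm]
    rw [this]
    exact (innerSL ℝ e).hasFDerivAt.comp x ((hasFDerivAt_id x).sub_const c)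
  have h4 := (fderiv_radial c x h2).fun_mul (h3.const_mul 2)
  rw [h4.fderiv]
  simp only [ContinuousLinearMap.add_apply, ContinuousLinearMap.smul_apply, innerSL_apply_apply,
    smul_eq_mul, nsmul_eq_mul, real_inner_self_eq_norm_sq]
  push_cast; ring

theorem sum_inner_sq (x : Eu N) :
    ∑ i : Fin N, (inner ℝ x (EuclideanSpace.single i (1:ℝ))) ^ 2 = ‖x‖ ^ 2 := by
  rw [EuclideanSpace.norm_sq_eq]
  refine Finset.sum_congr rfl fun i _ => ?_
  simp [EuclideanSpace.inner_single_right]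

theorem lap_radial {F F1 : ℝ → ℝ} {F2 : ℝ} (c x : Eu N)
    (h : ∀ᶠ t in 𝓝 (‖x - c‖ ^ 2), HasDerivAt F (F1 t) t) (h2 : HasDerivAt F1 F2 (‖x - c‖ ^ 2)) :
    lap (fun y => F (‖y - c‖ ^ 2)) x
      = 4 * ‖x - c‖ ^ 2 * F2 + 2 * N * F1 (‖x - c‖ ^ 2) := by
  unfold lap
  simp only [dd_radial c x _ h h2]
  rw [Finset.sum_add_distrib, ← Finset.mul_sum, sum_inner_sq]
  simp; ring

theorem contDiff_normsq (c : Eu N) {n : WithTop ℕ∞} : ContDiff ℝ n (fun y : Eu N => ‖y - c‖ ^ 2) :=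
  (contDiff_id.sub contDiff_const).norm_sq ℝ

theorem lap_normsq (c x : Eu N) : lap (fun y => ‖y - c‖ ^ 2) x = 2 * N := by
  have := lap_radial (F := fun t => t) (F1 := fun _ => 1) (F2 := 0) c x
    (Eventually.of_forall fun t => hasDerivAt_id t) (hasDerivAt_const _ _)
  simpa using this

theorem dd_line {f : (Eu N) → ℝ} {x : Eu N} (hf : ContDiffAt ℝ 2 f x) (e : Eu N) :
    deriv (deriv (fun t : ℝ => f (x + t • e))) 0 = fderiv ℝ (fun y => fderiv ℝ f y e) x e := by
  have hl : ∀ t : ℝ, HasDerivAt (fun t : ℝ => x + t • e) e t := fun t => by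
    simpa using ((hasDerivAt_id t).smul_const e).const_add x
  have hc : Tendsto (fun t : ℝ => x + t • e) (𝓝 0) (𝓝 x) := by
    have := (hl 0).continuousAt.tendsto
    simpa using this
  have : deriv (fun t : ℝ => f (x + t • e)) =ᶠ[𝓝 0] fun t => fderiv ℝ f (x + t • e) e := by
    filter_upwards [hc.eventually (cd2_diff hf)] with t ht
    exact (ht.hasFDerivAt.comp_hasDerivAt t (hl t)).deriv
  rw [this.deriv_eq]
  have h2 : HasFDerivAt (fun y => fderiv ℝ f y e) (fderiv ℝ (fun y => fderiv ℝ f y e) x)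
      (x + (0:ℝ) • e) := by
    have := (cd2_diff2 hf e).hasFDerivAt
    simpa using this
  exact (h2.comp_hasDerivAt (0:ℝ) (hl 0)).deriv

theorem lap_nonneg_of_isLocalMin {f : (Eu N) → ℝ} {x : Eu N} (hf : ContDiffAt ℝ 2 f x)
    (hm : IsLocalMin f x) : 0 ≤ lap f x := by
  unfold lap
  refine Finset.sum_nonneg fun i _ => ?_
  set e : Eu N := EuclideanSpace.single i 1
  by_contra hneg
  push Not at hneg
  rw [← dd_line hf e] at hneg
  set g : ℝ → ℝ := fun t : ℝ => f (x + t • e) with hg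
  have hcl : ContinuousAt (fun t : ℝ => x + t • e) 0 := by fun_prop
  have hc : Tendsto (fun t : ℝ => x + t • e) (𝓝 0) (𝓝 x) := by
    have := hcl.tendsto
    simpa using this
  have hgm : IsLocalMin g 0 := by
    have := hc.eventually hm
    filter_upwards [this] with t ht
    simpa [hg] using ht
  have hgc : ContinuousAt g 0 := by
    have h0 : ContinuousAt f (x + (0:ℝ) • e) := by simpa using hf.continuousAt
    exact ContinuousAt.comp (g := f) (f := fun t : ℝ => x + t • e) h0 hcl
  have hmax := isLocalMax_of_deriv_deriv_neg hneg hgm.deriv_eq_zero hgc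
  have hconst : g =ᶠ[𝓝 0] fun _ => g 0 := by
    filter_upwards [hgm, hmax] with t h1 h2
    exact le_antisymm h2 h1
  have h3 : deriv g =ᶠ[𝓝 0] fun _ => 0 := by
    filter_upwards [hconst.eventually_nhds] with t ht
    rw [Filter.EventuallyEq.deriv_eq ht]; simp
  rw [h3.deriv_eq] at hneg
  simp at hneg

theorem max_principle {C : Set (Eu N)} (hC : IsClosed C) {w : (Eu N) → ℝ} (hw : ContinuousOn w C)
    {B : ℝ} (hB : ∀ z ∈ C, B ≤ w z)
    (hl : ∀ z ∈ C, w z < 0 → C ∈ 𝓝 z ∧ ContDiffAt ℝ 2 w z ∧ lap w z ≤ w z) :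
    ∀ z ∈ C, 0 ≤ w z := by
  intro x0 hx0
  have key : ∀ ε > 0, -(ε * (2 * N + ‖x0‖ ^ 2)) ≤ w x0 := by
    intro ε hε
    set g : (Eu N) → ℝ := fun y => w y + ε * ‖y - 0‖ ^ 2 with hg
    have hgc : ContinuousOn g C := hw.add (by fun_prop)
    have hcoer : ∃ y ∈ C, ∀ z ∈ C, g y ≤ g z := by
      set ρ := Real.sqrt ((g x0 - B) / ε) with hρ
      have hcomp : IsCompact (C ∩ Metric.closedBall 0 (ρ + ‖x0‖)) :=
        (isCompact_closedBall _ _).inter_left hC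
      have hx0' : x0 ∈ C ∩ Metric.closedBall 0 (ρ + ‖x0‖) := by
        refine ⟨hx0, ?_⟩
        simp [hρ, Real.sqrt_nonneg]
      obtain ⟨y, hy, hmin⟩ := hcomp.exists_isMinOn ⟨x0, hx0'⟩ (hgc.mono inter_subset_left)
      refine ⟨y, hy.1, fun z hz => ?_⟩
      by_cases hzb : z ∈ Metric.closedBall (0 : Eu N) (ρ + ‖x0‖)
      · exact hmin ⟨hz, hzb⟩
      · have h1 : g y ≤ g x0 := hmin hx0'
        refine h1.trans ?_
        simp only [Metric.mem_closedBall, dist_zero_right, not_le] at hzb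
        have h2 : ρ < ‖z‖ := by linarith [norm_nonneg x0]
        have h3 : (g x0 - B) / ε < ‖z‖ ^ 2 := by
          rcases le_or_gt 0 ((g x0 - B) / ε) with h | h
          · exact (Real.sqrt_lt' (lt_of_le_of_lt (Real.sqrt_nonneg _) h2)).1 h2
          · exact h.trans_le (sq_nonneg _)
        rw [div_lt_iff₀ hε] at h3
        have := hB z hz
        simp only [hg, sub_zero] at h3 ⊢
        linarith
    obtain ⟨y, hy, hmin⟩ := hcoer
    have h0 : g y ≤ g x0 := hmin x0 hx0
    have hyw : -(ε * (2 * N)) ≤ w y := by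
      by_contra hlt
      push Not at hlt
      have hneg : w y < 0 := hlt.trans_le (by
        have : (0:ℝ) ≤ ε * (2 * N) := by positivity
        linarith)
      obtain ⟨hn, hcd, hlap⟩ := hl y hy hneg
      have hcdn : ContDiffAt ℝ 2 (fun y : Eu N => ‖y - 0‖ ^ 2) y := (contDiff_normsq 0).contDiffAt
      have hcdn' : ContDiffAt ℝ 2 (fun y : Eu N => ε * ‖y - 0‖ ^ 2) y := contDiffAt_const.mul hcdn
      have hgm : IsLocalMin g y := by
        filter_upwards [hn] with z hz using hmin z hz
      have h4 := lap_nonneg_of_isLocalMin (hcd.add hcdn') hgm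
      have h5 : lap g y = lap w y + ε * (2 * N) := by
        rw [hg, lap_add hcd hcdn', lap_const_mul ε hcdn, lap_normsq]
      have h4' : 0 ≤ lap g y := h4
      linarith
    simp only [hg, sub_zero] at h0
    have : 0 ≤ ε * ‖y‖ ^ 2 := by positivity
    linarith
  by_contra hlt
  push Not at hlt
  set T : ℝ := 2 * N + ‖x0‖ ^ 2 with hT
  have hT0 : 0 ≤ T := by positivity
  have := key (- w x0 / (2 * (T + 1))) (by apply div_pos <;> linarith)
  have h2 : - w x0 / (2 * (T + 1)) * T < - w x0 := by
    rw [div_mul_eq_mul_div, div_lt_iff₀ (by positivity)]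
    nlinarith
  linarith

end A1


open Set Filter Topology MeasureTheory
open scoped NNReal ContDiff

section A2
variable {N : ℕ} {F : Type*} [NormedAddCommGroup F] [NormedSpace ℝ F]

structure Bdm (f : Eu N → ℝ) (M : ℝ) : Prop where
  meas : AEStronglyMeasurable f volume
  bd : ∀ x, ‖f x‖ ≤ M

noncomputable def cv (f : Eu N → ℝ) (Φ : Eu N → F) (x : Eu N) : F := ∫ t, f t • Φ (x - t)

theorem Bdm.nonneg {f : Eu N → ℝ} {M : ℝ} (hf : Bdm f M) : 0 ≤ M :=
  (norm_nonneg _).trans (hf.bd 0)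

theorem Bdm.locInt {f : Eu N → ℝ} {M : ℝ} (hf : Bdm f M) : LocallyIntegrable f volume := by
  have h1 : LocallyIntegrable (fun _ : Eu N => M) volume := locallyIntegrable_const M
  exact h1.mono hf.meas (Eventually.of_forall fun x => (hf.bd x).trans (le_abs_self _))

theorem cv_integrable {f : Eu N → ℝ} {M : ℝ} (hf : Bdm f M) {Φ : Eu N → F} (hΦ : Integrable Φ)
    (x : Eu N) : Integrable (fun t => f t • Φ (x - t)) := by
  exact (hΦ.comp_sub_left x).bdd_smul M hf.meas (Eventually.of_forall hf.bd)

theorem cv_norm_le {f : Eu N → ℝ} {M : ℝ} (hf : Bdm f M) {Φ : Eu N → F} (hΦ : Integrable Φ)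
    (x : Eu N) : ‖cv f Φ x‖ ≤ M * ∫ z, ‖Φ z‖ := by
  calc ‖cv f Φ x‖ ≤ ∫ t, M * ‖Φ (x - t)‖ := by
        refine norm_integral_le_of_norm_le ((hΦ.comp_sub_left x).norm.const_mul M)
          (Eventually.of_forall fun t => ?_)
        rw [norm_smul]
        exact mul_le_mul_of_nonneg_right (hf.bd t) (norm_nonneg _)
    _ = M * ∫ z, ‖Φ z‖ := by
        rw [integral_const_mul, integral_sub_left_eq_self (fun z => ‖Φ z‖) volume x]

theorem cv_sub {f : Eu N → ℝ} {M : ℝ} (hf : Bdm f M) {Φ Ψ : Eu N → F} (hΦ : Integrable Φ)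
    (hΨ : Integrable Ψ) (x : Eu N) :
    cv f (fun z => Φ z - Ψ z) x = cv f Φ x - cv f Ψ x := by
  unfold cv
  rw [← integral_sub (cv_integrable hf hΦ x) (cv_integrable hf hΨ x)]
  simp [smul_sub]

theorem cv_add {f : Eu N → ℝ} {M : ℝ} (hf : Bdm f M) {Φ Ψ : Eu N → F} (hΦ : Integrable Φ)
    (hΨ : Integrable Ψ) (x : Eu N) :
    cv f (fun z => Φ z + Ψ z) x = cv f Φ x + cv f Ψ x := by
  unfold cv
  rw [← integral_add (cv_integrable hf hΦ x) (cv_integrable hf hΨ x)]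
  simp [smul_add]

theorem cv_tendstoUniformly {ι : Type*} {l : Filter ι} {f : Eu N → ℝ} {M : ℝ} (hf : Bdm f M)
    {Φ : ι → Eu N → F} {Φ0 : Eu N → F} (hΦ : ∀ i, Integrable (Φ i)) (hΦ0 : Integrable Φ0)
    (hl : Tendsto (fun i => ∫ z, ‖Φ i z - Φ0 z‖) l (𝓝 0)) :
    TendstoUniformly (fun i => cv f (Φ i)) (cv f Φ0) l := by
  rw [Metric.tendstoUniformly_iff]
  intro ε hε
  have h1 : Tendsto (fun i => M * ∫ z, ‖Φ i z - Φ0 z‖) l (𝓝 (M * 0)) := hl.const_mul M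
  rw [mul_zero] at h1
  filter_upwards [h1.eventually (gt_mem_nhds hε)] with i hi x
  rw [dist_comm, dist_eq_norm, ← cv_sub hf (hΦ i) hΦ0]
  exact (cv_norm_le hf ((hΦ i).sub hΦ0) x).trans_lt hi

theorem cv_eq_conv (f : Eu N → ℝ) (Φ : Eu N → F) :
    cv f Φ = convolution f Φ (ContinuousLinearMap.lsmul ℝ ℝ) volume := by
  funext x; simp [cv, convolution]

theorem cv_hasFDerivAt [CompleteSpace F] {f : Eu N → ℝ} {M : ℝ} (hf : Bdm f M) {Φ : Eu N → F}
    (hc : HasCompactSupport Φ) (hΦ : ContDiff ℝ 1 Φ) (x : Eu N) :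
    HasFDerivAt (cv f Φ) (cv f (fderiv ℝ Φ) x) x := by
  have h := hc.hasFDerivAt_convolution_right (ContinuousLinearMap.lsmul ℝ ℝ) hf.locInt hΦ x
  rw [← cv_eq_conv] at h
  have h2 : convolution f (fderiv ℝ Φ)
      (ContinuousLinearMap.precompR (Eu N) (ContinuousLinearMap.lsmul ℝ ℝ)) volume x
      = cv f (fderiv ℝ Φ) x := rfl
  rw [← h2]
  exact h

theorem cd_integrable {Φ : Eu N → F} (hc : HasCompactSupport Φ) (hΦ : Continuous Φ) :
    Integrable Φ := hΦ.integrable_of_hasCompactSupport hc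

theorem cv_contDiff [CompleteSpace F] {f : Eu N → ℝ} {M : ℝ} (hf : Bdm f M) {Φ : Eu N → F}
    (hc : HasCompactSupport Φ) (hΦ : ContDiff ℝ ∞ Φ) : ContDiff ℝ ∞ (cv f Φ) := by
  rw [cv_eq_conv]
  exact hc.contDiff_convolution_right _ hf.locInt hΦ

theorem cv_fderiv_apply {f : Eu N → ℝ} {M : ℝ} (hf : Bdm f M) {φ : Eu N → ℝ}
    (hc : HasCompactSupport φ) (hφ : ContDiff ℝ 1 φ) (x e : Eu N) :
    fderiv ℝ (cv f φ) x e = cv f (fun z => fderiv ℝ φ z e) x := by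
  rw [(cv_hasFDerivAt hf hc hφ x).fderiv]
  unfold cv
  have h1 : Integrable (fderiv ℝ φ) :=
    cd_integrable (hc.fderiv ℝ) (hφ.continuous_fderiv one_ne_zero)
  have := ContinuousLinearMap.integral_apply (cv_integrable hf h1 x) e
  rw [this]
  rfl

theorem cs_fderiv_apply {φ : Eu N → ℝ} (hc : HasCompactSupport φ) (e : Eu N) :
    HasCompactSupport (fun z => fderiv ℝ φ z e) :=
  (hc.fderiv ℝ).comp_left (g := fun L : Eu N →L[ℝ] ℝ => L e) rfl

theorem cd_fderiv_apply {φ : Eu N → ℝ} (hφ : ContDiff ℝ ∞ φ) (e : Eu N) :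
    ContDiff ℝ ∞ (fun z => fderiv ℝ φ z e) :=
  (hφ.fderiv_right (m := ∞) (by simp)).clm_apply contDiff_const

theorem lap_integrable_aux {φ : Eu N → ℝ} (hc : HasCompactSupport φ) (hφ : ContDiff ℝ ∞ φ)
    (e : Eu N) :
    Integrable (fun z => fderiv ℝ (fun y => fderiv ℝ φ y e) z e) :=
  cd_integrable (cs_fderiv_apply (cs_fderiv_apply hc e) e)
    (cd_fderiv_apply (cd_fderiv_apply hφ e) e).continuous

theorem lap_contDiff {φ : Eu N → ℝ} (hφ : ContDiff ℝ ∞ φ) : ContDiff ℝ ∞ (lap φ) := by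
  unfold lap
  exact ContDiff.sum fun i _ => cd_fderiv_apply (cd_fderiv_apply hφ _) _

theorem lap_zero_of_not_mem {φ : Eu N → ℝ} {x : Eu N} (hx : x ∉ tsupport φ) : lap φ x = 0 := by
  have : φ =ᶠ[𝓝 x] fun _ => 0 := notMem_tsupport_iff_eventuallyEq.1 hx
  rw [lap_congr this, lap_const]

theorem lap_compactSupport {φ : Eu N → ℝ} (hc : HasCompactSupport φ) :
    HasCompactSupport (lap φ) :=
  HasCompactSupport.intro hc fun _ hx => lap_zero_of_not_mem hx

theorem lap_integrable {φ : Eu N → ℝ} (hc : HasCompactSupport φ) (hφ : ContDiff ℝ ∞ φ) :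
    Integrable (lap φ) :=
  cd_integrable (lap_compactSupport hc) (lap_contDiff hφ).continuous

theorem lap_cv {f : Eu N → ℝ} {M : ℝ} (hf : Bdm f M) {φ : Eu N → ℝ}
    (hc : HasCompactSupport φ) (hφ : ContDiff ℝ ∞ φ) (x : Eu N) :
    lap (cv f φ) x = cv f (lap φ) x := by
  have h1 : ∀ e x, fderiv ℝ (fun y => fderiv ℝ (cv f φ) y e) x e
      = cv f (fun z => fderiv ℝ (fun y => fderiv ℝ φ y e) z e) x := by
    intro e x
    have : (fun y => fderiv ℝ (cv f φ) y e) = cv f (fun z => fderiv ℝ φ z e) := by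
      funext y
      exact cv_fderiv_apply hf hc (hφ.of_le (by simp)) y e
    rw [this]
    exact cv_fderiv_apply hf (cs_fderiv_apply hc e) ((cd_fderiv_apply hφ e).of_le (by simp)) x e
  unfold lap
  simp only [h1]
  unfold cv
  rw [← integral_finsetSum]
  · simp [Finset.mul_sum]
  · intro i _
    exact cv_integrable hf (lap_integrable_aux hc hφ _) x

theorem cv_one_fderiv [CompleteSpace F] {Φ : Eu N → F}
    (hc : HasCompactSupport Φ) (hΦ : ContDiff ℝ 1 Φ) (x : Eu N) :
    ∫ t, fderiv ℝ Φ (x - t) = 0 := by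
  have hb : Bdm (fun _ : Eu N => (1:ℝ)) 1 := ⟨aestronglyMeasurable_const, fun x => by simp⟩
  have h1 := cv_hasFDerivAt hb hc hΦ x
  have h2 : cv (fun _ : Eu N => (1:ℝ)) Φ = fun _ => ∫ z, Φ z := by
    funext y
    simp only [cv, one_smul]
    exact integral_sub_left_eq_self (fun z => Φ z) volume y
  rw [h2] at h1
  have h3 := h1.unique (hasFDerivAt_const _ _)
  simpa [cv] using h3

end A2


open Set Filter Topology MeasureTheory
open scoped NNReal ContDiff

section A3
variable {N : ℕ}

noncomputable def nu (N : ℕ) : ℝ := ((N : ℝ) - 2) / 2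

noncomputable def chi (r τ : ℝ) : ℝ := Real.smoothTransition (2 - 2 * τ / r ^ 2)

theorem chi_contDiff (r : ℝ) {n : ℕ∞} : ContDiff ℝ n (chi r) := by
  unfold chi
  exact Real.smoothTransition.contDiff.comp (by fun_prop)

theorem chi_nonneg (r τ : ℝ) : 0 ≤ chi r τ := Real.smoothTransition.nonneg _
theorem chi_le_one (r τ : ℝ) : chi r τ ≤ 1 := Real.smoothTransition.le_one _

theorem chi_one {r τ : ℝ} (hr : 0 < r) (h : τ ≤ r ^ 2 / 2) : chi r τ = 1 := by
  apply Real.smoothTransition.one_of_one_le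
  have : 2 * τ / r ^ 2 ≤ 1 := by
    rw [div_le_one (by positivity)]; linarith
  linarith

theorem chi_zero {r τ : ℝ} (hr : 0 < r) (h : r ^ 2 ≤ τ) : chi r τ = 0 := by
  apply Real.smoothTransition.zero_of_nonpos
  have : 2 ≤ 2 * τ / r ^ 2 := by
    rw [le_div_iff₀ (by positivity)]; linarith
  linarith

theorem chi_hasDeriv (r τ : ℝ) : HasDerivAt (chi r) (deriv (chi r) τ) τ :=
  ((chi_contDiff r (n := 1)).differentiable (by simp) τ).hasDerivAt

theorem chi_deriv_contDiff (r : ℝ) : ContDiff ℝ ∞ (deriv (chi r)) := by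
  have h : ContDiff ℝ (∞ + 1) (chi r) := chi_contDiff r (n := ⊤)
  exact (contDiff_succ_iff_deriv.1 h).2.2

theorem chi_deriv2_contDiff (r : ℝ) : ContDiff ℝ ∞ (deriv (deriv (chi r))) := by
  have h : ContDiff ℝ (∞ + 1) (deriv (chi r)) := chi_deriv_contDiff r
  exact (contDiff_succ_iff_deriv.1 h).2.2

theorem chi_hasDeriv2 (r τ : ℝ) : HasDerivAt (deriv (chi r)) (deriv (deriv (chi r)) τ) τ :=
  ((chi_deriv_contDiff r).differentiable (by simp) τ).hasDerivAt

theorem chi_deriv_zero {r τ : ℝ} (hr : 0 < r) (h : τ < r ^ 2 / 2 ∨ r ^ 2 < τ) :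
    deriv (chi r) τ = 0 := by
  rcases h with h | h
  · have : chi r =ᶠ[𝓝 τ] fun _ => 1 := by
      filter_upwards [gt_mem_nhds h] with t ht using chi_one hr ht.le
    rw [this.deriv_eq]; simp
  · have : chi r =ᶠ[𝓝 τ] fun _ => 0 := by
      filter_upwards [lt_mem_nhds h] with t ht using chi_zero hr ht.le
    rw [this.deriv_eq]; simp

theorem chi_deriv2_zero {r τ : ℝ} (hr : 0 < r) (h : τ < r ^ 2 / 2 ∨ r ^ 2 < τ) :
    deriv (deriv (chi r)) τ = 0 := by
  have : deriv (chi r) =ᶠ[𝓝 τ] fun _ => 0 := by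
    rcases h with h | h
    · filter_upwards [gt_mem_nhds h] with t ht using chi_deriv_zero hr (Or.inl ht)
    · filter_upwards [lt_mem_nhds h] with t ht using chi_deriv_zero hr (Or.inr ht)
  rw [this.deriv_eq]; simp

theorem chi_bound {r : ℝ} : ∃ C, 1 ≤ C ∧ ∀ τ ∈ Icc 0 (r ^ 2), |deriv (chi r) τ| ≤ C ∧
    |deriv (deriv (chi r)) τ| ≤ C := by
  obtain ⟨C1, h1⟩ := isCompact_Icc.exists_bound_of_continuousOn (s := Icc 0 (r ^ 2))
    (chi_deriv_contDiff r).continuous.continuousOn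
  obtain ⟨C2, h2⟩ := isCompact_Icc.exists_bound_of_continuousOn (s := Icc 0 (r ^ 2))
    (chi_deriv2_contDiff r).continuous.continuousOn
  refine ⟨max 1 (max C1 C2), le_max_left _ _, fun τ hτ => ⟨?_, ?_⟩⟩
  · exact (h1 τ hτ).trans ((le_max_left _ _).trans (le_max_right _ _))
  · exact (h2 τ hτ).trans ((le_max_right _ _).trans (le_max_right _ _))

noncomputable def kF0 (N : ℕ) (r ε τ : ℝ) : ℝ := chi r τ * (τ + ε) ^ (-nu N)
noncomputable def kF1 (N : ℕ) (r ε τ : ℝ) : ℝ :=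
  deriv (chi r) τ * (τ + ε) ^ (-nu N) + chi r τ * (-nu N * (τ + ε) ^ (-nu N - 1))
noncomputable def kF2 (N : ℕ) (r ε τ : ℝ) : ℝ :=
  deriv (deriv (chi r)) τ * (τ + ε) ^ (-nu N)
    + 2 * deriv (chi r) τ * (-nu N * (τ + ε) ^ (-nu N - 1))
    + chi r τ * (nu N * (nu N + 1) * (τ + ε) ^ (-nu N - 2))

theorem rpow_shift_deriv {ε τ s : ℝ} (h : 0 < τ + ε) :
    HasDerivAt (fun t : ℝ => (t + ε) ^ s) (s * (τ + ε) ^ (s - 1)) τ := by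
  have h1 : HasDerivAt (fun t : ℝ => t + ε) 1 τ := (hasDerivAt_id τ).add_const ε
  have := h1.rpow_const (p := s) (Or.inl h.ne')
  simpa using this

theorem kF0_deriv {r ε τ : ℝ} (h : 0 < τ + ε) : HasDerivAt (kF0 N r ε) (kF1 N r ε τ) τ := by
  have := (chi_hasDeriv r τ).fun_mul (rpow_shift_deriv (s := -nu N) h)
  exact this

theorem kF1_deriv {r ε τ : ℝ} (h : 0 < τ + ε) : HasDerivAt (kF1 N r ε) (kF2 N r ε τ) τ := by
  have h1 := (chi_hasDeriv2 r τ).fun_mul (rpow_shift_deriv (s := -nu N) h)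
  have h2 := (chi_hasDeriv r τ).fun_mul
    ((rpow_shift_deriv (s := -nu N - 1) h).const_mul (-nu N))
  have := h1.fun_add h2
  refine HasDerivAt.congr_deriv this ?_
  rw [show -nu N - 1 - 1 = -nu N - 2 by ring]
  unfold kF2; ring

noncomputable def iSL (N : ℕ) : Eu N →L[ℝ] Eu N →L[ℝ] ℝ := innerSL ℝ

theorem iSL_apply (v w : Eu N) : iSL N v w = inner ℝ v w := rfl

noncomputable def K0 (N : ℕ) (r ε : ℝ) (z : Eu N) : ℝ := kF0 N r ε (‖z‖ ^ 2)
noncomputable def K1 (N : ℕ) (r ε : ℝ) (z : Eu N) : Eu N →L[ℝ] ℝ :=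
  (2 * kF1 N r ε (‖z‖ ^ 2)) • innerSL ℝ z
noncomputable def K2 (N : ℕ) (r ε : ℝ) (z : Eu N) : Eu N →L[ℝ] Eu N →L[ℝ] ℝ :=
  (4 * kF2 N r ε (‖z‖ ^ 2)) • (innerSL ℝ z).smulRight (innerSL ℝ z)
    + (2 * kF1 N r ε (‖z‖ ^ 2)) • iSL N

theorem pos_aux {ε : ℝ} (hε : 0 < ε) (z : Eu N) : 0 < ‖z‖ ^ 2 + ε := by positivity

theorem K0_hasFDeriv {r ε : ℝ} (hε : 0 < ε) (z : Eu N) :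
    HasFDerivAt (K0 N r ε) (K1 N r ε z) z := by
  have h : HasDerivAt (kF0 N r ε) (kF1 N r ε (‖z - 0‖ ^ 2)) (‖z - 0‖ ^ 2) :=
    kF0_deriv (by simpa using pos_aux hε z)
  have := fderiv_radial 0 z h
  simp only [sub_zero] at this
  refine HasFDerivAt.congr_fderiv this ?_
  unfold K1
  ext; simp; ring

theorem K1_hasFDeriv {r ε : ℝ} (hε : 0 < ε) (z : Eu N) :
    HasFDerivAt (K1 N r ε) (K2 N r ε z) z := by
  have h : HasDerivAt (kF1 N r ε) (kF2 N r ε (‖z - 0‖ ^ 2)) (‖z - 0‖ ^ 2) :=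
    kF1_deriv (by simpa using pos_aux hε z)
  have h1 := fderiv_radial 0 z h
  simp only [sub_zero] at h1
  have h3 := (h1.const_mul 2).fun_smul (iSL N).hasFDerivAt
  refine HasFDerivAt.congr_fderiv h3 ?_
  unfold K2
  ext v w
  simp [iSL_apply]
  ring

theorem K0_contDiff {r ε : ℝ} (hε : 0 < ε) : ContDiff ℝ ∞ (K0 N r ε) := by
  unfold K0 kF0
  have h1 : ContDiff ℝ ∞ (fun z : Eu N => ‖z‖ ^ 2) := contDiff_norm_sq ℝ
  refine ((chi_contDiff r (n := ⊤)).comp h1).mul ?_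
  exact (h1.add contDiff_const).rpow_const_of_ne fun z => (pos_aux hε z).ne'

theorem fderiv_K0 {r ε : ℝ} (hε : 0 < ε) : fderiv ℝ (K0 N r ε) = K1 N r ε := by
  funext z; exact (K0_hasFDeriv hε z).fderiv

theorem fderiv_K1 {r ε : ℝ} (hε : 0 < ε) : fderiv ℝ (K1 N r ε) = K2 N r ε := by
  funext z; exact (K1_hasFDeriv hε z).fderiv

theorem K1_contDiff {r ε : ℝ} (hε : 0 < ε) : ContDiff ℝ ∞ (K1 N r ε) := by
  rw [← fderiv_K0 hε]
  exact (K0_contDiff hε).fderiv_right (by simp)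

theorem K0_zero {r ε : ℝ} (hr : 0 < r) {z : Eu N} (hz : z ∉ Metric.closedBall (0 : Eu N) r) :
    K0 N r ε z = 0 := by
  have h1 : r < ‖z‖ := by simpa using hz
  have h2 : r ^ 2 ≤ ‖z‖ ^ 2 := by gcongr
  simp [K0, kF0, chi_zero hr h2]

theorem K0_cs {r ε : ℝ} (hr : 0 < r) : HasCompactSupport (K0 N r ε) :=
  HasCompactSupport.intro (isCompact_closedBall 0 r) fun _ hz => K0_zero hr hz

theorem K1_cs {r ε : ℝ} (hr : 0 < r) (hε : 0 < ε) : HasCompactSupport (K1 N r ε) := by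
  rw [← fderiv_K0 hε]; exact (K0_cs hr).fderiv ℝ

noncomputable def dom (r s : ℝ) (z : Eu N) : ℝ :=
  (Metric.closedBall (0 : Eu N) r).indicator (fun z => ‖z‖ ^ (-s)) z

theorem dom_nonneg (r s : ℝ) (z : Eu N) : 0 ≤ dom r s z := by
  unfold dom
  exact indicator_nonneg (fun z _ => by positivity) z

theorem dom_integrable {r s : ℝ} (hN : 0 < N) (hs : s < N) : Integrable (dom (N := N) r s) := by
  have : Nontrivial (Eu N) := by
    have : Nonempty (Fin N) := ⟨⟨0, hN⟩⟩
    infer_instance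
  unfold dom
  rw [integrable_indicator_iff Metric.isClosed_closedBall.measurableSet]
  have h : IntegrableOn (fun z : Eu N => ‖z‖ ^ (-s)) (Metric.ball 0 (|r| + 1)) := by
    have := (integrableOn_fun_norm_addHaar (E := Eu N) volume (f := fun y : ℝ => y ^ (-s))
      (r := |r| + 1)).2
    apply this
    have h2 : IntegrableOn (fun y : ℝ => y ^ ((N:ℝ) - 1 - s)) (Ioo 0 (|r| + 1)) := by
      have := intervalIntegral.intervalIntegrable_rpow' (a := 0) (b := |r| + 1)
        (r := (N:ℝ) - 1 - s) (by linarith)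
      rw [intervalIntegrable_iff_integrableOn_Ioo_of_le (by positivity)] at this
      exact this
    refine h2.congr_fun (fun y hy => ?_) measurableSet_Ioo
    have hy0 : 0 < y := hy.1
    simp only [finrank_euclideanSpace, Fintype.card_fin, smul_eq_mul]
    rw [← Real.rpow_natCast, ← Real.rpow_add hy0]
    congr 1
    rw [Nat.cast_sub (by omega)]
    push_cast; ring
  refine h.mono_set ?_
  intro z hz
  simp only [Metric.mem_closedBall, dist_zero_right, Metric.mem_ball] at *
  linarith [le_abs_self r]

theorem dom_of_gt {r s : ℝ} {z : Eu N} (h : r < ‖z‖) : dom r s z = 0 := by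
  unfold dom; rw [indicator_of_notMem]; simpa using h

theorem dom_of_le {r s : ℝ} {z : Eu N} (h : ‖z‖ ≤ r) : dom r s z = ‖z‖ ^ (-s) := by
  unfold dom; rw [indicator_of_mem]; simpa using h

theorem nu_pos (hN : 3 ≤ N) : 0 < nu N := by
  unfold nu
  have : (3:ℝ) ≤ N := by exact_mod_cast hN
  linarith

theorem rpow_shift_le {ε τ s : ℝ} (hε : 0 ≤ ε) (hτ : 0 < τ) (hs : 0 ≤ s) :
    (τ + ε) ^ (-s) ≤ τ ^ (-s) :=
  Real.rpow_le_rpow_of_nonpos hτ (by linarith) (by linarith)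

end A3


open Set Filter Topology MeasureTheory
open scoped NNReal ContDiff

section A4
variable {N : ℕ}

noncomputable def omF (N : ℕ) (r ε τ : ℝ) : ℝ :=
  4 * τ * (deriv (deriv (chi r)) τ * (τ + ε) ^ (-nu N)
    - 2 * nu N * deriv (chi r) τ * (τ + ε) ^ (-nu N - 1))
  + 2 * N * (deriv (chi r) τ * (τ + ε) ^ (-nu N))

noncomputable def rhF (N : ℕ) (r ε τ : ℝ) : ℝ :=
  4 * nu N * (nu N + 1) * ε * (chi r τ * (τ + ε) ^ (-nu N - 2))

theorem kF_lap {r ε τ : ℝ} (h : 0 < τ + ε) :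
    4 * τ * kF2 N r ε τ + 2 * N * kF1 N r ε τ = omF N r ε τ - rhF N r ε τ := by
  have h1 : (τ + ε) ^ (-nu N - 1) = (τ + ε) * (τ + ε) ^ (-nu N - 2) := by
    rw [show -nu N - 1 = 1 + (-nu N - 2) by ring, Real.rpow_add h, Real.rpow_one]
  have h2 : (N : ℝ) = 2 * (nu N + 1) := by unfold nu; ring
  unfold kF2 kF1 omF rhF
  rw [h2, h1]
  ring

theorem kF_bound {r : ℝ} (hN : 3 ≤ N) (hr : 0 < r) : ∃ C, 0 < C ∧ ∀ ε τ : ℝ, 0 ≤ ε → 0 < τ → τ ≤ r ^ 2 →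
    |kF0 N r ε τ| ≤ C * τ ^ (-nu N) ∧ |kF1 N r ε τ| ≤ C * τ ^ (-nu N - 1) ∧
    |kF2 N r ε τ| ≤ C * τ ^ (-nu N - 2) ∧ |omF N r ε τ| ≤ C * τ ^ (-nu N) := by
  obtain ⟨c, hc1, hc⟩ := chi_bound (r := r)
  have hν := nu_pos hN
  set ν := nu N with hνd
  refine ⟨1 + (c * r ^ 2 + ν) + (c * r ^ 4 + 2 * c * ν * r ^ 2 + ν * (ν + 1))
    + (4 * r ^ 2 * c + 8 * ν * c + 2 * N * c), by positivity, ?_⟩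
  intro ε τ hε hτ hτr
  obtain ⟨hd1, hd2⟩ := hc τ ⟨hτ.le, hτr⟩
  set P := τ ^ (-ν) with hP
  set Q := τ ^ (-ν - 1) with hQ
  set S := τ ^ (-ν - 2) with hS
  have hPpos : 0 < P := Real.rpow_pos_of_pos hτ _
  have hQpos : 0 < Q := Real.rpow_pos_of_pos hτ _
  have hSpos : 0 < S := Real.rpow_pos_of_pos hτ _
  have hPQ : P = τ * Q := by
    rw [hP, hQ, show -ν = 1 + (-ν - 1) by ring, Real.rpow_add hτ, Real.rpow_one]; ring_nf
  have hQS : Q = τ * S := by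
    rw [hQ, hS, show -ν - 1 = 1 + (-ν - 2) by ring, Real.rpow_add hτ, Real.rpow_one]
  set P' := (τ + ε) ^ (-ν) with hP'
  set Q' := (τ + ε) ^ (-ν - 1) with hQ'
  set S' := (τ + ε) ^ (-ν - 2) with hS'
  have hτε : 0 < τ + ε := by linarith
  have hP'0 : 0 < P' := Real.rpow_pos_of_pos hτε _
  have hQ'0 : 0 < Q' := Real.rpow_pos_of_pos hτε _
  have hS'0 : 0 < S' := Real.rpow_pos_of_pos hτε _
  have hPP : P' ≤ P := Real.rpow_le_rpow_of_nonpos hτ (by linarith) (by linarith)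
  have hQQ : Q' ≤ Q := Real.rpow_le_rpow_of_nonpos hτ (by linarith) (by linarith)
  have hSS : S' ≤ S := Real.rpow_le_rpow_of_nonpos hτ (by linarith) (by linarith)
  have hPQ' : P ≤ r ^ 2 * Q := by rw [hPQ]; gcongr
  have hQS' : Q ≤ r ^ 2 * S := by rw [hQS]; gcongr
  have hch0 := chi_nonneg r τ
  have hch1 := chi_le_one r τ
  have hc0 : 0 ≤ c := by linarith
  have b1 : |deriv (chi r) τ * P'| ≤ c * P := by
    rw [abs_mul, abs_of_pos hP'0]; gcongr
  have b2 : |deriv (deriv (chi r)) τ * P'| ≤ c * P := by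
    rw [abs_mul, abs_of_pos hP'0]; gcongr
  have b3 : |deriv (chi r) τ * Q'| ≤ c * Q := by
    rw [abs_mul, abs_of_pos hQ'0]; gcongr
  have b4 : |chi r τ * P'| ≤ P := by
    rw [abs_mul, abs_of_pos hP'0, abs_of_nonneg hch0]; nlinarith
  have b5 : |chi r τ * Q'| ≤ Q := by
    rw [abs_mul, abs_of_pos hQ'0, abs_of_nonneg hch0]; nlinarith
  have b6 : |chi r τ * S'| ≤ S := by
    rw [abs_mul, abs_of_pos hS'0, abs_of_nonneg hch0]; nlinarith
  have n1 : 0 ≤ c * r ^ 2 + ν := by positivity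
  have n2 : 0 ≤ c * r ^ 4 + 2 * c * ν * r ^ 2 + ν * (ν + 1) := by positivity
  have n3 : 0 ≤ 4 * r ^ 2 * c + 8 * ν * c + 2 * N * c := by positivity
  refine ⟨?_, ?_, ?_, ?_⟩
  · have : |kF0 N r ε τ| ≤ 1 * P := by rw [one_mul]; exact b4
    exact this.trans (mul_le_mul_of_nonneg_right (by linarith) hPpos.le)
  · have : |kF1 N r ε τ| ≤ (c * r ^ 2 + ν) * Q := by
      have e : kF1 N r ε τ = deriv (chi r) τ * P' - ν * (chi r τ * Q') := by
        unfold kF1; ring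
      rw [e]
      refine (abs_sub _ _).trans ?_
      rw [abs_mul ν, abs_of_pos hν]
      have : c * P ≤ c * (r ^ 2 * Q) := by gcongr
      have : ν * |chi r τ * Q'| ≤ ν * Q := by gcongr
      linarith
    exact this.trans (mul_le_mul_of_nonneg_right (by linarith) hQpos.le)
  · have : |kF2 N r ε τ| ≤ (c * r ^ 4 + 2 * c * ν * r ^ 2 + ν * (ν + 1)) * S := by
      have e : kF2 N r ε τ = deriv (deriv (chi r)) τ * P' - 2 * ν * (deriv (chi r) τ * Q')
          + ν * (ν + 1) * (chi r τ * S') := by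
        unfold kF2; ring
      rw [e]
      refine (abs_add_le _ _).trans ?_
      have t1 := abs_sub (deriv (deriv (chi r)) τ * P') (2 * ν * (deriv (chi r) τ * Q'))
      rw [abs_mul (2 * ν), abs_of_pos (show 0 < 2 * ν by positivity)] at t1
      rw [abs_mul (ν * (ν + 1)), abs_of_pos (show 0 < ν * (ν + 1) by positivity)]
      have i1 : c * P ≤ c * (r ^ 2 * (r ^ 2 * S)) := by
        have : P ≤ r ^ 2 * (r ^ 2 * S) := hPQ'.trans (by gcongr)
        gcongr
      have i2 : 2 * ν * |deriv (chi r) τ * Q'| ≤ 2 * ν * (c * (r ^ 2 * S)) := by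
        have : |deriv (chi r) τ * Q'| ≤ c * (r ^ 2 * S) := b3.trans (by gcongr)
        gcongr
      have i3 : ν * (ν + 1) * |chi r τ * S'| ≤ ν * (ν + 1) * S := by gcongr
      linarith
    exact this.trans (mul_le_mul_of_nonneg_right (by linarith) hSpos.le)
  · have : |omF N r ε τ| ≤ (4 * r ^ 2 * c + 8 * ν * c + 2 * N * c) * P := by
      have e : omF N r ε τ = 4 * τ * (deriv (deriv (chi r)) τ * P')
          - 8 * ν * τ * (deriv (chi r) τ * Q') + 2 * N * (deriv (chi r) τ * P') := by
        unfold omF; ring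
      rw [e]
      refine (abs_add_le _ _).trans ?_
      have t1 := abs_sub (4 * τ * (deriv (deriv (chi r)) τ * P'))
        (8 * ν * τ * (deriv (chi r) τ * Q'))
      rw [abs_mul (8 * ν * τ), abs_mul (4 * τ), abs_of_pos (show 0 < 8 * ν * τ by positivity),
        abs_of_pos (show 0 < 4 * τ by positivity)] at t1
      rw [abs_mul (2 * (N:ℝ)), abs_of_nonneg (show (0:ℝ) ≤ 2 * N by positivity)]
      have i1 : 4 * τ * |deriv (deriv (chi r)) τ * P'| ≤ 4 * r ^ 2 * (c * P) := by gcongr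
      have i2 : 8 * ν * τ * |deriv (chi r) τ * Q'| ≤ 8 * ν * τ * (c * Q) := by gcongr
      have i2' : 8 * ν * τ * (c * Q) = 8 * ν * c * P := by rw [hPQ]; ring
      have i3 : 2 * (N:ℝ) * |deriv (chi r) τ * P'| ≤ 2 * N * (c * P) := by gcongr
      linarith
    exact this.trans (mul_le_mul_of_nonneg_right (by linarith) hPpos.le)

theorem kF_zero {r ε τ : ℝ} (hr : 0 < r) (h : r ^ 2 < τ) :
    kF0 N r ε τ = 0 ∧ kF1 N r ε τ = 0 ∧ kF2 N r ε τ = 0 ∧ omF N r ε τ = 0 := by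
  simp [kF0, kF1, kF2, omF, chi_zero hr h.le, chi_deriv_zero hr (Or.inr h),
    chi_deriv2_zero hr (Or.inr h)]

noncomputable def Om (N : ℕ) (r ε : ℝ) (z : Eu N) : ℝ := omF N r ε (‖z‖ ^ 2)
noncomputable def Rh (N : ℕ) (r ε : ℝ) (z : Eu N) : ℝ := rhF N r ε (‖z‖ ^ 2)

theorem lap_K0 {r ε : ℝ} (hε : 0 < ε) (z : Eu N) :
    lap (K0 N r ε) z = Om N r ε z - Rh N r ε z := by
  have h0 : 0 < ‖z - 0‖ ^ 2 + ε := by simpa using pos_aux hε z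
  have h1 : ∀ᶠ t in 𝓝 (‖z - 0‖ ^ 2), HasDerivAt (kF0 N r ε) (kF1 N r ε t) t := by
    have : ∀ᶠ t in 𝓝 (‖z - 0‖ ^ 2), 0 < t + ε :=
      (continuous_id.add continuous_const).continuousAt.eventually (lt_mem_nhds h0)
    filter_upwards [this] with t ht using kF0_deriv ht
  have := lap_radial 0 z h1 (kF1_deriv h0)
  simp only [sub_zero] at this h0
  rw [kF_lap h0] at this
  exact this

theorem norm_rpow_aux (z : Eu N) (s : ℝ) : (‖z‖ ^ 2) ^ s = ‖z‖ ^ (2 * s) := by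
  rw [← Real.rpow_natCast, ← Real.rpow_mul (norm_nonneg z)]; norm_num

theorem K2_apply (r ε : ℝ) (z v w : Eu N) : K2 N r ε z v w =
    4 * kF2 N r ε (‖z‖ ^ 2) * (inner ℝ z v * inner ℝ z w)
      + 2 * kF1 N r ε (‖z‖ ^ 2) * inner ℝ v w := by
  unfold K2
  simp [iSL_apply]

theorem K2_norm_le {r ε c : ℝ} {z : Eu N} (hc : 0 ≤ c)
    (h : 4 * |kF2 N r ε (‖z‖ ^ 2)| * ‖z‖ ^ 2 + 2 * |kF1 N r ε (‖z‖ ^ 2)| ≤ c) :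
    ‖K2 N r ε z‖ ≤ c := by
  refine ContinuousLinearMap.opNorm_le_bound _ hc fun v => ?_
  refine ContinuousLinearMap.opNorm_le_bound _ (by positivity) fun w => ?_
  rw [K2_apply, Real.norm_eq_abs]
  refine (abs_add_le _ _).trans ?_
  simp only [abs_mul, abs_two, abs_of_pos (show (0:ℝ) < 4 by norm_num)]
  have h1 := abs_real_inner_le_norm z v
  have h2 := abs_real_inner_le_norm z w
  have h3 := abs_real_inner_le_norm v w
  calc _ ≤ 4 * |kF2 N r ε (‖z‖ ^ 2)| * ((‖z‖ * ‖v‖) * (‖z‖ * ‖w‖))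
        + 2 * |kF1 N r ε (‖z‖ ^ 2)| * (‖v‖ * ‖w‖) := by gcongr
    _ = (4 * |kF2 N r ε (‖z‖ ^ 2)| * ‖z‖ ^ 2 + 2 * |kF1 N r ε (‖z‖ ^ 2)|) * (‖v‖ * ‖w‖) := by ring
    _ ≤ c * (‖v‖ * ‖w‖) := by gcongr
    _ = _ := by ring

theorem K_bound {r : ℝ} (hN : 3 ≤ N) (hr : 0 < r) : ∃ C, 0 < C ∧ ∀ ε : ℝ, 0 ≤ ε → ∀ z : Eu N, z ≠ 0 →
    ‖K0 N r ε z‖ ≤ C * dom r (N - 2) z ∧ ‖K1 N r ε z‖ ≤ C * dom r (N - 1) z ∧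
    ‖K2 N r ε z‖ ≤ C * dom r N z ∧ ‖Om N r ε z‖ ≤ C * dom r (N - 2) z := by
  obtain ⟨C, hC0, hC⟩ := kF_bound (N := N) hN hr
  refine ⟨6 * C, by positivity, fun ε hε z hz => ?_⟩
  have hz0 : 0 < ‖z‖ := norm_pos_iff.2 hz
  rcases lt_or_ge r ‖z‖ with h | h
  · have h2 : r ^ 2 < ‖z‖ ^ 2 := by gcongr
    obtain ⟨e0, e1, e2, e3⟩ := kF_zero (N := N) (ε := ε) hr h2
    rw [dom_of_gt h, dom_of_gt h, dom_of_gt h, mul_zero]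
    refine ⟨?_, ?_, K2_norm_le le_rfl ?_, ?_⟩
    · rw [K0, e0, norm_zero]
    · rw [K1, e1, mul_zero, zero_smul, norm_zero]
    · rw [e1, e2]; simp
    · rw [Om, e3, norm_zero]
  · have h2 : ‖z‖ ^ 2 ≤ r ^ 2 := by gcongr
    obtain ⟨e0, e1, e2, e3⟩ := hC ε (‖z‖ ^ 2) hε (by positivity) h2
    rw [norm_rpow_aux] at e0 e1 e2 e3
    rw [dom_of_le h, dom_of_le h, dom_of_le h]
    have x0 : ‖z‖ ^ (2 * -nu N) = ‖z‖ ^ (-((N:ℝ) - 2)) := by congr 1; unfold nu; ring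
    have x1 : ‖z‖ ^ (2 * (-nu N - 1)) * ‖z‖ = ‖z‖ ^ (-((N:ℝ) - 1)) := by
      nth_rewrite 2 [← Real.rpow_one ‖z‖]
      rw [← Real.rpow_add hz0]; congr 1; unfold nu; ring
    have x2 : ‖z‖ ^ (2 * (-nu N - 2)) * ‖z‖ ^ 2 = ‖z‖ ^ (-(N:ℝ)) := by
      rw [← Real.rpow_natCast, ← Real.rpow_add hz0]; congr 1; unfold nu; push_cast; ring
    have x3 : ‖z‖ ^ (2 * (-nu N - 1)) = ‖z‖ ^ (-(N:ℝ)) := by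
      congr 1; unfold nu; ring
    have p0 : 0 ≤ ‖z‖ ^ (-((N:ℝ) - 2)) := by positivity
    have p1 : 0 ≤ ‖z‖ ^ (-((N:ℝ) - 1)) := by positivity
    have p2 : 0 ≤ ‖z‖ ^ (-(N:ℝ)) := by positivity
    rw [x0] at e0 e3
    refine ⟨?_, ?_, ?_, ?_⟩
    · refine e0.trans ?_; nlinarith
    · unfold K1
      rw [norm_smul, innerSL_apply_norm, Real.norm_eq_abs, abs_mul, abs_two]
      calc 2 * |kF1 N r ε (‖z‖ ^ 2)| * ‖z‖ ≤ 2 * (C * ‖z‖ ^ (2 * (-nu N - 1))) * ‖z‖ := by gcongr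
        _ = 2 * C * ‖z‖ ^ (-((N:ℝ) - 1)) := by rw [← x1]; ring
        _ ≤ _ := by nlinarith
    · refine K2_norm_le (by positivity) ?_
      have a1 : 4 * |kF2 N r ε (‖z‖ ^ 2)| * ‖z‖ ^ 2 ≤ 4 * (C * ‖z‖ ^ (-(N:ℝ))) := by
        calc 4 * |kF2 N r ε (‖z‖ ^ 2)| * ‖z‖ ^ 2
            ≤ 4 * (C * ‖z‖ ^ (2 * (-nu N - 2))) * ‖z‖ ^ 2 := by gcongr
          _ = 4 * (C * ‖z‖ ^ (-(N:ℝ))) := by rw [← x2]; ring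
      rw [x3] at e1
      linarith
    · refine e3.trans ?_; nlinarith

end A4


open Set Filter Topology MeasureTheory
open scoped NNReal ContDiff

section A5
variable {N : ℕ} {F : Type*} [NormedAddCommGroup F] [NormedSpace ℝ F]

noncomputable instance instNACGb : NormedAddCommGroup (Eu N →L[ℝ] Eu N →L[ℝ] ℝ) :=
  ContinuousLinearMap.toNormedAddCommGroup
noncomputable instance instNSb : NormedSpace ℝ (Eu N →L[ℝ] Eu N →L[ℝ] ℝ) :=
  ContinuousLinearMap.toNormedSpace
noncomputable instance instNSMb : NormSMulClass ℝ (Eu N →L[ℝ] Eu N →L[ℝ] ℝ) :=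
  NormedSpace.toNormSMulClass

noncomputable instance instACGb : AddCommGroup (Eu N →L[ℝ] Eu N →L[ℝ] ℝ) :=
  NormedAddCommGroup.toAddCommGroup
noncomputable instance instAGb : AddGroup (Eu N →L[ℝ] Eu N →L[ℝ] ℝ) :=
  AddCommGroup.toAddGroup
noncomputable instance instACMb : AddCommMonoid (Eu N →L[ℝ] Eu N →L[ℝ] ℝ) :=
  AddCommGroup.toAddCommMonoid
noncomputable instance instSNMb : SubNegMonoid (Eu N →L[ℝ] Eu N →L[ℝ] ℝ) :=
  AddGroup.toSubNegMonoid
noncomputable instance instAMb : AddMonoid (Eu N →L[ℝ] Eu N →L[ℝ] ℝ) :=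
  SubNegMonoid.toAddMonoid
noncomputable instance instAZb : AddZeroClass (Eu N →L[ℝ] Eu N →L[ℝ] ℝ) :=
  AddMonoid.toAddZeroClass

noncomputable def del (k : ℕ) : ℝ := 1 / ((k : ℝ) + 1)
noncomputable def eps (k : ℕ) : ℝ := del k ^ 2

theorem del_pos (k : ℕ) : 0 < del k := by unfold del; positivity
theorem eps_pos (k : ℕ) : 0 < eps k := pow_pos (del_pos k) 2
theorem del_tendsto : Tendsto del atTop (𝓝 0) := tendsto_one_div_add_atTop_nhds_zero_nat
theorem eps_tendsto : Tendsto eps atTop (𝓝 0) := by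
  have := del_tendsto.pow 2
  rw [zero_pow two_ne_zero] at this
  exact this

theorem ae_ne_zero (hN : 0 < N) : ∀ᵐ z : Eu N, z ≠ 0 := by
  have : Nonempty (Fin N) := ⟨⟨0, hN⟩⟩
  have : Nontrivial (Eu N) := inferInstance
  exact Measure.ae_ne volume 0

theorem dct_norm (hN : 0 < N) {Φ : ℕ → Eu N → F} {Φ0 : Eu N → F} {g : Eu N → ℝ} (hg : Integrable g)
    (hc : ∀ k, Continuous (Φ k)) (hb : ∀ k, ∀ z, z ≠ 0 → ‖Φ k z‖ ≤ g z)
    (hb0 : ∀ z, z ≠ 0 → ‖Φ0 z‖ ≤ g z)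
    (hl : ∀ z, z ≠ 0 → Tendsto (fun k => Φ k z) atTop (𝓝 (Φ0 z))) :
    (∀ k, Integrable (Φ k)) ∧ Integrable Φ0 ∧
      Tendsto (fun k => ∫ z, ‖Φ k z - Φ0 z‖) atTop (𝓝 0) := by
  have hae := ae_ne_zero hN
  have i1 : ∀ k, Integrable (Φ k) := fun k => hg.mono' (hc k).aestronglyMeasurable
    (hae.mono fun z hz => hb k z hz)
  have m0 : AEStronglyMeasurable Φ0 volume := by
    refine aestronglyMeasurable_of_tendsto_ae atTop (fun k => (hc k).aestronglyMeasurable)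
      (hae.mono fun z hz => hl z hz)
  have i0 : Integrable Φ0 := hg.mono' m0 (hae.mono fun z hz => hb0 z hz)
  refine ⟨i1, i0, ?_⟩
  have := tendsto_integral_of_dominated_convergence (μ := (volume : Measure (Eu N)))
    (F := fun k z => ‖Φ k z - Φ0 z‖) (f := fun _ => (0:ℝ)) (bound := fun z => 2 * g z)
    (fun k => ((i1 k).sub i0).norm.aestronglyMeasurable) (hg.const_mul 2)
    (fun k => hae.mono fun z hz => ?_) (hae.mono fun z hz => ?_)
  · simpa using this
  · rw [norm_norm]
    refine (norm_sub_le _ _).trans ?_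
    linarith [hb k z hz, hb0 z hz]
  · have := (hl z hz).sub_const (Φ0 z)
    simpa using this.norm

theorem rpow_eps {τ s : ℝ} (hτ : 0 < τ) :
    Tendsto (fun k => (τ + eps k) ^ s) atTop (𝓝 ((τ + 0) ^ s)) := by
  have h1 : Tendsto (fun k => τ + eps k) atTop (𝓝 (τ + 0)) := eps_tendsto.const_add τ
  exact h1.rpow_const (Or.inl (by linarith))

theorem kF_tendsto (N : ℕ) (r : ℝ) {τ : ℝ} (hτ : 0 < τ) :
    Tendsto (fun k => kF0 N r (eps k) τ) atTop (𝓝 (kF0 N r 0 τ)) ∧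
    Tendsto (fun k => kF1 N r (eps k) τ) atTop (𝓝 (kF1 N r 0 τ)) ∧
    Tendsto (fun k => kF2 N r (eps k) τ) atTop (𝓝 (kF2 N r 0 τ)) ∧
    Tendsto (fun k => omF N r (eps k) τ) atTop (𝓝 (omF N r 0 τ)) := by
  have h0 := rpow_eps (s := -nu N) hτ
  have h1 := rpow_eps (s := -nu N - 1) hτ
  have h2 := rpow_eps (s := -nu N - 2) hτ
  refine ⟨h0.const_mul _, (h0.const_mul _).add ((h1.const_mul _).const_mul _),
    ((h0.const_mul _).add ((h1.const_mul _).const_mul _)).add ((h2.const_mul _).const_mul _), ?_⟩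
  exact (((h0.const_mul _).sub (h1.const_mul _)).const_mul _).add ((h0.const_mul _).const_mul _)

theorem Rh_continuous {r ε : ℝ} (hε : 0 < ε) : Continuous (Rh N r ε) := by
  unfold Rh rhF
  have h1 : Continuous (fun z : Eu N => ‖z‖ ^ 2) := by fun_prop
  have h2 : Continuous (fun z : Eu N => chi r (‖z‖ ^ 2)) :=
    (chi_contDiff r (n := 1)).continuous.comp h1
  refine continuous_const.mul (h2.mul ?_)
  exact (h1.add continuous_const).rpow_const fun z => Or.inl (pos_aux hε z).ne'

theorem Om_continuous {r ε : ℝ} (hε : 0 < ε) : Continuous (Om N r ε) := by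
  have : Om N r ε = fun z => lap (K0 N r ε) z + Rh N r ε z := by
    funext z; rw [lap_K0 hε]; ring
  rw [this]
  exact (lap_contDiff (K0_contDiff hε)).continuous.add (Rh_continuous hε)

theorem K_lim0 {r : ℝ} (hN : 3 ≤ N) (hr : 0 < r) :
    (∀ k, Integrable (K0 N r (eps k))) ∧ Integrable (K0 N r 0) ∧
      Tendsto (fun k => ∫ z, ‖K0 N r (eps k) z - K0 N r 0 z‖) atTop (𝓝 0) := by
  obtain ⟨C, hC, h⟩ := K_bound hN hr
  refine dct_norm (by omega) ((dom_integrable (by omega) (by linarith)).const_mul C)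
    (fun k => (K0_contDiff (eps_pos k)).continuous) (fun k z hz => (h _ (eps_pos k).le z hz).1)
    (fun z hz => (h _ le_rfl z hz).1) fun z hz => ?_
  have : 0 < ‖z‖ := norm_pos_iff.2 hz
  exact (kF_tendsto N r (by positivity)).1

theorem K_lim1 {r : ℝ} (hN : 3 ≤ N) (hr : 0 < r) :
    (∀ k, Integrable (K1 N r (eps k))) ∧ Integrable (K1 N r 0) ∧
      Tendsto (fun k => ∫ z, ‖K1 N r (eps k) z - K1 N r 0 z‖) atTop (𝓝 0) := by
  obtain ⟨C, hC, h⟩ := K_bound hN hr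
  refine dct_norm (by omega) ((dom_integrable (by omega) (by linarith)).const_mul C)
    (fun k => (K1_contDiff (eps_pos k)).continuous) (fun k z hz => (h _ (eps_pos k).le z hz).2.1)
    (fun z hz => (h _ le_rfl z hz).2.1) fun z hz => ?_
  have : 0 < ‖z‖ := norm_pos_iff.2 hz
  exact ((kF_tendsto N r (by positivity)).2.1.const_mul 2).smul_const _

theorem K_limO {r : ℝ} (hN : 3 ≤ N) (hr : 0 < r) :
    (∀ k, Integrable (Om N r (eps k))) ∧ Integrable (Om N r 0) ∧
      Tendsto (fun k => ∫ z, ‖Om N r (eps k) z - Om N r 0 z‖) atTop (𝓝 0) := by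
  obtain ⟨C, hC, h⟩ := K_bound hN hr
  refine dct_norm (by omega) ((dom_integrable (by omega) (by linarith)).const_mul C)
    (fun k => Om_continuous (eps_pos k)) (fun k z hz => (h _ (eps_pos k).le z hz).2.2.2)
    (fun z hz => (h _ le_rfl z hz).2.2.2) fun z hz => ?_
  have : 0 < ‖z‖ := norm_pos_iff.2 hz
  exact (kF_tendsto N r (by positivity)).2.2.2

theorem K2_continuous {r ε : ℝ} (hε : 0 < ε) : Continuous (K2 N r ε) := by
  rw [← fderiv_K1 hε]
  exact (K1_contDiff hε).continuous_fderiv (by simp)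

theorem K_lim2 {r : ℝ} (hN : 3 ≤ N) (hr : 0 < r) :
    (∀ k, Integrable (fun z => ‖z‖ • K2 N r (eps k) z)) ∧ Integrable (fun z => ‖z‖ • K2 N r 0 z) ∧
      Tendsto (fun k => ∫ z, ‖‖z‖ • K2 N r (eps k) z - ‖z‖ • K2 N r 0 z‖) atTop (𝓝 0) := by
  obtain ⟨C, hC, h⟩ := K_bound hN hr
  have key : ∀ ε, 0 ≤ ε → ∀ z : Eu N, z ≠ 0 → ‖‖z‖ • K2 N r ε z‖ ≤ C * dom r (N - 1) z := by
    intro ε hε z hz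
    have hz0 : 0 < ‖z‖ := norm_pos_iff.2 hz
    rw [norm_smul, norm_norm]
    have h2 := (h ε hε z hz).2.2.1
    calc ‖z‖ * ‖K2 N r ε z‖ ≤ ‖z‖ * (C * dom r N z) := by gcongr
      _ = C * dom r (N - 1) z := by
        rcases lt_or_ge r ‖z‖ with h | h
        · rw [dom_of_gt h, dom_of_gt h]; ring
        · rw [dom_of_le h, dom_of_le h, show -((N:ℝ) - 1) = 1 + (-N) by ring,
            Real.rpow_add hz0, Real.rpow_one]; ring
  refine dct_norm (by omega) ((dom_integrable (by omega) (by linarith)).const_mul C)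
    (fun k => continuous_norm.smul (K2_continuous (eps_pos k))) (fun k z hz => key _ (eps_pos k).le z hz)
    (fun z hz => key _ le_rfl z hz) fun z hz => ?_
  have : 0 < ‖z‖ := norm_pos_iff.2 hz
  obtain ⟨_, t1, t2, _⟩ := kF_tendsto N r (τ := ‖z‖ ^ 2) (by positivity)
  exact Tendsto.const_smul (((t2.const_mul 4).smul_const _).add ((t1.const_mul 2).smul_const _)) _

end A5


open Set Filter Topology MeasureTheory
open scoped NNReal ContDiff

section A6
variable {N : ℕ} {F : Type*} [NormedAddCommGroup F] [NormedSpace ℝ F]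

theorem Om_contDiff {r : ℝ} (hr : 0 < r) : ContDiff ℝ ∞ (Om N r 0) := by
  rw [contDiff_iff_contDiffAt]
  intro z
  have h1 : ContDiff ℝ ∞ (fun z : Eu N => ‖z‖ ^ 2) := contDiff_norm_sq ℝ
  by_cases hz : z = 0
  · have : Om N r 0 =ᶠ[𝓝 z] fun _ => 0 := by
      have h2 : ∀ᶠ y in 𝓝 z, ‖y‖ ^ 2 < r ^ 2 / 2 := by
        refine h1.continuous.continuousAt.eventually (gt_mem_nhds ?_)
        subst hz; simp; positivity
      filter_upwards [h2] with y hy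
      simp [Om, omF, chi_deriv_zero hr (Or.inl hy), chi_deriv2_zero hr (Or.inl hy)]
    exact contDiffAt_const.congr_of_eventuallyEq this
  · have hz0 : ‖z‖ ^ 2 + 0 ≠ 0 := by simpa using hz
    have h2 : ContDiffAt ℝ ∞ (fun y : Eu N => ‖y‖ ^ 2) z := h1.contDiffAt
    have p : ∀ s : ℝ, ContDiffAt ℝ ∞ (fun y : Eu N => (‖y‖ ^ 2 + 0) ^ s) z := fun s =>
      (h2.add contDiffAt_const).rpow_const_of_ne hz0
    have c1 : ContDiffAt ℝ ∞ (fun y : Eu N => deriv (chi r) (‖y‖ ^ 2)) z :=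
      ((chi_deriv_contDiff r).comp h1).contDiffAt
    have c2 : ContDiffAt ℝ ∞ (fun y : Eu N => deriv (deriv (chi r)) (‖y‖ ^ 2)) z :=
      ((chi_deriv2_contDiff r).comp h1).contDiffAt
    unfold Om omF
    exact ((contDiffAt_const.mul h2).mul ((c2.mul (p _)).sub ((contDiffAt_const.mul c1).mul (p _)))).add
      (contDiffAt_const.mul (c1.mul (p _)))

theorem Om_zero {r ε : ℝ} (hr : 0 < r) {z : Eu N} (hz : z ∉ Metric.closedBall (0 : Eu N) r) :
    Om N r ε z = 0 := by
  have h1 : r < ‖z‖ := by simpa using hz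
  have h2 : r ^ 2 < ‖z‖ ^ 2 := by gcongr
  exact (kF_zero hr h2).2.2.2

theorem Om_cs {r ε : ℝ} (hr : 0 < r) : HasCompactSupport (Om N r ε) :=
  HasCompactSupport.intro (isCompact_closedBall 0 r) fun _ hz => Om_zero hr hz

/-- weak form of `-Δ u = h` on an open set -/
def Wk (Ω : Set (Eu N)) (u h : Eu N → ℝ) : Prop :=
  ∀ φ : Eu N → ℝ, ContDiff ℝ ∞ φ → HasCompactSupport φ → tsupport φ ⊆ Ω →
    ∫ t, u t * lap φ t = - ∫ t, h t * φ t

theorem fderiv_comp_sub_left' {f : Eu N → F} (x t : Eu N) (hf : DifferentiableAt ℝ f (x - t)) :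
    fderiv ℝ (fun s => f (x - s)) t = - fderiv ℝ f (x - t) := by
  have h1 : HasFDerivAt (fun s : Eu N => x - s) (-(ContinuousLinearMap.id ℝ (Eu N))) t :=
    (hasFDerivAt_id t).const_sub x
  have : HasFDerivAt (fun s => f (x - s)) _ t := hf.hasFDerivAt.comp t h1
  rw [HasFDerivAt.fderiv this]
  ext v; simp

theorem lap_comp_sub_left {φ : Eu N → ℝ} (hφ : ContDiff ℝ 2 φ) (x t : Eu N) :
    lap (fun s => φ (x - s)) t = lap φ (x - t) := by
  unfold lap
  refine Finset.sum_congr rfl fun i _ => ?_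
  have h1 : (fun y => fderiv ℝ (fun s => φ (x - s)) y (EuclideanSpace.single i 1))
      = fun y => (fun w => - fderiv ℝ φ w (EuclideanSpace.single i 1)) (x - y) := by
    funext y
    rw [fderiv_comp_sub_left' x y ((hφ.differentiable (by simp)) _)]; simp
  have h2 : Differentiable ℝ (fun w => fderiv ℝ φ w (EuclideanSpace.single i 1)) :=
    ((hφ.fderiv_right (m := 1) (by norm_num)).clm_apply contDiff_const).differentiable (by simp)
  rw [h1, fderiv_comp_sub_left' x t (h2.fun_neg _)]
  rw [fderiv_fun_neg]; simp

theorem Wk.cv {Ω : Set (Eu N)} {u h : Eu N → ℝ} (hw : Wk Ω u h) {φ : Eu N → ℝ}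
    (hφ : ContDiff ℝ ∞ φ) {r : ℝ} (hr : ∀ z, z ∉ Metric.closedBall (0 : Eu N) r → φ z = 0)
    {x : Eu N} (hx : Metric.closedBall x r ⊆ Ω) :
    cv u (lap φ) x = - cv h φ x := by
  have hsub : tsupport (fun t => φ (x - t)) ⊆ Metric.closedBall x r := by
    refine closure_minimal ?_ Metric.isClosed_closedBall
    intro t ht
    by_contra hn
    refine ht (hr _ ?_)
    simpa [dist_eq_norm, norm_sub_rev] using hn
  have := hw (fun t => φ (x - t)) (hφ.comp (by fun_prop))
    ((isCompact_closedBall x r).of_isClosed_subset (isClosed_tsupport _) hsub) (hsub.trans hx)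
  unfold _root_.cv
  simp only [smul_eq_mul]
  rw [← this]
  refine integral_congr_ae (Eventually.of_forall fun t => ?_)
  simp only
  rw [lap_comp_sub_left (hφ.of_le (WithTop.coe_le_coe.2 le_top))]

noncomputable def cN (N : ℕ) : ℝ :=
  ∫ z : Eu N, 4 * nu N * (nu N + 1) * (1 + ‖z‖ ^ 2) ^ (-((N:ℝ) + 2) / 2)

theorem cN_integrable (N : ℕ) :
    Integrable (fun z : Eu N => 4 * nu N * (nu N + 1) * (1 + ‖z‖ ^ 2) ^ (-((N:ℝ) + 2) / 2)) := by
  refine Integrable.const_mul ?_ _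
  exact integrable_rpow_neg_one_add_norm_sq (by simp)

theorem cN_pos (hN : 3 ≤ N) : 0 < cN N := by
  have hν := nu_pos hN
  unfold cN
  have hp : ∀ z : Eu N, 0 < 4 * nu N * (nu N + 1) * (1 + ‖z‖ ^ 2) ^ (-((N:ℝ) + 2) / 2) :=
    fun z => by positivity
  rw [integral_pos_iff_support_of_nonneg (fun z => (hp z).le) (cN_integrable N)]
  rw [Function.support_eq_univ fun z => (hp z).ne']
  exact Measure.measure_univ_pos.2 (NeZero.ne _)

theorem cv_swap (f : Eu N → ℝ) (Φ : Eu N → F) (x : Eu N) :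
    cv f Φ x = ∫ z, f (x - z) • Φ z := by
  unfold cv
  rw [← integral_sub_left_eq_self (fun z => f (x - z) • Φ z) volume x]
  simp

theorem Bdm.comp_affine {u : Eu N → ℝ} {M : ℝ} (hu : Bdm u M) (x : Eu N) {d : ℝ} (hd : d ≠ 0) :
    AEStronglyMeasurable (fun z : Eu N => u (x - d • z)) volume := by
  have h1 : AEStronglyMeasurable (fun z : Eu N => u (x - z)) volume :=
    hu.meas.comp_quasiMeasurePreserving (quasiMeasurePreserving_sub_left volume x)
  have h2 : Measure.QuasiMeasurePreserving (fun z : Eu N => d • z) volume volume := by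
    refine ⟨by fun_prop, ?_⟩
    rw [Measure.map_addHaar_smul volume hd]
    exact Measure.smul_absolutelyContinuous
  exact h1.comp_quasiMeasurePreserving h2

theorem Rh_scale {r d : ℝ} (hd : 0 < d) (z : Eu N) :
    d ^ N * Rh N r (d ^ 2) (d • z) = chi r (‖d • z‖ ^ 2) *
      (4 * nu N * (nu N + 1) * (1 + ‖z‖ ^ 2) ^ (-((N:ℝ) + 2) / 2)) := by
  unfold Rh rhF
  have e1 : ‖d • z‖ ^ 2 + d ^ 2 = d ^ 2 * (1 + ‖z‖ ^ 2) := by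
    rw [norm_smul, mul_pow, Real.norm_eq_abs, sq_abs]; ring
  have e2 : -nu N - 2 = -((N:ℝ) + 2) / 2 := by unfold nu; ring
  have e3 : d ^ N * d ^ 2 * (d ^ 2) ^ (-((N:ℝ) + 2) / 2) = 1 := by
    rw [← Real.rpow_natCast d 2, ← Real.rpow_natCast d N, ← Real.rpow_mul hd.le,
      ← Real.rpow_add hd, ← Real.rpow_add hd]
    have : (N:ℝ) + ((2:ℕ):ℝ) + ((2:ℕ):ℝ) * (-((N:ℝ) + 2) / 2) = 0 := by push_cast; ring
    rw [this, Real.rpow_zero]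
  rw [e1, e2, Real.mul_rpow (by positivity) (by positivity)]
  linear_combination (4 * nu N * (nu N + 1) * chi r (‖d • z‖ ^ 2) *
    (1 + ‖z‖ ^ 2) ^ (-((N:ℝ) + 2) / 2)) * e3

theorem Rh_approx {r : ℝ} (hr : 0 < r) {u : Eu N → ℝ} {M : ℝ} (hN : 3 ≤ N) (hu : Bdm u M) {x : Eu N}
    (hx : ContinuousAt u x) :
    Tendsto (fun k => cv u (Rh N r (eps k)) x) atTop (𝓝 (cN N * u x)) := by
  have hν := nu_pos hN
  set g : Eu N → ℝ := fun z => 4 * nu N * (nu N + 1) * (1 + ‖z‖ ^ 2) ^ (-((N:ℝ) + 2) / 2) with hg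
  have hg0 : ∀ z, 0 ≤ g z := fun z => by simp only [hg]; positivity
  have e : ∀ k, cv u (Rh N r (eps k)) x
      = ∫ z, u (x - del k • z) * (chi r (‖del k • z‖ ^ 2) * g z) := by
    intro k
    rw [cv_swap]
    have hd := del_pos k
    have := Measure.integral_comp_smul (volume : Measure (Eu N))
      (fun z => u (x - z) • Rh N r (eps k) z) (del k)
    have h2 : ∫ z, u (x - z) • Rh N r (eps k) z
        = ∫ z, del k ^ N * (u (x - del k • z) • Rh N r (eps k) (del k • z)) := by
      rw [integral_const_mul, this]
      rw [finrank_euclideanSpace, Fintype.card_fin, abs_of_pos (by positivity), smul_eq_mul,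
        ← mul_assoc, mul_inv_cancel₀ (by positivity), one_mul]
    rw [h2]
    refine integral_congr_ae (Eventually.of_forall fun z => ?_)
    simp only [hg]
    rw [← Rh_scale hd z]
    unfold eps
    rw [smul_eq_mul]; ring
  simp_rw [e]
  have hlim : cN N * u x = ∫ z, u x * g z := by
    rw [integral_const_mul, mul_comm]; rfl
  rw [hlim]
  have hcz : ∀ z : Eu N, Tendsto (fun k => del k • z) atTop (𝓝 0) := fun z => by
    simpa using del_tendsto.smul_const z
  have hcc : Continuous (fun z : Eu N => chi r (‖z‖ ^ 2)) :=
    (chi_contDiff r (n := 1)).continuous.comp (by fun_prop)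
  refine tendsto_integral_of_dominated_convergence (fun z => M * g z) (fun k => ?_)
    ((cN_integrable N).const_mul M) (fun k => Eventually.of_forall fun z => ?_)
    (Eventually.of_forall fun z => ?_)
  · refine (hu.comp_affine x (del_pos k).ne').mul ?_
    refine AEStronglyMeasurable.mul ?_ (cN_integrable N).aestronglyMeasurable
    exact (hcc.comp (continuous_const_smul _)).aestronglyMeasurable
  · rw [norm_mul, norm_mul, Real.norm_of_nonneg (chi_nonneg _ _), Real.norm_of_nonneg (hg0 z)]
    have h1 := hu.bd (x - del k • z)
    have h2 := chi_le_one r (‖del k • z‖ ^ 2)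
    have h3 : chi r (‖del k • z‖ ^ 2) * g z ≤ 1 * g z := mul_le_mul_of_nonneg_right h2 (hg0 z)
    have h4 : 0 ≤ chi r (‖del k • z‖ ^ 2) * g z := mul_nonneg (chi_nonneg _ _) (hg0 z)
    rw [one_mul] at h3
    exact mul_le_mul h1 h3 h4 hu.nonneg
  · have t1 : Tendsto (fun k => u (x - del k • z)) atTop (𝓝 (u x)) := by
      have : Tendsto (fun k => x - del k • z) atTop (𝓝 x) := by
        simpa using (hcz z).const_sub x
      exact hx.tendsto.comp this
    have t2 : Tendsto (fun k => chi r (‖del k • z‖ ^ 2)) atTop (𝓝 1) := by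
      have := (hcc.tendsto 0).comp (hcz z)
      have h0 : chi r (‖(0 : Eu N)‖ ^ 2) = 1 := chi_one hr (by simp; positivity)
      rw [h0] at this
      exact this
    simpa using t1.mul (t2.mul_const (g z))

theorem Rh_integrable {r : ℝ} (hN : 3 ≤ N) (hr : 0 < r) (k : ℕ) : Integrable (Rh N r (eps k)) := by
  have : Rh N r (eps k) = fun z => Om N r (eps k) z - lap (K0 N r (eps k)) z := by
    funext z; rw [lap_K0 (eps_pos k)]; ring
  rw [this]
  exact ((K_limO hN hr).1 k).sub (lap_integrable (K0_cs hr) (K0_contDiff (eps_pos k)))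

theorem lapK0_tendsto {r : ℝ} (hr : 0 < r) {u : Eu N → ℝ} {M : ℝ} (hN : 3 ≤ N) (hu : Bdm u M)
    {x : Eu N} (hx : ContinuousAt u x) :
    Tendsto (fun k => cv u (lap (K0 N r (eps k))) x) atTop (𝓝 (cv u (Om N r 0) x - cN N * u x)) := by
  have e : ∀ k, cv u (lap (K0 N r (eps k))) x
      = cv u (Om N r (eps k)) x - cv u (Rh N r (eps k)) x := by
    intro k
    rw [← cv_sub hu ((K_limO hN hr).1 k) (Rh_integrable hN hr k)]
    congr 1; funext z; rw [lap_K0 (eps_pos k)]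
  simp_rw [e]
  have t1 := cv_tendstoUniformly hu (K_limO hN hr).1 (K_limO hN hr).2.1 (K_limO hN hr).2.2
  exact (t1.tendsto_at x).sub (Rh_approx hr hN hu hx)

theorem representation {Ω : Set (Eu N)} {u h : Eu N → ℝ} {M M' r : ℝ} (hN : 3 ≤ N) (hr : 0 < r)
    (hu : Bdm u M) (hh : Bdm h M') (hw : Wk Ω u h) {x : Eu N} (hx : ContinuousAt u x)
    (hb : Metric.closedBall x r ⊆ Ω) :
    cN N * u x = cv u (Om N r 0) x + cv h (K0 N r 0) x := by
  have t1 := lapK0_tendsto hr hN hu hx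
  have t2 := (cv_tendstoUniformly hh (K_lim0 hN hr).1 (K_lim0 hN hr).2.1 (K_lim0 hN hr).2.2).tendsto_at x
  have e : ∀ k, cv u (lap (K0 N r (eps k))) x = - cv h (K0 N r (eps k)) x := fun k =>
    hw.cv (K0_contDiff (eps_pos k)) (fun z hz => K0_zero hr hz) hb
  simp_rw [e] at t1
  have := tendsto_nhds_unique t1 t2.neg
  linarith

theorem pot_hasFDeriv {h : Eu N → ℝ} {M r : ℝ} (hN : 3 ≤ N) (hr : 0 < r) (hh : Bdm h M) (x : Eu N) :
    HasFDerivAt (cv h (K0 N r 0)) (cv h (K1 N r 0) x) x := by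
  have t0 := cv_tendstoUniformly hh (K_lim0 hN hr).1 (K_lim0 hN hr).2.1 (K_lim0 hN hr).2.2
  have t1 := cv_tendstoUniformly hh (K_lim1 hN hr).1 (K_lim1 hN hr).2.1 (K_lim1 hN hr).2.2
  refine hasFDerivAt_of_tendstoUniformly t1 (fun k y => ?_) (fun y => t0.tendsto_at y) x
  have := cv_hasFDerivAt hh (K0_cs hr) ((K0_contDiff (r := r) (eps_pos k)).of_le (by simp)) y
  rwa [fderiv_K0 (eps_pos k)] at this

end A6


open Set Filter Topology MeasureTheory
open scoped NNReal ContDiff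

section A7
variable {N : ℕ} {F : Type*} [NormedAddCommGroup F] [NormedSpace ℝ F]

noncomputable def G2 (r : ℝ) (h : Eu N → ℝ) (ε : ℝ) (x : Eu N) : Eu N →L[ℝ] Eu N →L[ℝ] ℝ :=
  ∫ t, (h t - h x) • K2 N r ε (x - t)

theorem cvK2_eq {h : Eu N → ℝ} {M r : ℝ} (hr : 0 < r) (hh : Bdm h M) {ε : ℝ} (hε : 0 < ε)
    (x : Eu N) : cv h (K2 N r ε) x = G2 r h ε x := by
  unfold cv G2
  have hi : Integrable (K2 N r ε) := by
    rw [← fderiv_K1 hε]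
    exact cd_integrable ((K1_cs hr hε).fderiv ℝ) ((K1_contDiff hε).continuous_fderiv (by simp))
  have i2 : Integrable (fun t => h x • K2 N r ε (x - t)) := (hi.comp_sub_left x).smul (h x)
  simp_rw [sub_smul]
  rw [integral_sub (cv_integrable hh hi x) i2, integral_smul]
  have := cv_one_fderiv (K1_cs (N := N) hr hε) ((K1_contDiff hε).of_le (by simp)) x
  rw [fderiv_K1 hε] at this
  rw [this, smul_zero, sub_zero]

theorem G2_integrable {h : Eu N → ℝ} {r : ℝ} {L : ℝ≥0} (hL : LipschitzWith L h) {ε : ℝ}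
    (hm : AEStronglyMeasurable (K2 N r ε) volume)
    (hi : Integrable (fun z => ‖z‖ • K2 N r ε z)) (x : Eu N) :
    Integrable (fun t => (h t - h x) • K2 N r ε (x - t)) := by
  refine ((hi.comp_sub_left x).norm.const_mul L).mono' ?_ (Eventually.of_forall fun t => ?_)
  · refine AEStronglyMeasurable.smul
      (hL.continuous.sub continuous_const).aestronglyMeasurable ?_
    exact hm.comp_quasiMeasurePreserving (quasiMeasurePreserving_sub_left volume x)
  · rw [norm_smul, norm_smul, norm_norm, ← mul_assoc]
    refine mul_le_mul_of_nonneg_right ?_ (norm_nonneg _)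
    have := hL.dist_le_mul t x
    rw [dist_eq_norm, dist_eq_norm, norm_sub_rev t x] at this
    exact this

theorem K2_meas {r : ℝ} (hN : 3 ≤ N) : AEStronglyMeasurable (K2 N r 0) volume := by
  refine aestronglyMeasurable_of_tendsto_ae atTop (f := fun k => K2 N r (eps k))
    (fun k => (K2_continuous (eps_pos k)).aestronglyMeasurable)
    ((ae_ne_zero (by omega)).mono fun z hz => ?_)
  have : 0 < ‖z‖ := norm_pos_iff.2 hz
  obtain ⟨_, t1, t2, _⟩ := kF_tendsto N r (τ := ‖z‖ ^ 2) (by positivity)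
  exact ((t2.const_mul 4).smul_const _).add ((t1.const_mul 2).smul_const _)

theorem G2_unif {h : Eu N → ℝ} {r : ℝ} {L : ℝ≥0} (hN : 3 ≤ N) (hr : 0 < r)
    (hL : LipschitzWith L h) :
    TendstoUniformly (fun k => G2 r h (eps k)) (G2 r h 0) atTop := by
  obtain ⟨i1, i0, t⟩ := K_lim2 hN hr
  rw [Metric.tendstoUniformly_iff]
  intro ε hε
  have h1 : Tendsto (fun k => (L:ℝ) * ∫ z, ‖‖z‖ • K2 N r (eps k) z - ‖z‖ • K2 N r 0 z‖) atTop
    (𝓝 (L * 0)) := t.const_mul _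
  rw [mul_zero] at h1
  filter_upwards [h1.eventually (gt_mem_nhds hε)] with k hk x
  refine lt_of_le_of_lt ?_ hk
  rw [dist_comm, dist_eq_norm]
  unfold G2
  rw [← integral_sub (G2_integrable hL (K2_continuous (eps_pos k)).aestronglyMeasurable (i1 k) x)
    (G2_integrable hL (K2_meas hN) i0 x)]
  rw [← integral_const_mul, ← integral_sub_left_eq_self
    (fun z => (L:ℝ) * ‖‖z‖ • K2 N r (eps k) z - ‖z‖ • K2 N r 0 z‖) volume x]
  have i2 := (((i1 k).sub i0).norm.const_mul (L:ℝ)).comp_sub_left x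
  refine norm_integral_le_of_norm_le i2 (Eventually.of_forall fun t => ?_)
  rw [← smul_sub, ← smul_sub, norm_smul, norm_smul, norm_norm, ← mul_assoc]
  refine mul_le_mul_of_nonneg_right ?_ (norm_nonneg _)
  have := hL.dist_le_mul t x
  rw [dist_eq_norm, dist_eq_norm, norm_sub_rev t x] at this
  exact this

theorem pot_hasFDeriv2 {h : Eu N → ℝ} {M r : ℝ} {L : ℝ≥0} (hN : 3 ≤ N) (hr : 0 < r) (hh : Bdm h M)
    (hL : LipschitzWith L h) (x : Eu N) :
    HasFDerivAt (cv h (K1 N r 0)) (G2 r h 0 x) x := by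
  have t1 := cv_tendstoUniformly hh (K_lim1 hN hr).1 (K_lim1 hN hr).2.1 (K_lim1 hN hr).2.2
  refine hasFDerivAt_of_tendstoUniformly (G2_unif hN hr hL) (fun k y => ?_)
    (fun y => t1.tendsto_at y) x
  have := cv_hasFDerivAt hh (K1_cs hr (eps_pos k)) ((K1_contDiff (r := r) (eps_pos k)).of_le (by simp)) y
  rwa [fderiv_K1 (eps_pos k), cvK2_eq hr hh (eps_pos k)] at this

theorem lap_of_hasFDeriv {f : Eu N → ℝ} {f1 : Eu N → Eu N →L[ℝ] ℝ} {f2 : Eu N →L[ℝ] Eu N →L[ℝ] ℝ}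
    {x : Eu N} (h1 : ∀ y, HasFDerivAt f (f1 y) y) (h2 : HasFDerivAt f1 f2 x) :
    lap f x = ∑ i : Fin N, f2 (EuclideanSpace.single i 1) (EuclideanSpace.single i 1) := by
  unfold lap
  refine Finset.sum_congr rfl fun i _ => ?_
  have e : (fun y => fderiv ℝ f y (EuclideanSpace.single i 1))
      = fun y => f1 y (EuclideanSpace.single i 1) := by
    funext y; rw [(h1 y).fderiv]
  rw [e]
  have := h2.clm_apply (hasFDerivAt_const (EuclideanSpace.single i (1:ℝ)) x)
  rw [this.fderiv]
  simp

theorem pot_C2 {h : Eu N → ℝ} {M r : ℝ} {L : ℝ≥0} (hN : 3 ≤ N) (hr : 0 < r) (hh : Bdm h M)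
    (hL : LipschitzWith L h) : ContDiff ℝ 2 (cv h (K0 N r 0)) ∧
    ∀ x, lap (cv h (K0 N r 0)) x = cv h (Om N r 0) x - cN N * h x := by
  have d0 := pot_hasFDeriv hN hr hh
  have d1 := pot_hasFDeriv2 hN hr hh hL
  have dk0 : ∀ k x, HasFDerivAt (cv h (K0 N r (eps k))) (cv h (K1 N r (eps k)) x) x := by
    intro k x
    have := cv_hasFDerivAt hh (K0_cs hr) ((K0_contDiff (r := r) (eps_pos k)).of_le (by simp)) x
    rwa [fderiv_K0 (eps_pos k)] at this
  have dk1 : ∀ k x, HasFDerivAt (cv h (K1 N r (eps k))) (G2 r h (eps k) x) x := by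
    intro k x
    have := cv_hasFDerivAt hh (K1_cs hr (eps_pos k))
      ((K1_contDiff (r := r) (eps_pos k)).of_le (by simp)) x
    rwa [fderiv_K1 (eps_pos k), cvK2_eq hr hh (eps_pos k)] at this
  have hcont : Continuous (G2 r h 0) := by
    refine (G2_unif hN hr hL).continuous (Frequently.of_forall fun k => ?_)
    have hc1 : ContDiff ℝ ∞ (cv h (K1 N r (eps k))) :=
      cv_contDiff hh (K1_cs hr (eps_pos k)) (K1_contDiff (eps_pos k))
    have := hc1.continuous_fderiv (by simp)
    have e : fderiv ℝ (cv h (K1 N r (eps k))) = G2 r h (eps k) := by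
      funext x; exact (dk1 k x).fderiv
    rwa [e] at this
  constructor
  · rw [show (2 : WithTop ℕ∞) = ((1 : ℕ) : WithTop ℕ∞) + 1 from rfl, contDiff_succ_iff_hasFDerivAt]
    refine ⟨cv h (K1 N r 0), ?_, d0⟩
    rw [Nat.cast_one, contDiff_one_iff_hasFDerivAt]
    exact ⟨G2 r h 0, hcont, d1⟩
  · intro x
    have t1 := lapK0_tendsto hr hN hh (x := x) hL.continuous.continuousAt
    have e : ∀ k, cv h (lap (K0 N r (eps k))) x
        = ∑ i : Fin N, G2 r h (eps k) x (EuclideanSpace.single i 1) (EuclideanSpace.single i 1) := by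
      intro k
      rw [← lap_cv hh (K0_cs hr) (K0_contDiff (eps_pos k))]
      exact lap_of_hasFDeriv (dk0 k) (dk1 k x)
    simp_rw [e] at t1
    rw [lap_of_hasFDeriv d0 (d1 x)]
    refine tendsto_nhds_unique (tendsto_finsetSum _ fun i _ => ?_) t1
    have t2 := (G2_unif hN hr hL).tendsto_at x
    have c : Continuous (fun T : Eu N →L[ℝ] Eu N →L[ℝ] ℝ =>
        T (EuclideanSpace.single i 1) (EuclideanSpace.single i 1)) :=
      (ContinuousLinearMap.apply ℝ ℝ (EuclideanSpace.single i (1:ℝ))).continuous.comp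
        (ContinuousLinearMap.apply ℝ (Eu N →L[ℝ] ℝ) (EuclideanSpace.single i (1:ℝ))).continuous
    exact (c.tendsto _).comp t2

/-- locally Lipschitz at a point -/
def LLA {E F : Type*} [NormedAddCommGroup E] [NormedAddCommGroup F] (f : E → F) (x : E) : Prop :=
  ∃ K : ℝ≥0, ∃ t ∈ 𝓝 x, LipschitzOnWith K f t

theorem LLA.continuousAt {E F : Type*} [NormedAddCommGroup E] [NormedAddCommGroup F] {f : E → F}
    {x : E} (h : LLA f x) : ContinuousAt f x := by
  obtain ⟨K, t, ht, hK⟩ := h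
  exact hK.continuousOn.continuousAt ht

theorem LLA.prodMk {E F G : Type*} [NormedAddCommGroup E] [NormedAddCommGroup F]
    [NormedAddCommGroup G] {f : E → F} {g : E → G}
    {x : E} (hf : LLA f x) (hg : LLA g x) : LLA (fun y => (f y, g y)) x := by
  obtain ⟨K, t, ht, hK⟩ := hf
  obtain ⟨K', t', ht', hK'⟩ := hg
  exact ⟨max K K', t ∩ t', inter_mem ht ht',
    (hK.mono inter_subset_left).prodMk (hK'.mono inter_subset_right)⟩

theorem LLA.comp {E F G : Type*} [NormedAddCommGroup E] [NormedAddCommGroup F]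
    [NormedAddCommGroup G] {f : E → F} {g : F → G}
    {x : E} (hg : LLA g (f x)) (hf : LLA f x) : LLA (fun y => g (f y)) x := by
  have hc := hf.continuousAt
  obtain ⟨K, t, ht, hK⟩ := hf
  obtain ⟨K', t', ht', hK'⟩ := hg
  refine ⟨K' * K, t ∩ f ⁻¹' t', inter_mem ht (hc ht'), ?_⟩
  exact hK'.comp (hK.mono inter_subset_left) fun y hy => hy.2

theorem LLA.of_contDiffAt {E F : Type*} [NormedAddCommGroup E] [NormedSpace ℝ E]
    [NormedAddCommGroup F] [NormedSpace ℝ F] {f : E → F} {x : E}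
    (h : ContDiffAt ℝ 1 f x) : LLA f x := by
  obtain ⟨K, t, ht, hK⟩ := h.exists_lipschitzOnWith
  exact ⟨K, t, ht, hK⟩

theorem LLA.congr {E F : Type*} [NormedAddCommGroup E] [NormedAddCommGroup F] {f g : E → F}
    {x : E} (h : LLA f x) (e : f =ᶠ[𝓝 x] g) : LLA g x := by
  obtain ⟨K, t, ht, hK⟩ := h
  refine ⟨K, t ∩ {y | f y = g y}, inter_mem ht e, fun y hy z hz => ?_⟩
  rw [← hy.2, ← hz.2]
  exact hK hy.1 hz.1

theorem LLA.add {E : Type*} [NormedAddCommGroup E] {f g : E → ℝ} {x : E}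
    (hf : LLA f x) (hg : LLA g x) : LLA (fun y => f y + g y) x :=
  LLA.comp (g := fun p : ℝ × ℝ => p.1 + p.2) (LLA.of_contDiffAt (by fun_prop)) (hf.prodMk hg)

theorem LLA.sub {E : Type*} [NormedAddCommGroup E] {f g : E → ℝ} {x : E}
    (hf : LLA f x) (hg : LLA g x) : LLA (fun y => f y - g y) x :=
  LLA.comp (g := fun p : ℝ × ℝ => p.1 - p.2) (LLA.of_contDiffAt (by fun_prop)) (hf.prodMk hg)

theorem LLA.mul {E : Type*} [NormedAddCommGroup E] {f g : E → ℝ} {x : E}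
    (hf : LLA f x) (hg : LLA g x) : LLA (fun y => f y * g y) x :=
  LLA.comp (g := fun p : ℝ × ℝ => p.1 * p.2) (LLA.of_contDiffAt (by fun_prop)) (hf.prodMk hg)

theorem LLA.const {E : Type*} [NormedAddCommGroup E] (c : ℝ) (x : E) :
    LLA (fun _ : E => c) x :=
  ⟨0, univ, univ_mem, (LipschitzWith.const c).lipschitzOnWith⟩

theorem LLA.rpow {E : Type*} [NormedAddCommGroup E] {f : E → ℝ} {x : E}
    (hf : LLA f x) {b : ℝ} (hb : 1 ≤ b) : LLA (fun y => f y ^ b) x :=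
  LLA.comp (g := fun p : ℝ => p ^ b) (LLA.of_contDiffAt
    (Real.contDiff_rpow_const_of_le (n := 1) (by simpa using hb)).contDiffAt) hf

theorem Wk.mono {Ω Ω' : Set (Eu N)} {u h h' : Eu N → ℝ} (hw : Wk Ω u h) (hs : Ω' ⊆ Ω)
    (he : ∀ x ∈ Ω', h x = h' x) : Wk Ω' u h' := by
  intro φ h1 h2 h3
  rw [hw φ h1 h2 (h3.trans hs)]
  congr 1
  refine integral_congr_ae (Eventually.of_forall fun t => ?_)
  simp only
  by_cases ht : t ∈ tsupport φ
  · rw [he t (h3 ht)]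
  · rw [image_eq_zero_of_notMem_tsupport ht]; simp

/-- interior regularity -/
theorem weyl {Ω : Set (Eu N)} {u h : Eu N → ℝ} {M M' : ℝ} (hN : 3 ≤ N) (hΩ : IsOpen Ω)
    (hu : Bdm u M) (hh : Bdm h M') (hw : Wk Ω u h) (hc : ContinuousOn u Ω) {x0 : Eu N}
    (hx0 : x0 ∈ Ω) (hL : LLA h x0) : ContDiffAt ℝ 2 u x0 ∧ - lap u x0 = h x0 := by
  obtain ⟨K, t, ht, hK⟩ := hL
  obtain ⟨ρ, hρ, hball⟩ := Metric.mem_nhds_iff.1 (inter_mem ht (hΩ.mem_nhds hx0))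
  obtain ⟨g, hg, hge⟩ := (hK.mono (hball.trans inter_subset_left)).extend_real
  set h' : Eu N → ℝ := fun x => max (-M') (min (g x) M') with hh'
  have hM' := hh.nonneg
  have hL' : LipschitzWith K h' := (hg.min_const M').const_max (-M')
  have hb' : Bdm h' M' := by
    refine ⟨hL'.continuous.aestronglyMeasurable, fun x => ?_⟩
    rw [Real.norm_eq_abs, abs_le]
    exact ⟨le_max_left _ _, max_le (by linarith) (min_le_right _ _)⟩
  have he : ∀ x ∈ Metric.ball x0 ρ, h x = h' x := by
    intro x hx
    have h1 := hge hx
    have h2 := hh.bd x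
    rw [Real.norm_eq_abs, abs_le] at h2
    simp only [hh']
    rw [← h1, min_eq_left h2.2, max_eq_right h2.1]
  have hw' : Wk (Metric.ball x0 ρ) u h' := hw.mono (hball.trans inter_subset_right) he
  have hr : 0 < ρ / 4 := by positivity
  have hsub : ∀ x ∈ Metric.ball x0 (ρ / 4), Metric.closedBall x (ρ / 4) ⊆ Metric.ball x0 ρ := by
    intro x hx y hy
    simp only [Metric.mem_ball, Metric.mem_closedBall] at *
    linarith [dist_triangle y x x0]
  have rep : ∀ x ∈ Metric.ball x0 (ρ / 4),
      cN N * u x = cv u (Om N (ρ / 4) 0) x + cv h' (K0 N (ρ / 4) 0) x := by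
    intro x hx
    have hxΩ : x ∈ Ω := (hball (hsub x hx (Metric.mem_closedBall_self hr.le))).2
    exact representation hN hr hu hb' hw' (hc.continuousAt (hΩ.mem_nhds hxΩ)) (hsub x hx)
  have hcN := cN_pos hN
  obtain ⟨pc, pl⟩ := pot_C2 hN hr hb' hL'
  have qc : ContDiff ℝ 2 (cv u (Om N (ρ / 4) 0)) :=
    (cv_contDiff hu (Om_cs hr) (Om_contDiff hr)).of_le (WithTop.coe_le_coe.2 le_top)
  have hx0b : x0 ∈ Metric.ball x0 (ρ / 4) := Metric.mem_ball_self hr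
  have ee : u =ᶠ[𝓝 x0] fun x =>
      (cN N)⁻¹ * (cv u (Om N (ρ / 4) 0) x + cv h' (K0 N (ρ / 4) 0) x) := by
    filter_upwards [Metric.ball_mem_nhds x0 hr] with x hx
    rw [← rep x hx, ← mul_assoc, inv_mul_cancel₀ hcN.ne', one_mul]
  refine ⟨(contDiff_const.mul (qc.add pc)).contDiffAt.congr_of_eventuallyEq ee, ?_⟩
  rw [lap_congr ee, lap_const_mul _ (qc.add pc).contDiffAt,
    lap_add qc.contDiffAt pc.contDiffAt, pl,
    lap_cv hu (Om_cs hr) (Om_contDiff hr),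
    hw'.cv (Om_contDiff hr) (fun z hz => Om_zero hr hz) (hsub x0 hx0b),
    he x0 (hsub x0 hx0b (Metric.mem_closedBall_self hr.le))]
  field_simp
  ring

/-- interior Lipschitz estimate -/
theorem weyl_lip (hN : 3 ≤ N) {r : ℝ} (hr : 0 < r) : ∃ C, 0 < C ∧ ∀ (Ω : Set (Eu N))
    (u h : Eu N → ℝ) (M : ℝ), IsOpen Ω →
    Bdm u M → Bdm h M → Wk Ω u h → ContinuousOn u Ω → ∀ x y : Eu N,
    Metric.closedBall x r ⊆ Ω → Metric.closedBall y r ⊆ Ω → |u x - u y| ≤ C * M * ‖x - y‖ := by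
  set I1 := ∫ z, ‖fderiv ℝ (Om N r 0) z‖
  set I2 := ∫ z, ‖K1 N r 0 z‖
  have hI1 : 0 ≤ I1 := integral_nonneg fun z => norm_nonneg _
  have hI2 : 0 ≤ I2 := integral_nonneg fun z => norm_nonneg _
  have hcN := cN_pos hN
  refine ⟨(cN N)⁻¹ * (I1 + I2) + 1, by positivity, ?_⟩
  intro Ω u h M hΩ hu hh hw hc x y hx hy
  have hM := hu.nonneg
  have rep : ∀ x, Metric.closedBall x r ⊆ Ω →
      u x = (cN N)⁻¹ * (cv u (Om N r 0) x + cv h (K0 N r 0) x) := by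
    intro x hx
    have hxΩ : x ∈ Ω := hx (Metric.mem_closedBall_self hr.le)
    rw [← representation hN hr hu hh hw (hc.continuousAt (hΩ.mem_nhds hxΩ)) hx, ← mul_assoc,
      inv_mul_cancel₀ hcN.ne', one_mul]
  rw [rep x hx, rep y hy]
  have hO1 : ContDiff ℝ 1 (Om N r 0) := (Om_contDiff hr).of_le (by simp)
  have d : ∀ z, HasFDerivAt (fun z => cv u (Om N r 0) z + cv h (K0 N r 0) z)
      (cv u (fderiv ℝ (Om N r 0)) z + cv h (K1 N r 0) z) z := fun z =>
    (cv_hasFDerivAt hu (Om_cs hr) hO1 z).add (pot_hasFDeriv hN hr hh z)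
  have b : ∀ z, ‖cv u (fderiv ℝ (Om N r 0)) z + cv h (K1 N r 0) z‖ ≤ M * I1 + M * I2 := by
    intro z
    refine (norm_add_le _ _).trans (add_le_add ?_ ?_)
    · exact cv_norm_le hu (cd_integrable ((Om_cs hr).fderiv ℝ)
        (hO1.continuous_fderiv (by simp))) z
    · exact cv_norm_le hh (K_lim1 hN hr).2.1 z
  have := convex_univ.norm_image_sub_le_of_norm_hasFDerivWithin_le (C := M * I1 + M * I2)
    (fun z _ => (d z).hasFDerivWithinAt) (fun z _ => b z) (mem_univ y) (mem_univ x)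
  rw [← mul_sub, abs_mul, abs_of_pos (by positivity : 0 < (cN N)⁻¹)]
  rw [Real.norm_eq_abs] at this
  calc (cN N)⁻¹ * |_| ≤ (cN N)⁻¹ * ((M * I1 + M * I2) * ‖x - y‖) := by gcongr
    _ = ((cN N)⁻¹ * (I1 + I2)) * M * ‖x - y‖ := by ring
    _ ≤ _ := by gcongr; linarith

end A7


open Set Filter Topology MeasureTheory
open scoped NNReal ContDiff

section B1
variable {N : ℕ}

noncomputable def gE (z : Eu N) : ℝ := Real.exp (-(1/4) * ‖z‖ ^ 2)

theorem gE_pos (z : Eu N) : 0 < gE z := Real.exp_pos _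

theorem gE_cont : Continuous (gE (N := N)) := by unfold gE; fun_prop

theorem gauss_int {b : ℝ} (hb : 0 < b) : Integrable (fun z : Eu N => Real.exp (-b * ‖z‖ ^ 2)) := by
  refine Integrable.of_integral_ne_zero ?_
  rw [GaussianFourier.integral_rexp_neg_mul_sq_norm hb]
  positivity

theorem gE_int : Integrable (gE (N := N)) := gauss_int (by norm_num)

theorem gE_int' : Integrable (fun z : Eu N => ‖z‖ * gE z) := by
  refine ((gauss_int (N := N) (b := 1/8) (by norm_num)).const_mul 2).mono'
    (continuous_norm.mul gE_cont).aestronglyMeasurable (Eventually.of_forall fun z => ?_)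
  rw [Real.norm_of_nonneg (mul_nonneg (norm_nonneg _) (gE_pos z).le)]
  have h1 : gE z = Real.exp (-(1/8) * ‖z‖ ^ 2) * Real.exp (-(1/8) * ‖z‖ ^ 2) := by
    unfold gE; rw [← Real.exp_add]; congr 1; ring
  have h2 : Real.exp (-(1/8) * ‖z‖ ^ 2) * Real.exp ((1/8) * ‖z‖ ^ 2) = 1 := by
    rw [← Real.exp_add]; ring_nf; simp
  have h3 := Real.add_one_le_exp ((1/8) * ‖z‖ ^ 2)
  set A := Real.exp (-(1/8) * ‖z‖ ^ 2)
  have hA : 0 < A := Real.exp_pos _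
  have h4 : ‖z‖ * A ≤ 2 := by
    have : ‖z‖ ≤ 2 * Real.exp ((1/8) * ‖z‖ ^ 2) := by nlinarith [sq_nonneg (‖z‖ - 2)]
    nlinarith
  rw [h1]
  nlinarith

theorem gE_fderiv (z v : Eu N) : HasFDerivAt (gE (N := N)) ((-(1/2) * gE z) • (iSL N z)) z := by
  have h : HasDerivAt (fun τ : ℝ => Real.exp (-(1/4) * τ)) (-(1/4) * Real.exp (-(1/4) * ‖z - 0‖ ^ 2))
      (‖z - 0‖ ^ 2) := by
    have := ((hasDerivAt_id (‖z - 0‖ ^ 2)).const_mul (-(1/4) : ℝ)).exp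
    refine this.congr_deriv ?_
    simp; ring
  have := fderiv_radial 0 z h
  simp only [sub_zero] at this
  refine HasFDerivAt.congr_fderiv this ?_
  ext w
  simp [iSL_apply, gE]
  ring

theorem cs_bound {F : Type*} [NormedAddCommGroup F] {f : Eu N → F} (hc : HasCompactSupport f)
    (hf : Continuous f) : ∃ C, 0 ≤ C ∧ ∀ x, ‖f x‖ ≤ C := by
  obtain ⟨C, hC⟩ := hc.exists_bound_of_continuous hf
  exact ⟨C, (norm_nonneg _).trans (hC 0), hC⟩

theorem bdd_gE_int {f : Eu N → ℝ} (hf : Continuous f) {C : ℝ} (hC : ∀ x, ‖f x‖ ≤ C) :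
    Integrable (fun z => f z * gE z) :=
  gE_int.bdd_mul hf.aestronglyMeasurable (Eventually.of_forall hC)

theorem gauss_ibp_i {f : Eu N → ℝ} (hf : ContDiff ℝ 1 f) {C C' : ℝ} (hC : ∀ x, ‖f x‖ ≤ C)
    (e : Eu N) (hC' : ∀ x, ‖fderiv ℝ f x e‖ ≤ C') (he : ‖e‖ = 1) :
    ∫ z, f z * (inner ℝ z e * gE z) = 2 * ∫ z, fderiv ℝ f z e * gE z := by
  have hfd : ∀ z, fderiv ℝ (gE (N := N)) z e = -(1/2) * (inner ℝ z e * gE z) := by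
    intro z; rw [(gE_fderiv z 0).fderiv]; simp [iSL_apply]; ring
  have i0 : Integrable (fun z : Eu N => f z * (inner ℝ z e * gE z)) := by
    refine (gE_int'.const_mul C).mono' ?_ (Eventually.of_forall fun z => ?_)
    · have := hf.continuous
      have := gE_cont (N := N)
      exact (by fun_prop : Continuous (fun z : Eu N => f z * (inner ℝ z e * gE z))).aestronglyMeasurable
    · rw [norm_mul, norm_mul, Real.norm_of_nonneg (gE_pos z).le]
      have h1 := norm_inner_le_norm (𝕜 := ℝ) z e
      rw [he, mul_one] at h1
      have h0 : 0 ≤ C := (norm_nonneg _).trans (hC 0)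
      have := (gE_pos z).le
      have := hC z
      gcongr
  have := integral_mul_fderiv_eq_neg_fderiv_mul_of_integrable (μ := (volume : Measure (Eu N)))
    (f := f) (g := gE) (v := e)
    (bdd_gE_int ((hf.continuous_fderiv (by simp)).clm_apply continuous_const) hC')
    ((i0.const_mul (-(1/2))).congr (Eventually.of_forall fun z => by simp only [hfd]; ring)) (bdd_gE_int hf.continuous hC)
    (fun x _ => hf.differentiable (by simp) x) (fun x _ => (gE_fderiv x 0).differentiableAt)
  simp_rw [hfd, mul_left_comm _ (-(1/2) : ℝ), integral_const_mul] at this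
  linarith

theorem gauss_ibp {φ : Eu N → ℝ} (hφ : ContDiff ℝ ∞ φ) (hc : HasCompactSupport φ) (x : Eu N)
    (σ : ℝ) : ∫ z, -(fderiv ℝ φ (x - σ • z) z) * gE z = 2 * σ * ∫ z, lap φ (x - σ • z) * gE z := by
  set e : Fin N → Eu N := fun i => EuclideanSpace.single i 1 with he
  have hen : ∀ i, ‖e i‖ = 1 := fun i => by simp [he]
  have hexp : ∀ (L : Eu N →L[ℝ] ℝ) z, L z = ∑ i, L (e i) * inner ℝ z (e i) := by
    intro L z
    have h1 := (EuclideanSpace.basisFun (Fin N) ℝ).sum_repr z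
    conv_lhs => rw [← h1]
    rw [map_sum]
    refine Finset.sum_congr rfl fun i _ => ?_
    simp [he, EuclideanSpace.inner_single_right]
    ring
  have key : ∀ i, Integrable (fun z => fderiv ℝ φ (x - σ • z) (e i) * (inner ℝ z (e i) * gE z)) ∧
      ∫ z, fderiv ℝ φ (x - σ • z) (e i) * (inner ℝ z (e i) * gE z) =
      2 * ∫ z, -σ * fderiv ℝ (fun y => fderiv ℝ φ y (e i)) (x - σ • z) (e i) * gE z := by
    intro i
    have c1 := cd_fderiv_apply hφ (e i)
    have cs1 := cs_fderiv_apply hc (e i)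
    obtain ⟨C, hC0, hC⟩ := cs_bound cs1 c1.continuous
    obtain ⟨C', hC0', hC'⟩ := cs_bound (cs_fderiv_apply cs1 (e i)) (cd_fderiv_apply c1 (e i)).continuous
    have hd : ∀ z, fderiv ℝ (fun z => fderiv ℝ φ (x - σ • z) (e i)) z (e i)
        = -σ * fderiv ℝ (fun y => fderiv ℝ φ y (e i)) (x - σ • z) (e i) := by
      intro z
      have h1 : HasFDerivAt (fun z : Eu N => x - σ • z) (-(σ • ContinuousLinearMap.id ℝ (Eu N))) z :=
        ((hasFDerivAt_id z).const_smul σ).const_sub x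
      have hd1 := c1.differentiable (by simp)
      generalize hψ : (fun y => fderiv ℝ φ y (e i)) = ψ at hd1 ⊢
      have h2 : HasFDerivAt (fun z => ψ (x - σ • z)) _ z :=
        (hd1 (x - σ • z)).hasFDerivAt.comp z h1
      have h3 : (fun z => fderiv ℝ φ (x - σ • z) (e i)) = (fun z => ψ (x - σ • z)) := by
        funext z; rw [← hψ]
      rw [h3, HasFDerivAt.fderiv h2]; simp
    have hsm : ContDiff ℝ ∞ (fun z => fderiv ℝ φ (x - σ • z) (e i)) :=
      c1.comp (by fun_prop : ContDiff ℝ ∞ (fun z : Eu N => x - σ • z))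
    constructor
    · refine (gE_int'.const_mul C).mono' ?_ (Eventually.of_forall fun z => ?_)
      · have h1 := hsm.continuous
        have h2 : Continuous (fun z : Eu N => inner ℝ z (e i)) := by fun_prop
        exact (h1.mul (h2.mul gE_cont)).aestronglyMeasurable
      · rw [norm_mul, norm_mul, Real.norm_of_nonneg (gE_pos z).le]
        have h1 := norm_inner_le_norm (𝕜 := ℝ) z (e i)
        rw [hen, mul_one] at h1
        have := (gE_pos z).le
        have := hC (x - σ • z)
        gcongr
    · have := gauss_ibp_i (hsm.of_le (by simp)) (fun z => hC _) (e i) (C' := |σ| * C')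
        (fun z => ?_) (hen i)
      · rw [this]; simp_rw [hd]
      · rw [hd, norm_mul, norm_neg, Real.norm_eq_abs]
        exact mul_le_mul_of_nonneg_left (hC' _) (abs_nonneg _)
  have e1 : ∀ z, -(fderiv ℝ φ (x - σ • z) z) * gE z
      = - ∑ i, fderiv ℝ φ (x - σ • z) (e i) * (inner ℝ z (e i) * gE z) := by
    intro z
    rw [hexp (fderiv ℝ φ (x - σ • z)) z, neg_mul, Finset.sum_mul]
    congr 1
    exact Finset.sum_congr rfl fun i _ => by ring
  simp_rw [e1]
  rw [integral_neg, integral_finsetSum _ fun i _ => (key i).1]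
  simp_rw [(key _).2, mul_assoc, integral_const_mul]
  have e2 : ∀ z, lap φ (x - σ • z) * gE z
      = ∑ i, fderiv ℝ (fun y => fderiv ℝ φ y (e i)) (x - σ • z) (e i) * gE z := by
    intro z; unfold lap; rw [Finset.sum_mul]
  simp_rw [e2]
  rw [integral_finsetSum]
  · rw [← Finset.mul_sum, ← Finset.mul_sum]; ring
  · intro i _
    have c2 := cd_fderiv_apply (cd_fderiv_apply hφ (e i)) (e i)
    obtain ⟨C', hC0', hC'⟩ := cs_bound (cs_fderiv_apply (cs_fderiv_apply hc (e i)) (e i)) c2.continuous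
    have : Continuous (fun z => fderiv ℝ (fun y => fderiv ℝ φ y (e i)) (x - σ • z) (e i)) :=
      c2.continuous.comp (by fun_prop)
    exact bdd_gE_int this (fun z => hC' _)

theorem gauss_deriv {φ : Eu N → ℝ} (hφ : ContDiff ℝ ∞ φ) (hc : HasCompactSupport φ) (x : Eu N)
    (σ : ℝ) : HasDerivAt (fun σ : ℝ => ∫ z, φ (x - σ • z) * gE z)
      (2 * σ * ∫ z, lap φ (x - σ • z) * gE z) σ := by
  rw [← gauss_ibp hφ hc]
  obtain ⟨C, hC0, hC⟩ := cs_bound hc hφ.continuous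
  have hcd : Continuous (fderiv ℝ φ) := hφ.continuous_fderiv (by simp)
  obtain ⟨C', hC0', hC'⟩ := cs_bound (hc.fderiv ℝ) hcd
  have hcz : ∀ σ : ℝ, Continuous (fun z : Eu N => φ (x - σ • z)) := fun σ =>
    hφ.continuous.comp (by fun_prop)
  refine (hasDerivAt_integral_of_dominated_loc_of_deriv_le (s := univ)
    (F := fun σ z => φ (x - σ • z) * gE z)
    (F' := fun σ z => -(fderiv ℝ φ (x - σ • z) z) * gE z)
    (bound := fun z => C' * (‖z‖ * gE z)) univ_mem
    (Eventually.of_forall fun σ => ((hcz σ).mul gE_cont).aestronglyMeasurable)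
    (bdd_gE_int (hcz σ) fun z => hC _) ?_ (Eventually.of_forall fun z s _ => ?_)
    (gE_int'.const_mul C') (Eventually.of_forall fun z s _ => ?_)).2
  · have : Continuous (fun z : Eu N => fderiv ℝ φ (x - σ • z) z) :=
      (hcd.comp (by fun_prop : Continuous fun z : Eu N => x - σ • z)).clm_apply continuous_id
    exact (this.neg.mul gE_cont).aestronglyMeasurable
  · rw [norm_mul, norm_neg, Real.norm_of_nonneg (gE_pos z).le, ← mul_assoc]
    refine mul_le_mul_of_nonneg_right ?_ (gE_pos z).le
    exact (ContinuousLinearMap.le_opNorm _ _).trans (mul_le_mul_of_nonneg_right (hC' _) (norm_nonneg _))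
  · have h1 : HasDerivAt (fun s : ℝ => x - s • z) (-z) s := by
      have := ((hasDerivAt_id s).smul_const z).const_sub x
      simpa using this
    have h2 : HasDerivAt (fun s : ℝ => φ (x - s • z)) (fderiv ℝ φ (x - s • z) (-z)) s :=
      ((hφ.differentiable (by simp)) (x - s • z)).hasFDerivAt.comp_hasDerivAt s h1
    have := h2.mul_const (gE z)
    rwa [map_neg] at this

end B1


open Set Filter Topology MeasureTheory
open scoped NNReal ContDiff

section B2
variable {N : ℕ}

structure ResM (N : ℕ) (lam : ℝ) (Θ : Measure (Eu N)) : Prop where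
  fin : IsFiniteMeasure Θ
  mass : Θ.real univ = 1 / lam
  inv : ∀ T : Eu N ≃ₗᵢ[ℝ] Eu N, Θ.map T = Θ
  eqn : ∀ φ : Eu N → ℝ, ContDiff ℝ ∞ φ → HasCompactSupport φ → ∀ x,
    ∫ y, (lam * φ (x - y) - lap φ (x - y)) ∂Θ = φ x

noncomputable def rhoS (lam σ : ℝ) : ℝ := 2 * σ * Real.exp (-lam * σ ^ 2)

theorem rhoS_deriv (lam σ : ℝ) : HasDerivAt (fun σ => -Real.exp (-lam * σ ^ 2)) (lam * rhoS lam σ) σ := by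
  have h := (((hasDerivAt_id σ).pow 2).const_mul (-lam)).exp.neg
  refine h.congr_deriv ?_
  simp [rhoS]; ring

theorem rhoS_lim {lam : ℝ} (hl : 0 < lam) :
    Tendsto (fun σ : ℝ => Real.exp (-lam * σ ^ 2)) atTop (𝓝 0) := by
  refine Real.tendsto_exp_atBot.comp ?_
  have : Tendsto (fun σ : ℝ => σ ^ 2) atTop atTop := tendsto_pow_atTop (by norm_num)
  exact this.const_mul_atTop_of_neg (by linarith)

theorem rhoS_int {lam : ℝ} (hl : 0 < lam) : IntegrableOn (rhoS lam) (Ioi 0) ∧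
    ∫ σ in Ioi 0, rhoS lam σ = 1 / lam := by
  have h0 : ∀ σ ∈ Ioi (0:ℝ), 0 ≤ lam * rhoS lam σ := by
    intro σ hσ
    have : (0:ℝ) < σ := hσ
    unfold rhoS; positivity
  have hlim : Tendsto (fun σ : ℝ => -Real.exp (-lam * σ ^ 2)) atTop (𝓝 (-0)) := (rhoS_lim hl).neg
  have h1 := integrableOn_Ioi_deriv_of_nonneg' (fun σ _ => rhoS_deriv lam σ) h0 hlim
  have h2 := integral_Ioi_of_hasDerivAt_of_nonneg' (fun σ _ => rhoS_deriv lam σ) h0 hlim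
  have h3 : IntegrableOn (rhoS lam) (Ioi 0) := by
    have := h1.const_mul (1/lam)
    refine this.congr (Eventually.of_forall fun σ => ?_)
    simp only; field_simp
  refine ⟨h3, ?_⟩
  rw [integral_const_mul] at h2
  simp at h2
  field_simp
  linarith

noncomputable def muS (lam : ℝ) : Measure ℝ :=
  (volume.restrict (Ioi 0)).withDensity (fun σ => ((Real.toNNReal (rhoS lam σ) : ℝ≥0) : ENNReal))

noncomputable def gamS (N : ℕ) : Measure (Eu N) :=
  volume.withDensity (fun z => ((Real.toNNReal (gE z / ∫ w : Eu N, gE w) : ℝ≥0) : ENNReal))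

theorem rhoS_meas (lam : ℝ) : Measurable (rhoS lam) := by
  unfold rhoS; fun_prop

theorem gE_tot : 0 < ∫ w : Eu N, gE w := by
  rw [show (∫ w : Eu N, gE w) = ∫ w : Eu N, Real.exp (-(1/4) * ‖w‖ ^ 2) from rfl,
    GaussianFourier.integral_rexp_neg_mul_sq_norm (by norm_num)]
  positivity

theorem muS_integral (lam : ℝ) (f : ℝ → ℝ) :
    ∫ σ, f σ ∂(muS lam) = ∫ σ in Ioi 0, rhoS lam σ * f σ := by
  unfold muS
  rw [integral_withDensity_eq_integral_smul (rhoS_meas lam).real_toNNReal]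
  refine setIntegral_congr_fun measurableSet_Ioi fun σ hσ => ?_
  have h0 : (0:ℝ) < σ := hσ
  have : 0 ≤ rhoS lam σ := by unfold rhoS; positivity
  simp [NNReal.smul_def, this]

theorem gamS_integral (f : Eu N → ℝ) :
    ∫ z, f z ∂(gamS N) = (1 / ∫ w : Eu N, gE w) * ∫ z, f z * gE z := by
  unfold gamS
  rw [integral_withDensity_eq_integral_smul, ← integral_const_mul]
  · refine integral_congr_ae (Eventually.of_forall fun z => ?_)
    have : 0 ≤ gE z / ∫ w : Eu N, gE w := div_nonneg (gE_pos z).le gE_tot.le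
    simp [NNReal.smul_def, this]
    ring
  · exact ((gE_cont.measurable).div_const _).real_toNNReal

theorem muS_fin {lam : ℝ} (hl : 0 < lam) : IsFiniteMeasure (muS lam) := by
  unfold muS
  exact isFiniteMeasure_withDensity_ofReal (rhoS_int hl).1.2

theorem gamS_fin : IsFiniteMeasure (gamS N) := by
  unfold gamS
  exact isFiniteMeasure_withDensity_ofReal (gE_int.div_const _).2

theorem gamS_inv (T : Eu N ≃ₗᵢ[ℝ] Eu N) : (gamS N).map T = gamS N := by
  ext s hs
  have hT : Measurable T := T.continuous.measurable
  rw [Measure.map_apply hT hs]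
  unfold gamS
  rw [withDensity_apply _ (hT hs), withDensity_apply _ hs]
  have hm := T.measurePreserving.restrict_preimage hs
  have hmeas : Measurable (fun z : Eu N => ((Real.toNNReal (gE z / ∫ w : Eu N, gE w) : ℝ≥0) : ENNReal)) :=
    ((gE_cont.measurable).div_const _).real_toNNReal.coe_nnreal_ennreal
  rw [← hm.lintegral_comp hmeas]
  simp [gE]

theorem resM_exists {lam : ℝ} (hl : 0 < lam) : ∃ Θ : Measure (Eu N), ResM N lam Θ := by
  have := muS_fin hl
  have := gamS_fin (N := N)
  have hm : Measurable (fun p : ℝ × Eu N => p.1 • p.2) := by fun_prop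
  refine ⟨((muS lam).prod (gamS N)).map (fun p => p.1 • p.2), ?_, ?_, ?_, ?_⟩
  · infer_instance
  · have h1 : ∫ σ : Eu N, (1:ℝ) ∂(((muS lam).prod (gamS N)).map (fun p : ℝ × Eu N => p.1 • p.2)) = 1 / lam := by
      rw [integral_map hm.aemeasurable (by fun_prop), integral_prod _ (integrable_const _)]
      simp_rw [gamS_integral, muS_integral, one_mul]
      rw [one_div_mul_cancel gE_tot.ne']
      simpa using (rhoS_int hl).2
    simpa using h1
  · intro T
    have hT : Measurable T := T.continuous.measurable
    rw [Measure.map_map hT hm]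
    have e1 : (T ∘ fun p : ℝ × Eu N => p.1 • p.2) = (fun p : ℝ × Eu N => p.1 • p.2) ∘ (Prod.map id T) := by
      funext p; simp
    rw [e1, ← Measure.map_map hm (measurable_id.prodMap hT), ← Measure.map_prod_map _ _ measurable_id hT,
      gamS_inv, Measure.map_id]
  · intro φ hφ hc x
    obtain ⟨C, hC0, hC⟩ := cs_bound hc hφ.continuous
    obtain ⟨C', hC0', hC'⟩ := cs_bound (lap_compactSupport hc) (lap_contDiff hφ).continuous
    have hcF : Continuous (fun y : Eu N => lam * φ (x - y) - lap φ (x - y)) :=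
      by
        have h1 := hφ.continuous
        have h2 := (lap_contDiff hφ).continuous
        fun_prop
    have hbF : ∀ y, ‖lam * φ (x - y) - lap φ (x - y)‖ ≤ lam * C + C' := fun y => by
      refine (norm_sub_le _ _).trans ?_
      rw [norm_mul, Real.norm_of_nonneg hl.le]
      exact add_le_add (mul_le_mul_of_nonneg_left (hC _) hl.le) (hC' _)
    have hi : Integrable (fun p : ℝ × Eu N => lam * φ (x - p.1 • p.2) - lap φ (x - p.1 • p.2))
        ((muS lam).prod (gamS N)) := by
      refine Integrable.of_bound (C := lam * C + C') ?_ (Eventually.of_forall fun p => hbF _)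
      exact (hcF.measurable.comp hm).aestronglyMeasurable
    rw [integral_map hm.aemeasurable hcF.aestronglyMeasurable, integral_prod _ hi]
    simp_rw [gamS_integral]
    rw [muS_integral]
    have hsplit : ∀ σ : ℝ, ∫ z : Eu N, (lam * φ (x - σ • z) - lap φ (x - σ • z)) * gE z
        = lam * (∫ z, φ (x - σ • z) * gE z) - ∫ z, lap φ (x - σ • z) * gE z := by
      intro σ
      have hs : Continuous (fun z : Eu N => x - σ • z) := by fun_prop
      rw [← integral_const_mul, ← integral_sub]
      · exact integral_congr_ae (Eventually.of_forall fun z => by simp only; ring)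
      · exact (bdd_gE_int (hφ.continuous.comp hs) fun z => hC _).const_mul _
      · exact bdd_gE_int ((lap_contDiff hφ).continuous.comp hs) fun z => hC' _
    set G := ∫ w : Eu N, gE w with hG
    have hGp : 0 < G := gE_tot
    set P : ℝ → ℝ := fun σ => -(Real.exp (-lam * σ ^ 2) * ∫ z, φ (x - σ • z) * gE z) with hP
    have hd : ∀ σ, HasDerivAt P (rhoS lam σ * ∫ z : Eu N, (lam * φ (x - σ • z) - lap φ (x - σ • z)) * gE z) σ := by
      intro σ
      have h1 : HasDerivAt (fun σ => Real.exp (-lam * σ ^ 2)) (-(lam * rhoS lam σ)) σ := by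
        have := (rhoS_deriv lam σ).fun_neg
        simpa only [neg_neg] using this
      have h2 := (HasDerivAt.fun_mul h1 (gauss_deriv hφ hc x σ)).neg
      have h3 : HasDerivAt P _ σ := h2
      refine (h3.congr_deriv ?_)
      rw [hsplit]
      simp only [rhoS]; ring
    have hbd : ∀ σ : ℝ, ‖∫ z : Eu N, φ (x - σ • z) * gE z‖ ≤ C * G := by
      intro σ
      rw [hG, ← integral_const_mul]
      refine norm_integral_le_of_norm_le (gE_int.const_mul C) (Eventually.of_forall fun z => ?_)
      rw [norm_mul, Real.norm_of_nonneg (gE_pos z).le]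
      exact mul_le_mul_of_nonneg_right (hC _) (gE_pos z).le
    have hbd2 : ∀ σ : ℝ, ‖∫ z : Eu N, (lam * φ (x - σ • z) - lap φ (x - σ • z)) * gE z‖ ≤ (lam * C + C') * G := by
      intro σ
      rw [hG, ← integral_const_mul]
      refine norm_integral_le_of_norm_le (gE_int.const_mul _) (Eventually.of_forall fun z => ?_)
      rw [norm_mul, Real.norm_of_nonneg (gE_pos z).le]
      exact mul_le_mul_of_nonneg_right (hbF _) (gE_pos z).le
    have hlim : Tendsto P atTop (𝓝 0) := by
      rw [← neg_zero]
      refine Tendsto.neg ?_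
      exact (rhoS_lim hl).zero_mul_isBoundedUnder_le (isBoundedUnder_of ⟨C * G, hbd⟩)
    have hii : IntegrableOn (fun σ => rhoS lam σ * ∫ z : Eu N, (lam * φ (x - σ • z) - lap φ (x - σ • z)) * gE z) (Ioi 0) := by
      have hm' : StronglyMeasurable (fun σ => rhoS lam σ * ∫ z : Eu N, (lam * φ (x - σ • z) - lap φ (x - σ • z)) * gE z) := by
        have : (fun σ => rhoS lam σ * ∫ z : Eu N, (lam * φ (x - σ • z) - lap φ (x - σ • z)) * gE z) = deriv P := by
          funext σ; exact (hd σ).deriv.symm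
        rw [this]; exact stronglyMeasurable_deriv P
      refine ((rhoS_int hl).1.norm.mul_const ((lam * C + C') * G)).mono' hm'.aestronglyMeasurable
        (Eventually.of_forall fun σ => ?_)
      rw [norm_mul]
      exact mul_le_mul_of_nonneg_left (hbd2 σ) (norm_nonneg _)
    have hmain := integral_Ioi_of_hasDerivAt_of_tendsto' (fun σ _ => hd σ) hii hlim
    have e0 : P 0 = -(φ x * G) := by
      simp [hP, integral_const_mul, hG]
    rw [e0] at hmain
    have e2 : ∀ σ : ℝ, rhoS lam σ * (1 / G * ∫ z : Eu N, (lam * φ (x - σ • z) - lap φ (x - σ • z)) * gE z)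
        = (1 / G) * (rhoS lam σ * ∫ z : Eu N, (lam * φ (x - σ • z) - lap φ (x - σ • z)) * gE z) := fun σ => by ring
    simp_rw [e2]
    rw [integral_const_mul, hmain]
    field_simp
    ring

end B2


open Set Filter Topology MeasureTheory
open scoped NNReal ContDiff

section B3
variable {N : ℕ}

/-- bounded continuous -/
def BC (f : Eu N → ℝ) : Prop := Continuous f ∧ ∃ M, ∀ x, ‖f x‖ ≤ M

theorem BC.add {f g : Eu N → ℝ} (hf : BC f) (hg : BC g) : BC (fun x => f x + g x) := by
  obtain ⟨M, hM⟩ := hf.2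
  obtain ⟨M', hM'⟩ := hg.2
  exact ⟨hf.1.add hg.1, M + M', fun x => (norm_add_le _ _).trans (add_le_add (hM x) (hM' x))⟩

theorem BC.sub {f g : Eu N → ℝ} (hf : BC f) (hg : BC g) : BC (fun x => f x - g x) := by
  obtain ⟨M, hM⟩ := hf.2
  obtain ⟨M', hM'⟩ := hg.2
  exact ⟨hf.1.sub hg.1, M + M', fun x => (norm_sub_le _ _).trans (add_le_add (hM x) (hM' x))⟩

theorem BC.mul {f g : Eu N → ℝ} (hf : BC f) (hg : BC g) : BC (fun x => f x * g x) := by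
  obtain ⟨M, hM⟩ := hf.2
  obtain ⟨M', hM'⟩ := hg.2
  refine ⟨hf.1.mul hg.1, M * M', fun x => ?_⟩
  rw [norm_mul]
  exact mul_le_mul (hM x) (hM' x) (norm_nonneg _) ((norm_nonneg _).trans (hM x))

theorem BC.const (c : ℝ) : BC (fun _ : Eu N => c) := ⟨continuous_const, ‖c‖, fun _ => le_rfl⟩

theorem BC.bdm {f : Eu N → ℝ} (hf : BC f) : ∃ M, Bdm f M := by
  obtain ⟨M, hM⟩ := hf.2
  exact ⟨M, hf.1.aestronglyMeasurable, hM⟩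

theorem BC.comp_iso {f : Eu N → ℝ} (hf : BC f) (T : Eu N ≃ₗᵢ[ℝ] Eu N) : BC (fun x => f (T x)) := by
  obtain ⟨M, hM⟩ := hf.2
  exact ⟨hf.1.comp T.continuous, M, fun x => hM _⟩

noncomputable def Rop (Θ : Measure (Eu N)) (f : Eu N → ℝ) (x : Eu N) : ℝ := ∫ y, f (x - y) ∂Θ

variable {lam : ℝ} {Θ : Measure (Eu N)}

theorem Rop_int [IsFiniteMeasure Θ] {f : Eu N → ℝ} (hf : BC f) (x : Eu N) :
    Integrable (fun y => f (x - y)) Θ := by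
  obtain ⟨M, hM⟩ := hf.2
  have := hf.1
  exact Integrable.of_bound (by fun_prop : Continuous fun y => f (x - y)).aestronglyMeasurable M
    (Eventually.of_forall fun y => hM _)

theorem Rop_bd (h : ResM N lam Θ) {f : Eu N → ℝ} {M : ℝ} (hM : ∀ x, ‖f x‖ ≤ M) (x : Eu N) :
    ‖Rop Θ f x‖ ≤ M / lam := by
  have := h.fin
  have h1 := norm_integral_le_of_norm_le_const (μ := Θ) (f := fun y => f (x - y)) (C := M)
    (Eventually.of_forall fun y => hM _)
  rw [h.mass] at h1
  unfold Rop
  rw [div_eq_mul_one_div]; exact h1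

theorem Rop_BC (h : ResM N lam Θ) {f : Eu N → ℝ} (hf : BC f) : BC (Rop Θ f) := by
  have := h.fin
  obtain ⟨M, hM⟩ := hf.2
  have hc := hf.1
  refine ⟨?_, M / lam, Rop_bd h hM⟩
  unfold Rop
  refine continuous_of_dominated (bound := fun _ => M) (fun x => (Rop_int hf x).1)
    (fun x => Eventually.of_forall fun y => hM _) (integrable_const _)
    (Eventually.of_forall fun y => by fun_prop)

theorem Rop_add (h : ResM N lam Θ) {f g : Eu N → ℝ} (hf : BC f) (hg : BC g) (x : Eu N) :
    Rop Θ (fun x => f x + g x) x = Rop Θ f x + Rop Θ g x := by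
  have := h.fin
  exact integral_add (Rop_int hf x) (Rop_int hg x)

theorem Rop_sub (h : ResM N lam Θ) {f g : Eu N → ℝ} (hf : BC f) (hg : BC g) (x : Eu N) :
    Rop Θ (fun x => f x - g x) x = Rop Θ f x - Rop Θ g x := by
  have := h.fin
  exact integral_sub (Rop_int hf x) (Rop_int hg x)

theorem Rop_iso (h : ResM N lam Θ) {f : Eu N → ℝ} (hf : BC f) (T : Eu N ≃ₗᵢ[ℝ] Eu N) (x : Eu N) :
    Rop Θ (fun x => f (T x)) x = Rop Θ f (T x) := by
  have := h.fin
  have hc := hf.1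
  unfold Rop
  conv_rhs => rw [← h.inv T]
  rw [integral_map T.continuous.measurable.aemeasurable
    (by fun_prop : Continuous fun y => f (T x - y)).aestronglyMeasurable]
  simp

/-- symmetry of the resolvent -/
theorem Rop_symm (h : ResM N lam Θ) {g ψ : Eu N → ℝ} (hg : BC g) (hψ : Continuous ψ)
    (hi : Integrable ψ) : ∫ x, Rop Θ g x * ψ x = ∫ x, g x * Rop Θ ψ x := by
  have := h.fin
  obtain ⟨M, hM⟩ := hg.2
  have hM0 : 0 ≤ M := (norm_nonneg _).trans (hM 0)
  have hgc := hg.1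
  unfold Rop
  have i1 : Integrable (Function.uncurry fun (x y : Eu N) => g (x - y) * ψ x) (volume.prod Θ) := by
    refine ((hi.comp_fst Θ).norm.const_mul M).mono' ?_ (Eventually.of_forall fun p => ?_)
    · exact Continuous.aestronglyMeasurable (by unfold Function.uncurry; fun_prop)
    · simp only [Function.uncurry, norm_mul]
      exact mul_le_mul_of_nonneg_right (hM _) (norm_nonneg _)
  have hi2 : ∀ y, Integrable (fun x => g x * ψ (x + y)) := fun y =>
    (hi.comp_add_right y).bdd_mul (c := M) hgc.aestronglyMeasurable (Eventually.of_forall hM)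
  have i2 : Integrable (Function.uncurry fun (x y : Eu N) => g x * ψ (x + y)) (volume.prod Θ) := by
    have hm : Continuous (Function.uncurry fun (x y : Eu N) => g x * ψ (x + y)) := by
      unfold Function.uncurry; fun_prop
    rw [integrable_prod_iff' hm.aestronglyMeasurable]
    refine ⟨Eventually.of_forall fun y => hi2 y, ?_⟩
    refine Integrable.of_bound (C := M * ∫ x, ‖ψ x‖) ?_ (Eventually.of_forall fun y => ?_)
    · have h3 : StronglyMeasurable (Function.uncurry fun (y x : Eu N) => ‖g x * ψ (x + y)‖) :=
        Continuous.stronglyMeasurable (by unfold Function.uncurry; fun_prop)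
      exact h3.integral_prod_right.aestronglyMeasurable
    · rw [Real.norm_of_nonneg (integral_nonneg fun x => norm_nonneg _)]
      rw [← integral_add_right_eq_self (fun x => ‖ψ x‖) y, ← integral_const_mul]
      refine integral_mono (hi2 y).norm ((hi.comp_add_right y).norm.const_mul M) fun x => ?_
      simp only [Function.uncurry, norm_mul]
      exact mul_le_mul_of_nonneg_right (hM _) (norm_nonneg _)
  have e1 : ∀ x, (∫ y, g (x - y) ∂Θ) * ψ x = ∫ y, g (x - y) * ψ x ∂Θ := fun x =>
    (integral_mul_const _ _).symm
  have e2 : ∀ x, ∫ y, ψ (x - y) ∂Θ = ∫ y, ψ (x + y) ∂Θ := by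
    intro x
    conv_lhs => rw [← h.inv (LinearIsometryEquiv.neg ℝ)]
    rw [integral_map (LinearIsometryEquiv.continuous _).measurable.aemeasurable
      (by fun_prop : Continuous fun y => ψ (x - y)).aestronglyMeasurable]
    simp
  simp_rw [e1, e2]
  rw [integral_integral_swap i1]
  simp_rw [← integral_const_mul]
  rw [integral_integral_swap i2]
  refine integral_congr_ae (Eventually.of_forall fun y => ?_)
  simp only
  rw [← integral_add_right_eq_self (fun x => g (x - y) * ψ x) y]
  simp

theorem Rop_integral (h : ResM N lam Θ) {ψ : Eu N → ℝ} (hψ : Continuous ψ)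
    (hi : Integrable ψ) : ∫ x, Rop Θ ψ x = (1 / lam) * ∫ x, ψ x := by
  have h1 := Rop_symm h (BC.const 1) hψ hi
  have h2 : ∀ x, Rop Θ (fun _ => (1:ℝ)) x = 1 / lam := by
    intro x; unfold Rop; simp [h.mass]
  simp_rw [h2, one_mul, integral_const_mul] at h1
  exact h1.symm

structure KD (N : ℕ) (V : Eu N → ℝ) (L : ℝ) (Θ : Measure (Eu N)) : Prop where
  hN : 3 ≤ N
  L0 : 0 ≤ L
  res : ResM N (1 + L) Θ
  lip : ∀ x, LLA V x
  nn : ∀ x, 0 ≤ V x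
  le : ∀ x, V x ≤ L
  rad : ∀ x y, ‖x‖ = ‖y‖ → V x = V y

structure IsK (V : Eu N → ℝ) (L : ℝ) (Θ : Measure (Eu N)) (f u : Eu N → ℝ) : Prop where
  bc : BC u
  eq : ∀ x, u x = Rop Θ (fun z => f z + (L - V z) * u z) x

variable {V : Eu N → ℝ} {L : ℝ}

theorem KD.bcV (h : KD N V L Θ) : BC V :=
  ⟨continuous_iff_continuousAt.2 fun x => (h.lip x).continuousAt, L, fun x => by
    rw [Real.norm_of_nonneg (h.nn x)]; exact h.le x⟩

theorem KD.bcW (h : KD N V L Θ) {u : Eu N → ℝ} (hu : BC u) : BC (fun z => (L - V z) * u z) :=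
  ((BC.const L).sub h.bcV).mul hu

theorem K_exists (h : KD N V L Θ) {f : Eu N → ℝ} (hf : BC f) : ∃ u, IsK V L Θ f u := by
  have hB : ∀ u : BoundedContinuousFunction (Eu N) ℝ, BC (fun x => u x) := fun u =>
    ⟨u.continuous, ‖u‖, u.norm_coe_le_norm⟩
  have hG : ∀ u : BoundedContinuousFunction (Eu N) ℝ, BC (fun z => f z + (L - V z) * u z) :=
    fun u => hf.add (h.bcW (hB u))
  have hR := fun u => Rop_BC h.res (hG u)
  have hΦ : ∀ u : BoundedContinuousFunction (Eu N) ℝ, ∃ v : BoundedContinuousFunction (Eu N) ℝ,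
      ∀ x, v x = Rop Θ (fun z => f z + (L - V z) * u z) x := by
    intro u
    obtain ⟨M, hM⟩ := (hR u).2
    exact ⟨BoundedContinuousFunction.ofNormedAddCommGroup _ (hR u).1 M hM, fun x => rfl⟩
  choose Φ hΦ using hΦ
  have hL1 : 0 < 1 + L := by linarith [h.L0]
  have hc : ContractingWith (Real.toNNReal (L / (1 + L))) Φ := by
    constructor
    · rw [← NNReal.coe_lt_coe, Real.coe_toNNReal _ (div_nonneg h.L0 hL1.le), NNReal.coe_one,
        div_lt_one hL1]
      linarith
    · refine LipschitzWith.of_dist_le_mul fun u v => ?_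
      rw [Real.coe_toNNReal _ (div_nonneg h.L0 hL1.le)]
      refine (BoundedContinuousFunction.dist_le (by have := h.L0; positivity)).2 fun x => ?_
      rw [hΦ, hΦ, Real.dist_eq, ← Rop_sub h.res (hG u) (hG v)]
      have := Rop_bd h.res (M := L * dist u v)
        (f := fun x => f x + (L - V x) * u x - (f x + (L - V x) * v x)) (fun z => ?_) x
      · refine this.trans (le_of_eq ?_); ring
      · rw [show f z + (L - V z) * u z - (f z + (L - V z) * v z) = (L - V z) * (u z - v z) by ring,
          norm_mul, Real.norm_of_nonneg (by linarith [h.le z])]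
        refine mul_le_mul (by linarith [h.nn z]) ?_ (norm_nonneg _) h.L0
        rw [← dist_eq_norm]; exact BoundedContinuousFunction.dist_coe_le_dist (f := u) (g := v) z
  have hfp : Φ (hc.fixedPoint) = hc.fixedPoint := hc.fixedPoint_isFixedPt
  refine ⟨fun x => (hc.fixedPoint) x, hB _, fun x => ?_⟩
  rw [← hΦ, hfp]

theorem IsK.weak (h : KD N V L Θ) {f u : Eu N → ℝ} (hf : BC f) (hu : IsK V L Θ f u)
    (Ω : Set (Eu N)) : Wk Ω u (fun x => f x - (1 + V x) * u x) := by
  intro φ hφ hc _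
  have hlc := (lap_contDiff hφ).continuous
  have hcf := hf.1
  have hcV := h.bcV.1
  have hcu := hu.bc.1
  have i1 : Integrable φ := cd_integrable hc hφ.continuous
  have i2 : Integrable (lap φ) := cd_integrable (lap_compactSupport hc) hlc
  have hsy := Rop_symm h.res (hf.add (h.bcW hu.bc)) (ψ := fun x => (1 + L) * φ x - lap φ x)
    ((continuous_const.mul hφ.continuous).sub hlc) ((i1.const_mul _).sub i2)
  have e1 : ∀ x, Rop Θ (fun x => (1 + L) * φ x - lap φ x) x = φ x := fun x => h.res.eqn φ hφ hc x
  simp_rw [e1, ← hu.eq] at hsy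
  obtain ⟨M, hM⟩ := hu.bc.bdm
  have j1 : Integrable (fun x => u x * φ x) :=
    cd_integrable (hc.mul_left) (hcu.mul hφ.continuous)
  have j2 : Integrable (fun x => u x * lap φ x) :=
    cd_integrable ((lap_compactSupport hc).mul_left) (hcu.mul hlc)
  have j3 : Integrable (fun x => (f x + (L - V x) * u x) * φ x) :=
    cd_integrable (hc.mul_left) ((hcf.add ((continuous_const.sub hcV).mul hcu)).mul hφ.continuous)
  have e2 : ∫ x, u x * ((1 + L) * φ x - lap φ x) = (1 + L) * (∫ x, u x * φ x) - ∫ x, u x * lap φ x := by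
    rw [← integral_const_mul, ← integral_sub (j1.const_mul _) j2]
    exact integral_congr_ae (Eventually.of_forall fun x => by simp only; ring)
  have e3 : ∫ x, (f x - (1 + V x) * u x) * φ x
      = (∫ x, (f x + (L - V x) * u x) * φ x) - (1 + L) * ∫ x, u x * φ x := by
    rw [← integral_const_mul, ← integral_sub j3 (j1.const_mul _)]
    exact integral_congr_ae (Eventually.of_forall fun x => by simp only; ring)
  rw [e3]
  linarith

theorem IsK.lla (h : KD N V L Θ) {f u : Eu N → ℝ} (hf : BC f) (hu : IsK V L Θ f u) (x : Eu N) :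
    LLA u x := by
  obtain ⟨C, hC, hl⟩ := weyl_lip h.hN one_pos
  obtain ⟨M, hM⟩ := hu.bc.bdm
  obtain ⟨M', hM'⟩ := (hf.sub (((BC.const 1).add h.bcV).mul hu.bc)).bdm
  have h1 : Bdm u (max M M') := ⟨hM.1, fun x => (hM.2 x).trans (le_max_left _ _)⟩
  have h2 : Bdm (fun x => f x - (1 + V x) * u x) (max M M') :=
    ⟨hM'.1, fun x => (hM'.2 x).trans (le_max_right _ _)⟩
  refine ⟨Real.toNNReal (C * max M M'), univ, univ_mem, ?_⟩
  refine LipschitzOnWith.of_dist_le_mul fun y _ z _ => ?_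
  rw [Real.coe_toNNReal _ (mul_nonneg hC.le h1.nonneg), Real.dist_eq, dist_eq_norm]
  exact hl univ u _ _ isOpen_univ h1 h2 (hu.weak h hf univ) hu.bc.1.continuousOn y z
    (subset_univ _) (subset_univ _)

theorem IsK.c2 (h : KD N V L Θ) {f u : Eu N → ℝ} (hf : BC f) (hfl : ∀ x, LLA f x)
    (hu : IsK V L Θ f u) (x : Eu N) :
    ContDiffAt ℝ 2 u x ∧ lap u x = (1 + V x) * u x - f x := by
  obtain ⟨M, hM⟩ := hu.bc.bdm
  obtain ⟨M', hM'⟩ := (hf.sub (((BC.const 1).add h.bcV).mul hu.bc)).bdm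
  have := weyl h.hN isOpen_univ hM hM' (hu.weak h hf univ) hu.bc.1.continuousOn (mem_univ x)
    ((hfl x).sub (((LLA.const 1 x).add (h.lip x)).mul (hu.lla h hf x)))
  refine ⟨this.1, ?_⟩
  have := this.2
  linarith

theorem IsK.sub (h : KD N V L Θ) {f g u v : Eu N → ℝ} (hf : BC f) (hg : BC g) (hu : IsK V L Θ f u)
    (hv : IsK V L Θ g v) : IsK V L Θ (fun x => f x - g x) (fun x => u x - v x) := by
  refine ⟨hu.bc.sub hv.bc, fun x => ?_⟩
  rw [hu.eq x, hv.eq x, ← Rop_sub h.res (hf.add (h.bcW hu.bc)) (hg.add (h.bcW hv.bc))]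
  congr 1; funext z; ring

theorem IsK.const_mul (c : ℝ) {f u : Eu N → ℝ} (hu : IsK V L Θ f u) :
    IsK V L Θ (fun x => c * f x) (fun x => c * u x) := by
  refine ⟨(BC.const c).mul hu.bc, fun x => ?_⟩
  rw [hu.eq x]
  unfold Rop
  rw [← integral_const_mul]
  congr 1; funext z; ring

theorem IsK.iso (h : KD N V L Θ) {f u : Eu N → ℝ} (hf : BC f) (hu : IsK V L Θ f u)
    (T : Eu N ≃ₗᵢ[ℝ] Eu N) : IsK V L Θ (fun x => f (T x)) (fun x => u (T x)) := by
  refine ⟨hu.bc.comp_iso T, fun x => ?_⟩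
  rw [hu.eq (T x), ← Rop_iso h.res (hf.add (h.bcW hu.bc))]
  have : ∀ z, V (T z) = V z := fun z => h.rad _ _ (by simp)
  simp_rw [this]

/-- weak maximum principle -/
theorem IsK.nonneg_of (h : KD N V L Θ) {f u : Eu N → ℝ} (hf : BC f) (hfl : ∀ x, LLA f x)
    (hu : IsK V L Θ f u) {C : Set (Eu N)} (hC : IsClosed C) (hf0 : ∀ x ∈ C, 0 ≤ f x)
    (hb : ∀ z ∈ C, u z < 0 → C ∈ 𝓝 z) : ∀ z ∈ C, 0 ≤ u z := by
  obtain ⟨M, hM⟩ := hu.bc.2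
  refine max_principle hC hu.bc.1.continuousOn (B := -M) (fun z _ => (abs_le.1 (hM z)).1)
    fun z hz hneg => ⟨hb z hz hneg, (hu.c2 h hf hfl z).1, ?_⟩
  rw [(hu.c2 h hf hfl z).2]
  nlinarith [h.nn z, hf0 z hz]

theorem IsK.nonneg (h : KD N V L Θ) {f u : Eu N → ℝ} (hf : BC f) (hfl : ∀ x, LLA f x)
    (hu : IsK V L Θ f u) (hf0 : ∀ x, 0 ≤ f x) (x : Eu N) : 0 ≤ u x :=
  hu.nonneg_of h hf hfl isClosed_univ (fun x _ => hf0 x) (fun _ _ _ => univ_mem) x (mem_univ x)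

theorem IsK.le_const (h : KD N V L Θ) {f u : Eu N → ℝ} (hf : BC f) (hfl : ∀ x, LLA f x)
    (hu : IsK V L Θ f u) {M : ℝ} (hM0 : 0 ≤ M) (hfM : ∀ x, f x ≤ M) (x : Eu N) : u x ≤ M := by
  obtain ⟨B, hB⟩ := hu.bc.2
  have := max_principle (w := fun x => M - u x) isClosed_univ
    (continuous_const.sub hu.bc.1).continuousOn (B := M - B)
    (fun z _ => by linarith [(abs_le.1 (hB z)).2])
    (fun z _ hz => ⟨univ_mem, contDiffAt_const.sub (hu.c2 h hf hfl z).1, ?_⟩) x (mem_univ x)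
  · linarith
  · rw [lap_sub contDiffAt_const (hu.c2 h hf hfl z).1, lap_const, (hu.c2 h hf hfl z).2]
    nlinarith [h.nn z, hfM z]

theorem IsK.unique (h : KD N V L Θ) {f u v : Eu N → ℝ} (hf : BC f) (hu : IsK V L Θ f u)
    (hv : IsK V L Θ f v) : u = v := by
  have e : (fun x => f x - f x) = (fun _ : Eu N => (0:ℝ)) := by funext x; ring
  have h1 := hu.sub h hf hf hv
  have h2 := hv.sub h hf hf hu
  rw [e] at h1 h2
  funext x
  have a1 := h1.nonneg h (BC.const 0) (fun x => LLA.const 0 x) (fun _ => le_rfl) x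
  have a2 := h2.nonneg h (BC.const 0) (fun x => LLA.const 0 x) (fun _ => le_rfl) x
  linarith

end B3


open Set Filter Topology MeasureTheory
open scoped NNReal ContDiff

section B4
variable {N : ℕ} {Θ : Measure (Eu N)} {V : Eu N → ℝ} {L : ℝ}

structure Src (f : Eu N → ℝ) : Prop where
  lla : ∀ x, LLA f x
  cs : HasCompactSupport f

theorem Src.cont {f : Eu N → ℝ} (hf : Src f) : Continuous f :=
  continuous_iff_continuousAt.2 fun x => (hf.lla x).continuousAt

theorem Src.bc {f : Eu N → ℝ} (hf : Src f) : BC f := by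
  obtain ⟨C, _, hC⟩ := cs_bound hf.cs hf.cont
  exact ⟨hf.cont, C, hC⟩

theorem Src.int {f : Eu N → ℝ} (hf : Src f) : Integrable f := cd_integrable hf.cs hf.cont

theorem Src.rpow {f : Eu N → ℝ} (hf : Src f) {b : ℝ} (hb : 1 ≤ b) : Src (fun x => f x ^ b) :=
  ⟨fun x => (hf.lla x).rpow hb, hf.cs.comp_left (g := fun y : ℝ => y ^ b) (by
    exact Real.zero_rpow (by linarith))⟩

theorem Src.mul_left {f g : Eu N → ℝ} (hf : Src f) (hg : ∀ x, LLA g x) : Src (fun x => f x * g x) :=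
  ⟨fun x => (hf.lla x).mul (hg x), hf.cs.mul_right⟩

noncomputable def KK (V : Eu N → ℝ) (L : ℝ) (Θ : Measure (Eu N)) (f : Eu N → ℝ) : Eu N → ℝ :=
  open Classical in if h : ∃ u, IsK V L Θ f u then h.choose else 0

theorem KK_spec (h : KD N V L Θ) {f : Eu N → ℝ} (hf : BC f) : IsK V L Θ f (KK V L Θ f) := by
  have := K_exists h hf
  unfold KK
  rw [dif_pos this]
  exact this.choose_spec

theorem barrier (hN : 3 ≤ N) : ∃ B : Eu N → ℝ, (∀ x, 0 < B x) ∧ Integrable B ∧ ContDiff ℝ 2 B ∧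
    ∀ x, lap B x ≤ B x / 2 := by
  set κ : ℝ := 8 * N * (N + 1) + 1 with hκ
  have hκ1 : 1 ≤ κ := by rw [hκ]; have : (0:ℝ) ≤ 8 * N * (N + 1) := by positivity
                         linarith
  have hpos : ∀ t : ℝ, 0 ≤ t → 0 < κ + t := fun t ht => by linarith
  have hsm : ContDiff ℝ 2 (fun x : Eu N => ((κ + ‖x‖ ^ 2) ^ N)⁻¹) := by
    refine ContDiff.inv ?_ (fun x => (pow_pos (hpos _ (sq_nonneg _)) N).ne')
    exact (contDiff_const.add (contDiff_norm_sq ℝ)).pow N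
  refine ⟨fun x => ((κ + ‖x‖ ^ 2) ^ N)⁻¹, fun x => inv_pos.2 (pow_pos (hpos _ (sq_nonneg _)) N),
    ?_, hsm, fun x => ?_⟩
  · have h1 := integrable_rpow_neg_one_add_norm_sq (E := Eu N) (μ := volume) (r := 2 * N) (by
      rw [finrank_euclideanSpace_fin]
      have : (3:ℝ) ≤ N := by exact_mod_cast hN
      linarith)
    refine h1.mono' hsm.continuous.aestronglyMeasurable (Eventually.of_forall fun x => ?_)
    rw [Real.norm_of_nonneg (inv_pos.2 (pow_pos (hpos _ (sq_nonneg _)) N)).le,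
      show (-(2 * (N:ℝ)) / 2) = -(N:ℝ) by ring, Real.rpow_neg (by positivity), Real.rpow_natCast]
    gcongr
  · have hd : ∀ t, 0 < κ + t → HasDerivAt (fun t => ((κ + t) ^ N)⁻¹) (-N * ((κ + t) ^ (N + 1))⁻¹) t := by
      intro t ht
      have h1 : HasDerivAt (fun t => κ + t) 1 t := (hasDerivAt_id t).const_add κ
      refine ((h1.pow N).fun_inv (pow_pos ht N).ne').congr_deriv ?_
      obtain ⟨k, rfl⟩ : ∃ k, N = k + 1 := ⟨N - 1, by omega⟩
      simp only [Pi.pow_apply, Nat.add_sub_cancel]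
      field_simp
      ring
    have hd2 : ∀ t, 0 < κ + t → HasDerivAt (fun t => -N * ((κ + t) ^ (N + 1))⁻¹)
        (N * (N + 1) * ((κ + t) ^ (N + 2))⁻¹) t := by
      intro t ht
      have h1 : HasDerivAt (fun t => κ + t) 1 t := (hasDerivAt_id t).const_add κ
      refine (((h1.pow (N + 1)).fun_inv (pow_pos ht (N + 1)).ne').const_mul (-N : ℝ)).congr_deriv ?_
      simp only [Pi.pow_apply, Nat.add_sub_cancel]
      push_cast
      field_simp
      ring
    have hev : ∀ᶠ t in 𝓝 (‖x - 0‖ ^ 2), HasDerivAt (fun t => ((κ + t) ^ N)⁻¹) (-N * ((κ + t) ^ (N + 1))⁻¹) t := by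
      have : ∀ᶠ t in 𝓝 (‖x - 0‖ ^ 2), -κ < t :=
        lt_mem_nhds (by nlinarith [sq_nonneg ‖x - 0‖])
      filter_upwards [this] with t ht
      exact hd t (by linarith)
    have := lap_radial 0 x hev (hd2 _ (hpos _ (sq_nonneg _)))
    simp only [sub_zero] at this
    rw [this]
    set t := ‖x‖ ^ 2
    have ht : 0 ≤ t := sq_nonneg _
    have hk := hpos t ht
    have hN0 : (0:ℝ) ≤ N := by positivity
    have e1 : ((κ + t) ^ (N + 1))⁻¹ = ((κ + t) ^ N)⁻¹ * (κ + t)⁻¹ := by rw [pow_succ, mul_inv]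
    have e2 : ((κ + t) ^ (N + 2))⁻¹ = ((κ + t) ^ N)⁻¹ * (κ + t)⁻¹ * (κ + t)⁻¹ := by
      rw [pow_succ, pow_succ, mul_inv, mul_inv]
    have hb : 0 < ((κ + t) ^ N)⁻¹ := inv_pos.2 (pow_pos hk N)
    have hi : 0 < (κ + t)⁻¹ := inv_pos.2 hk
    have e3 : (κ + t) * (κ + t)⁻¹ = 1 := mul_inv_cancel₀ hk.ne'
    rw [e1, e2]
    have k1 : 4 * t * (N * (N + 1)) * (κ + t)⁻¹ * (κ + t)⁻¹ ≤ 1 / 2 := by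
      have a1 : t * (κ + t)⁻¹ ≤ 1 := by nlinarith
      have a2 : 8 * (N * (N + 1)) * (κ + t)⁻¹ ≤ 1 := by
        refine le_of_le_of_eq (mul_le_mul_of_nonneg_right ?_ hi.le) e3
        rw [hκ]; linarith
      have a3 : 0 ≤ 8 * (N * (N + 1)) * (κ + t)⁻¹ := by positivity
      have a4 := mul_le_mul a1 a2 a3 zero_le_one
      nlinarith
    have k2 : 0 ≤ 2 * (N:ℝ) * (N * (((κ + t) ^ N)⁻¹ * (κ + t)⁻¹)) := by positivity
    have k3 := mul_le_mul_of_nonneg_left k1 hb.le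
    linarith

theorem IsK.integrable (h : KD N V L Θ) {f u : Eu N → ℝ} (hf : Src f) (hf0 : ∀ x, 0 ≤ f x)
    (hu : IsK V L Θ f u) : Integrable u := by
  obtain ⟨B, hB0, hBi, hBs, hBl⟩ := barrier (N := N) h.hN
  have hu0 := hu.nonneg h hf.bc hf.lla hf0
  have hq : Continuous (fun x => f x / B x) := hf.cont.div hBs.continuous (fun x => (hB0 x).ne')
  have hqc : HasCompactSupport (fun x => f x / B x) := by
    have : (fun x => f x / B x) = fun x => f x * (B x)⁻¹ := by funext x; rw [div_eq_mul_inv]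
    rw [this]; exact hf.cs.mul_right
  obtain ⟨A, hA0, hA⟩ := cs_bound hqc hq
  have hfA : ∀ x, f x ≤ A * B x := fun x => by
    have := (le_abs_self _).trans (hA x)
    rwa [div_le_iff₀ (hB0 x)] at this
  obtain ⟨M, hM⟩ := hu.bc.2
  have key := max_principle (w := fun x => 2 * A * B x - u x) isClosed_univ
    ((continuous_const.mul hBs.continuous).sub hu.bc.1).continuousOn (B := - M)
    (fun z _ => by
      have := (abs_le.1 (hM z)).2
      have := mul_nonneg hA0 (hB0 z).le
      linarith)
    (fun z _ hz => ⟨univ_mem, (contDiffAt_const.mul hBs.contDiffAt).sub (hu.c2 h hf.bc hf.lla z).1, by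
      rw [lap_sub (contDiffAt_const.mul hBs.contDiffAt) (hu.c2 h hf.bc hf.lla z).1,
        lap_const_mul _ hBs.contDiffAt, (hu.c2 h hf.bc hf.lla z).2]
      have := mul_le_mul_of_nonneg_left (hBl z) (by linarith : 0 ≤ 2 * A)
      have := mul_nonneg (h.nn z) (hu0 z)
      have := hfA z
      linarith⟩)
  refine (hBi.const_mul (2 * A)).mono' hu.bc.1.aestronglyMeasurable (Eventually.of_forall fun x => ?_)
  rw [Real.norm_of_nonneg (hu0 x)]
  linarith [key x (mem_univ x)]

theorem int_rpow {u : Eu N → ℝ} (hu : BC u) (hu0 : ∀ x, 0 ≤ u x) (hi : Integrable u) {b : ℝ}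
    (hb : 1 ≤ b) : Integrable (fun x => u x ^ b) := by
  obtain ⟨M, hM⟩ := hu.2
  have hM0 : 0 ≤ M := (norm_nonneg _).trans (hM 0)
  refine (hi.const_mul (M ^ (b - 1))).mono'
    (hu.1.rpow_const fun x => Or.inr (by linarith)).aestronglyMeasurable
    (Eventually.of_forall fun x => ?_)
  rw [Real.norm_of_nonneg (Real.rpow_nonneg (hu0 x) b)]
  have e : u x ^ b = u x ^ (b - 1) * u x := by
    rcases (hu0 x).eq_or_lt with h | h
    · rw [← h, Real.zero_rpow (by linarith)]; simp
    · rw [← Real.rpow_add_one h.ne']; congr 1; ring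
  rw [e]
  refine mul_le_mul_of_nonneg_right ?_ (hu0 x)
  exact Real.rpow_le_rpow (hu0 x) ((le_abs_self _).trans (hM x)) (by linarith)

theorem IsK.integral_le (h : KD N V L Θ) {f u : Eu N → ℝ} (hf : Src f) (hf0 : ∀ x, 0 ≤ f x)
    (hu : IsK V L Θ f u) : ∫ x, u x ≤ ∫ x, f x := by
  have hi := hu.integrable h hf hf0
  have hu0 := hu.nonneg h hf.bc hf.lla hf0
  have hWi : Integrable (fun x => (L - V x) * u x) := by
    refine hi.bdd_mul (c := L) (continuous_const.sub h.bcV.1).aestronglyMeasurable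
      (Eventually.of_forall fun x => ?_)
    rw [Real.norm_of_nonneg (by linarith [h.le x])]; linarith [h.nn x]
  have hc := (hf.bc.add (h.bcW hu.bc)).1
  have h1 := Rop_integral h.res hc (hf.int.add hWi)
  simp_rw [← hu.eq] at h1
  have h2 : ∫ x, (f x + (L - V x) * u x) ≤ (∫ x, f x) + L * ∫ x, u x := by
    rw [integral_add hf.int hWi, ← integral_const_mul]
    refine add_le_add le_rfl (integral_mono hWi (hi.const_mul L) fun x => ?_)
    exact mul_le_mul_of_nonneg_right (by linarith [h.nn x]) (hu0 x)
  have hL : 0 < 1 + L := by linarith [h.L0]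
  have h3 : (1 + L) * ∫ x, u x = ∫ x, (f x + (L - V x) * u x) := by
    rw [h1]; field_simp
  linarith

theorem IsK.symm (h : KD N V L Θ) {f g u v : Eu N → ℝ} (hf : Src f) (hf0 : ∀ x, 0 ≤ f x)
    (hg : Src g) (hg0 : ∀ x, 0 ≤ g x) (hu : IsK V L Θ f u) (hv : IsK V L Θ g v) :
    ∫ x, u x * g x = ∫ x, f x * v x := by
  have hiu := hu.integrable h hf hf0
  have hiv := hv.integrable h hg hg0
  have hW : ∀ {w : Eu N → ℝ}, Integrable w → Integrable (fun x => (L - V x) * w x) := by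
    intro w hw
    refine hw.bdd_mul (c := L) (continuous_const.sub h.bcV.1).aestronglyMeasurable
      (Eventually.of_forall fun x => ?_)
    rw [Real.norm_of_nonneg (by linarith [h.le x])]; linarith [h.nn x]
  have hc := (hg.bc.add (h.bcW hv.bc)).1
  have h1 := Rop_symm h.res (hf.bc.add (h.bcW hu.bc)) hc (hg.int.add (hW hiv))
  simp_rw [← hu.eq, ← hv.eq] at h1
  obtain ⟨M, hM⟩ := hu.bc.2
  obtain ⟨M', hM'⟩ := hv.bc.2
  have j1 : Integrable (fun x => u x * g x) :=
    hg.int.bdd_mul hu.bc.1.aestronglyMeasurable (Eventually.of_forall hM)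
  have j2 : Integrable (fun x => u x * ((L - V x) * v x)) :=
    (hW hiv).bdd_mul hu.bc.1.aestronglyMeasurable (Eventually.of_forall hM)
  have j3 : Integrable (fun x => f x * v x) :=
    hf.int.mul_bdd hv.bc.1.aestronglyMeasurable (Eventually.of_forall hM')
  have e1 : ∫ x, u x * (g x + (L - V x) * v x) = (∫ x, u x * g x) + ∫ x, u x * ((L - V x) * v x) := by
    rw [← integral_add j1 j2]; congr 1; funext x; ring
  have e2 : ∫ x, (f x + (L - V x) * u x) * v x = (∫ x, f x * v x) + ∫ x, u x * ((L - V x) * v x) := by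
    rw [← integral_add j3 j2]; congr 1; funext x; ring
  linarith

theorem tangent {f l b : ℝ} (hf : 0 ≤ f) (hl : 0 < l) (hb : 1 ≤ b) :
    0 ≤ f ^ b - b * l ^ (b - 1) * f + (b - 1) * l ^ b := by
  have h1 := one_add_mul_self_le_rpow_one_add (s := f / l - 1) (by
    have : 0 ≤ f / l := by positivity
    linarith) hb
  rw [show 1 + (f / l - 1) = f / l by ring, Real.div_rpow hf hl.le] at h1
  have hlb : 0 < l ^ b := Real.rpow_pos_of_pos hl b
  have e : l ^ (b - 1) = l ^ b / l := by rw [Real.rpow_sub_one hl.ne']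
  rw [le_div_iff₀ hlb] at h1
  rw [e]
  have : (1 + b * (f / l - 1)) * l ^ b = b * (l ^ b / l) * f - (b - 1) * l ^ b := by
    field_simp; ring
  linarith

/-- Jensen-type inequality -/
theorem IsK.jensen (h : KD N V L Θ) {f u U : Eu N → ℝ} (hf : Src f) (hf0 : ∀ x, 0 ≤ f x) {b : ℝ}
    (hb : 1 ≤ b) (hu : IsK V L Θ f u) (hU : IsK V L Θ (fun x => f x ^ b) U) (x : Eu N) :
    u x ^ b ≤ U x := by
  have hF := hf.rpow hb
  have hF0 : ∀ x, 0 ≤ f x ^ b := fun x => Real.rpow_nonneg (hf0 x) b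
  have hU0 := hU.nonneg h hF.bc hF.lla hF0
  have hu0 := hu.nonneg h hf.bc hf.lla hf0
  rcases (hu0 x).eq_or_lt with h0 | hl
  · rw [← h0, Real.zero_rpow (by linarith)]; exact hU0 x
  set l := u x with hldef
  have hc1 := fun z => (hu.c2 h hf.bc hf.lla z)
  have hc2 := fun z => (hU.c2 h hF.bc hF.lla z)
  obtain ⟨M, hM⟩ := hu.bc.2
  have hlb : 0 ≤ (b - 1) * l ^ b := mul_nonneg (by linarith) (Real.rpow_nonneg hl.le b)
  have hcf : 0 ≤ b * l ^ (b - 1) := mul_nonneg (by linarith) (Real.rpow_nonneg hl.le _)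
  have key := max_principle (w := fun z => (U z - b * l ^ (b - 1) * u z) + (b - 1) * l ^ b) isClosed_univ
    ((hU.bc.1.sub (continuous_const.mul hu.bc.1)).add continuous_const).continuousOn
    (B := - (b * l ^ (b - 1) * M))
    (fun z _ => by
      have := mul_le_mul_of_nonneg_left (abs_le.1 (hM z)).2 hcf
      linarith [hU0 z])
    (fun z _ hz => ⟨univ_mem, ((hc2 z).1.sub (contDiffAt_const.mul (hc1 z).1)).add contDiffAt_const, by
      rw [lap_add ((hc2 z).1.sub (contDiffAt_const.mul (hc1 z).1)) contDiffAt_const,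
        lap_sub (hc2 z).1 (contDiffAt_const.mul (hc1 z).1), lap_const_mul _ (hc1 z).1, lap_const,
        (hc1 z).2, (hc2 z).2]
      have t1 := tangent (hf0 z) hl hb
      have t2 := mul_nonneg (h.nn z) (neg_nonneg.2 hz.le)
      have t3 := mul_nonneg (h.nn z) hlb
      nlinarith⟩) x (mem_univ x)
  simp only [← hldef] at key
  have e : l ^ (b - 1) * l = l ^ b := by rw [← Real.rpow_add_one hl.ne']; congr 1; ring
  rw [mul_assoc, e] at key
  linarith

theorem IsK.integral_rpow_le (h : KD N V L Θ) {f u : Eu N → ℝ} (hf : Src f) (hf0 : ∀ x, 0 ≤ f x)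
    {b : ℝ} (hb : 1 ≤ b) (hu : IsK V L Θ f u) : ∫ x, u x ^ b ≤ ∫ x, f x ^ b := by
  have hF := hf.rpow hb
  have hF0 : ∀ x, 0 ≤ f x ^ b := fun x => Real.rpow_nonneg (hf0 x) b
  obtain ⟨U, hU⟩ := K_exists h hF.bc
  have hu0 := hu.nonneg h hf.bc hf.lla hf0
  refine le_trans ?_ (hU.integral_le h hF hF0)
  exact integral_mono (int_rpow hu.bc hu0 (hu.integrable h hf hf0) hb) (hU.integrable h hF hF0)
    fun x => hu.jensen h hf hf0 hb hU x

end B4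


open Set Filter Topology MeasureTheory
open scoped NNReal ContDiff

section B5
variable {N : ℕ} {Θ : Measure (Eu N)} {V : Eu N → ℝ} {L : ℝ} {m : ℕ}

def Cone (m : ℕ) (f : Eu N → ℝ) : Prop :=
  ∀ x y, ‖x‖ = ‖y‖ → tVar m y ≤ tVar m x → f x ≤ f y

theorem sVar_nonneg (x : Eu N) : 0 ≤ sVar m x := Real.sqrt_nonneg _
theorem tVar_nonneg (x : Eu N) : 0 ≤ tVar m x := Real.sqrt_nonneg _

theorem sVar_sq (x : Eu N) : sVar m x ^ 2 = ∑ i : Fin N, if (i : ℕ) < m then x i ^ 2 else 0 := by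
  unfold sVar
  rw [Real.sq_sqrt]
  exact Finset.sum_nonneg fun i _ => by split_ifs <;> positivity

theorem tVar_sq (x : Eu N) : tVar m x ^ 2 = ∑ i : Fin N, if (i : ℕ) < m then 0 else x i ^ 2 := by
  unfold tVar
  rw [Real.sq_sqrt]
  exact Finset.sum_nonneg fun i _ => by split_ifs <;> positivity

theorem st_sq (x : Eu N) : sVar m x ^ 2 + tVar m x ^ 2 = ‖x‖ ^ 2 := by
  rw [sVar_sq, tVar_sq, ← Finset.sum_add_distrib, EuclideanSpace.norm_sq_eq]
  refine Finset.sum_congr rfl fun i _ => ?_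
  split_ifs <;> simp

noncomputable def pl (i0 i1 : Fin N) (a b : ℝ) : Eu N :=
  EuclideanSpace.single i0 a + EuclideanSpace.single i1 b

variable {i0 i1 : Fin N}

theorem pl_apply0 (h : i0 ≠ i1) (a b : ℝ) : pl i0 i1 a b i0 = a := by
  simp [pl, h]

theorem pl_apply1 (h : i0 ≠ i1) (a b : ℝ) : pl i0 i1 a b i1 = b := by
  simp [pl, h.symm]

theorem pl_apply (a b : ℝ) {i : Fin N} (h : i ≠ i0) (h' : i ≠ i1) : pl i0 i1 a b i = 0 := by
  simp [pl, h, h']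

theorem inner_pl (a b : ℝ) (z : Eu N) : inner ℝ (pl i0 i1 a b) z = a * z i0 + b * z i1 := by
  simp [pl, inner_add_left, EuclideanSpace.inner_single_left]

theorem norm_pl (h : i0 ≠ i1) (a b : ℝ) : ‖pl i0 i1 a b‖ ^ 2 = a ^ 2 + b ^ 2 := by
  rw [← real_inner_self_eq_norm_sq, inner_pl, pl_apply0 h, pl_apply1 h]; ring

theorem pl_smul (c a b : ℝ) : c • pl i0 i1 a b = pl i0 i1 (c * a) (c * b) := by
  ext i; simp [pl]

theorem pl_sub (a b a' b' : ℝ) : pl i0 i1 a b - pl i0 i1 a' b' = pl i0 i1 (a - a') (b - b') := by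
  ext i; simp [pl]; split_ifs <;> ring

theorem idx_ne (h0 : (i0 : ℕ) < m) (h1 : m ≤ (i1 : ℕ)) : i0 ≠ i1 := by
  intro h; rw [h] at h0; omega

theorem tVar_sub_pl (h0 : (i0 : ℕ) < m) (h1 : m ≤ (i1 : ℕ)) (z : Eu N) (a b : ℝ) :
    tVar m (z - pl i0 i1 a b) ^ 2 = tVar m z ^ 2 - 2 * b * z i1 + b ^ 2 := by
  have hne := idx_ne h0 h1
  have : tVar m (z - pl i0 i1 a b) ^ 2 - tVar m z ^ 2 = - 2 * b * z i1 + b ^ 2 := by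
    rw [tVar_sq, tVar_sq, ← Finset.sum_sub_distrib, Finset.sum_eq_single i1]
    · rw [if_neg (by omega), if_neg (by omega)]
      simp only [PiLp.sub_apply, pl_apply1 hne]; ring
    · intro i _ hi
      by_cases h : (i : ℕ) < m
      · simp [h]
      · rw [if_neg h, if_neg h, PiLp.sub_apply, pl_apply a b (by rintro rfl; exact h h0) hi]; ring
    · simp
  linarith

theorem tVar_pl (h0 : (i0 : ℕ) < m) (h1 : m ≤ (i1 : ℕ)) (a : ℝ) {b : ℝ} (hb : 0 ≤ b) :
    tVar m (pl i0 i1 a b) = b := by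
  have h := tVar_sub_pl h0 h1 (pl i0 i1 a b) (a - a) b
  have h2 : pl i0 i1 a b - pl i0 i1 (a - a) b = pl i0 i1 a 0 := by rw [pl_sub]; simp
  have h3 : tVar m (pl i0 i1 a 0) ^ 2 = 0 := by
    rw [tVar_sq]
    refine Finset.sum_eq_zero fun i _ => ?_
    split_ifs with hi
    · rfl
    · by_cases hi1 : i = i1
      · rw [hi1, pl_apply1 (idx_ne h0 h1)]; simp
      · rw [pl_apply a 0 (by rintro rfl; exact hi h0) hi1]; simp
  rw [h2, h3, pl_apply1 (idx_ne h0 h1)] at h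
  have : tVar m (pl i0 i1 a b) ^ 2 = b ^ 2 := by linarith
  exact (sq_eq_sq₀ (tVar_nonneg _) hb).1 this

theorem sVar_pl (h0 : (i0 : ℕ) < m) (h1 : m ≤ (i1 : ℕ)) {a b : ℝ} (ha : 0 ≤ a) (hb : 0 ≤ b) :
    sVar m (pl i0 i1 a b) = a := by
  have h := st_sq (m := m) (pl i0 i1 a b)
  rw [tVar_pl h0 h1 a hb, norm_pl (idx_ne h0 h1)] at h
  exact (sq_eq_sq₀ (sVar_nonneg _) ha).1 (by linarith)

/-- reflection sending `x` to `y` -/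
noncomputable def rfl2 (d : Eu N) : Eu N ≃ₗᵢ[ℝ] Eu N := (ℝ ∙ d)ᗮ.reflection

theorem rfl2_apply (d z : Eu N) : rfl2 d z = z - (2 * (inner ℝ d z / ‖d‖ ^ 2)) • d := by
  unfold rfl2
  rw [Submodule.reflection_orthogonal_apply, Submodule.reflection_singleton_apply]
  simp only [RCLike.ofReal_real_eq_id, id_eq, neg_sub, sub_right_inj]
  rw [← smul_smul, ofNat_smul_eq_nsmul ℝ 2]

theorem rfl2_maps {x y : Eu N} (h : ‖x‖ = ‖y‖) : rfl2 (x - y) x = y :=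
  Submodule.reflection_sub h

theorem rfl2_tVar {d : Eu N} (hd : ∀ i : Fin N, m ≤ (i : ℕ) → d i = 0) (z : Eu N) :
    tVar m (rfl2 d z) = tVar m z := by
  unfold tVar
  congr 1
  refine Finset.sum_congr rfl fun i _ => ?_
  split_ifs with h
  · rfl
  · rw [rfl2_apply]; simp [hd i (by omega)]

theorem rfl2_sVar {d : Eu N} (hd : ∀ i : Fin N, (i : ℕ) < m → d i = 0) (z : Eu N) :
    sVar m (rfl2 d z) = sVar m z := by
  unfold sVar
  congr 1
  refine Finset.sum_congr rfl fun i _ => ?_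
  split_ifs with h
  · rw [rfl2_apply]; simp [hd i h]
  · rfl

theorem rfl2_tVar' {d : Eu N} (hd : ∀ i : Fin N, (i : ℕ) < m → d i = 0) (z : Eu N) :
    tVar m (rfl2 d z) = tVar m z := by
  have h1 := st_sq (m := m) (rfl2 d z)
  have h2 := st_sq (m := m) z
  rw [rfl2_sVar hd, LinearIsometryEquiv.norm_map] at h1
  exact (sq_eq_sq₀ (tVar_nonneg _) (tVar_nonneg _)).1 (by linarith)

theorem canon (h0 : (i0 : ℕ) < m) (h1 : m ≤ (i1 : ℕ)) (x : Eu N) :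
    ∃ T : Eu N ≃ₗᵢ[ℝ] Eu N, (∀ z, tVar m (T z) = tVar m z) ∧
      T x = pl i0 i1 (sVar m x) (tVar m x) := by
  have hne := idx_ne h0 h1
  set x' : Eu N := WithLp.toLp 2 (fun i => if (i : ℕ) < m then (if i = i0 then sVar m x else 0) else x i) with hx'
  have hx'a : ∀ i, x' i = if (i : ℕ) < m then (if i = i0 then sVar m x else 0) else x i := fun i => rfl
  have ht' : tVar m x' = tVar m x := by
    unfold tVar; congr 1
    refine Finset.sum_congr rfl fun i _ => ?_
    split_ifs with h
    · rfl
    · rw [hx'a, if_neg h]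
  have hs' : sVar m x' ^ 2 = sVar m x ^ 2 := by
    rw [sVar_sq x', Finset.sum_eq_single i0]
    · rw [if_pos h0, hx'a, if_pos h0, if_pos rfl]
    · intro i _ hi
      split_ifs with h
      · rw [hx'a, if_pos h, if_neg hi]; simp
      · rfl
    · simp
  have hn1 : ‖x‖ = ‖x'‖ := by
    refine (sq_eq_sq₀ (norm_nonneg _) (norm_nonneg _)).1 ?_
    rw [← st_sq (m := m), ← st_sq (m := m), ht', hs']
  set x2 := pl i0 i1 (sVar m x) (tVar m x) with hx2
  have hn2 : ‖x'‖ = ‖x2‖ := by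
    rw [← hn1]
    refine (sq_eq_sq₀ (norm_nonneg _) (norm_nonneg _)).1 ?_
    rw [← st_sq (m := m), hx2, norm_pl hne]
  refine ⟨(rfl2 (x - x')).trans (rfl2 (x' - x2)), fun z => ?_, ?_⟩
  · rw [LinearIsometryEquiv.trans_apply, rfl2_tVar', rfl2_tVar]
    · intro i hi
      rw [PiLp.sub_apply, hx'a, if_neg (by omega), sub_self]
    · intro i hi
      rw [PiLp.sub_apply, hx'a, if_pos hi]
      by_cases hii : i = i0
      · rw [if_pos hii, hii, hx2, pl_apply0 hne, sub_self]
      · rw [if_neg hii, hx2, pl_apply _ _ hii (by rintro rfl; omega), sub_self]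
  · rw [LinearIsometryEquiv.trans_apply, rfl2_maps hn1, rfl2_maps hn2]

theorem Cone.eq {f : Eu N → ℝ} (hf : Cone m f) {x y : Eu N} (h : ‖x‖ = ‖y‖)
    (ht : tVar m x = tVar m y) : f x = f y :=
  le_antisymm (hf x y h ht.ge) (hf y x h.symm ht.le)

theorem IsK.canon (h : KD N V L Θ) (h0 : (i0 : ℕ) < m) (h1 : m ≤ (i1 : ℕ)) {f u : Eu N → ℝ}
    (hf : BC f) (hu : IsK V L Θ f u) (hc : Cone m f) (x : Eu N) :
    u x = u (pl i0 i1 (sVar m x) (tVar m x)) := by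
  obtain ⟨T, hT, hTx⟩ := _root_.canon h0 h1 x
  have h2 := hu.iso h hf T
  have e : (fun x => f (T x)) = f := by
    funext z
    exact hc.eq (by simp) (hT z)
  rw [e] at h2
  have := congrFun (hu.unique h hf h2) x
  rw [this, hTx]

theorem IsK.cone (h : KD N V L Θ) (h0 : (i0 : ℕ) < m) (h1 : m ≤ (i1 : ℕ)) {f u : Eu N → ℝ}
    (hf : Src f) (hu : IsK V L Θ f u) (hc : Cone m f) : Cone m u := by
  have hne := idx_ne h0 h1
  have hcan := hu.canon h h0 h1 hf.bc hc
  have hinv : ∀ x y, ‖x‖ = ‖y‖ → tVar m x ^ 2 = tVar m y ^ 2 → u x = u y := by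
    intro x y hn ht
    have ht' := (sq_eq_sq₀ (tVar_nonneg _) (tVar_nonneg _)).1 ht
    have hs : sVar m x = sVar m y := by
      have a := st_sq (m := m) x
      have b := st_sq (m := m) y
      rw [hn] at a
      exact (sq_eq_sq₀ (sVar_nonneg _) (sVar_nonneg _)).1 (by linarith)
    rw [hcan x, hcan y, ht', hs]
  intro x y hn ht
  rw [hcan x, hcan y]
  have hs : sVar m x ≤ sVar m y := by
    have a := st_sq (m := m) x
    have b := st_sq (m := m) y
    rw [hn] at a
    refine abs_le_of_sq_le_sq' ?_ (sVar_nonneg _) |>.2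
    nlinarith [tVar_nonneg (m := m) x, tVar_nonneg (m := m) y]
  have hsum : sVar m x ^ 2 + tVar m x ^ 2 = sVar m y ^ 2 + tVar m y ^ 2 := by
    rw [st_sq, st_sq, hn]
  have p1 := sVar_nonneg (m := m) x
  have p2 := tVar_nonneg (m := m) x
  have p3 := sVar_nonneg (m := m) y
  have p4 := tVar_nonneg (m := m) y
  generalize sVar m x = s at *
  generalize sVar m y = s' at *
  generalize tVar m x = t at *
  generalize tVar m y = t' at *
  have hnn : ‖pl i0 i1 s t‖ = ‖pl i0 i1 s' t'‖ :=
    (sq_eq_sq₀ (norm_nonneg _) (norm_nonneg _)).1 (by rw [norm_pl hne, norm_pl hne, hsum])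
  rcases ht.eq_or_lt with rfl | hlt
  · have : s = s' := (sq_eq_sq₀ p1 p3).1 (by linarith)
    rw [this]
  set X := pl i0 i1 s t with hX
  set Y := pl i0 i1 s' t' with hY
  have hd : X - Y = pl i0 i1 (s - s') (t - t') := pl_sub _ _ _ _
  set D := (s - s') ^ 2 + (t - t') ^ 2 with hD
  have hDp : 0 < D := by have : 0 < t - t' := by linarith
                         positivity
  set σ := rfl2 (X - Y) with hσ
  have hσX : σ X = Y := rfl2_maps hnn
  set A : Eu N → ℝ := fun z => (t - t') * z i0 + (s' - s) * z i1 with hA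
  set B : Eu N → ℝ := fun z => (s - s') * z i0 + (t - t') * z i1 with hB
  have hAc : Continuous A := by rw [hA]; fun_prop
  have hBc : Continuous B := by rw [hB]; fun_prop
  have hσz : ∀ z, σ z = z - pl i0 i1 (2 * (B z / D) * (s - s')) (2 * (B z / D) * (t - t')) := by
    intro z
    rw [hσ, rfl2_apply, hd, inner_pl, norm_pl hne, pl_smul]
  have htd : ∀ z, tVar m z ^ 2 - tVar m (σ z) ^ 2
      = 4 * (B z / D) * (t - t') * (A z / D) * (s' - s) := by
    intro z
    rw [hσz, tVar_sub_pl h0 h1]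
    have : z i1 * D = B z * (t - t') + A z * (s' - s) := by
      simp only [hA, hB, hD]; ring
    have h3 : z i1 = (B z * (t - t') + A z * (s' - s)) / D := by
      rw [← this]; field_simp
    rw [h3]
    field_simp
    ring
  set f' : Eu N → ℝ := fun x => f (σ x) - f x with hf'
  have hBC' : BC f' := (hf.bc.comp_iso σ).sub hf.bc
  have hL' : ∀ z, LLA f' z := fun z => by
    refine LLA.sub ?_ (hf.lla z)
    exact LLA.comp (f := fun x => σ x) (hf.lla (σ z))
      ⟨1, univ, univ_mem, σ.lipschitz.lipschitzOnWith⟩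
  have hw : IsK V L Θ f' (fun x => u (σ x) - u x) :=
    (hu.iso h hf.bc σ).sub h (hf.bc.comp_iso σ) hf.bc hu
  have hle : ∀ z, 0 ≤ A z → 0 ≤ B z → tVar m (σ z) ≤ tVar m z := by
    intro z ha hb
    have h3 : 0 ≤ 4 * (B z / D) * (t - t') * (A z / D) * (s' - s) := by
      have : 0 ≤ t - t' := by linarith
      have : 0 ≤ s' - s := by linarith
      positivity
    rw [← htd] at h3
    exact abs_le_of_sq_le_sq' (by linarith) (tVar_nonneg _) |>.2
  have key := hw.nonneg_of h hBC' hL' (C := {z | 0 ≤ A z ∧ 0 ≤ B z})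
    ((isClosed_le continuous_const hAc).inter (isClosed_le continuous_const hBc))
    (fun z hz => sub_nonneg.2 (hc z (σ z) (by simp) (hle z hz.1 hz.2)))
    (fun z hz hneg => by
      rcases hz.1.eq_or_lt with ha | ha
      · exfalso
        have h3 := htd z
        rw [← ha] at h3
        have := hinv (σ z) z (by simp) (by simp at h3; linarith)
        linarith
      rcases hz.2.eq_or_lt with hb | hb
      · exfalso
        have h3 : σ z = z := by
          have h4 : pl i0 i1 0 0 = (0 : Eu N) := by ext i; simp [pl]
          rw [hσz, ← hb]; simp [h4]
        rw [h3] at hneg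
        linarith
      · exact mem_of_superset ((isOpen_lt continuous_const hAc).inter
          (isOpen_lt continuous_const hBc) |>.mem_nhds ⟨ha, hb⟩) fun y hy => ⟨hy.1.le, hy.2.le⟩)
    X ⟨?_, ?_⟩
  · rw [hσX] at key; linarith
  · simp only [hA, hX, pl_apply0 hne, pl_apply1 hne]
    have : 0 ≤ t - t' := by linarith
    have : 0 ≤ s' - s := by linarith
    positivity
  · simp only [hB, hX, pl_apply0 hne, pl_apply1 hne]
    nlinarith [sq_nonneg (s - s'), sq_nonneg (t - t')]

end B5


open Set Filter Topology MeasureTheory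
open scoped NNReal ContDiff ENNReal

section B6
variable {N : ℕ} {Θ : Measure (Eu N)} {V : Eu N → ℝ} {L : ℝ} {m m' : ℕ}

noncomputable def yz (e : Fin m' → Fin N) (i0 : Fin N) (ρ : ℝ) (ζ : Eu m') : Eu N :=
  EuclideanSpace.single i0 (Real.sqrt (ρ ^ 2 - ‖ζ‖ ^ 2)) + ∑ j, EuclideanSpace.single (e j) (ζ j)

noncomputable def etaP (e : Fin m' → Fin N) (y : Eu N) : Eu m' := WithLp.toLp 2 (fun j => y (e j))

theorem yz_norm {e : Fin m' → Fin N} {i0 : Fin N} (he : Function.Injective e) (h0 : ∀ j, e j ≠ i0)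
    {ρ : ℝ} (hρ : 0 ≤ ρ) {ζ : Eu m'} (hζ : ‖ζ‖ ≤ ρ) : ‖yz e i0 ρ ζ‖ = ρ := by
  have a0 : yz e i0 ρ ζ i0 = Real.sqrt (ρ ^ 2 - ‖ζ‖ ^ 2) := by
    simp [yz, fun j => (h0 j).symm]
  have aj : ∀ j, yz e i0 ρ ζ (e j) = ζ j := by
    intro j
    simp [yz, h0 j, Pi.single_apply, he.eq_iff]
  refine (sq_eq_sq₀ (norm_nonneg _) hρ).1 ?_
  rw [← real_inner_self_eq_norm_sq]
  nth_rewrite 1 [yz]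
  rw [inner_add_left, sum_inner]
  simp only [EuclideanSpace.inner_single_left, a0, aj]
  have : ‖ζ‖ ^ 2 = ∑ j, ζ j * ζ j := by
    rw [EuclideanSpace.norm_sq_eq]; refine Finset.sum_congr rfl fun j _ => ?_
    simp [sq]
  have h2 : 0 ≤ ρ ^ 2 - ‖ζ‖ ^ 2 := by nlinarith [norm_nonneg ζ]
  have h3 := Real.mul_self_sqrt h2
  simp only [conj_trivial]
  linarith

theorem eta_le {e : Fin m' → Fin N} (he : Function.Injective e) (y : Eu N) : ‖etaP e y‖ ≤ ‖y‖ := by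
  refine (sq_le_sq₀ (norm_nonneg _) (norm_nonneg _)).1 ?_
  rw [EuclideanSpace.norm_sq_eq, EuclideanSpace.norm_sq_eq]
  have : ∑ j, ‖etaP e y j‖ ^ 2 = ∑ i ∈ Finset.univ.image e, ‖y i‖ ^ 2 := by
    rw [Finset.sum_image (fun a _ b _ h => he h)]; rfl
  rw [this]
  exact Finset.sum_le_sum_of_subset_of_nonneg (Finset.subset_univ _) fun _ _ _ => by positivity

theorem yz_dist {e : Fin m' → Fin N} {i0 : Fin N} (he : Function.Injective e) (h0 : ∀ j, e j ≠ i0)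
    (ρ : ℝ) (ζ : Eu m') (y : Eu N) : ‖ζ - etaP e y‖ ≤ ‖yz e i0 ρ ζ - y‖ := by
  have : ζ - etaP e y = etaP e (yz e i0 ρ ζ - y) := by
    ext j
    simp [etaP, yz, h0 j, Pi.single_apply, he.eq_iff]
  rw [this]; exact eta_le he _

theorem avg {e : Fin m' → Fin N} {i0 : Fin N} (he : Function.Injective e) (h0 : ∀ j, e j ≠ i0)
    (hi : (i0 : ℕ) < m) (hej : ∀ j, (e j : ℕ) < m)
    {H : Eu N → ℝ≥0∞} (hH : Measurable H)
    (hinv : ∀ x y, ‖x‖ = ‖y‖ → tVar m x = tVar m y → H x = H y)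
    {k : ℝ → ℝ≥0∞} (hk : Antitone k) {ρ : ℝ} (hρ : 0 ≤ ρ) :
    (∫⁻ y, H y * k ‖EuclideanSpace.single i0 ρ - y‖) * volume (Metric.ball (0 : Eu m') ρ) ≤
      (∫⁻ ζ : Eu m', k ‖ζ‖) * ∫⁻ y, H y := by
  have hkm := hk.measurable
  have hη : Continuous (etaP e) := by
    unfold etaP; fun_prop
  have key : ∀ ζ ∈ Metric.ball (0 : Eu m') ρ,
      ∫⁻ y, H y * k ‖EuclideanSpace.single i0 ρ - y‖ ≤ ∫⁻ y, H y * k ‖ζ - etaP e y‖ := by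
    intro ζ hζ
    have hn : ‖EuclideanSpace.single i0 ρ‖ = ‖yz e i0 ρ ζ‖ := by
      rw [yz_norm he h0 hρ (by simpa using (mem_ball_zero_iff.1 hζ).le)]; simp [abs_of_nonneg hρ]
    set T := rfl2 (EuclideanSpace.single i0 ρ - yz e i0 ρ ζ) with hT
    have hT0 : T (EuclideanSpace.single i0 ρ) = yz e i0 ρ ζ := rfl2_maps hn
    have hTt : ∀ z, tVar m (T z) = tVar m z := by
      refine rfl2_tVar fun i him => ?_
      have h1 : i ≠ i0 := by rintro rfl; omega
      have h2 : ∀ j, i ≠ e j := by rintro j rfl; have := hej j; omega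
      simp [yz, h1, h2]
    have mp : MeasurePreserving T volume volume := T.measurePreserving
    have e1 : ∫⁻ y, H y * k ‖yz e i0 ρ ζ - y‖ = ∫⁻ y, H y * k ‖EuclideanSpace.single i0 ρ - y‖ := by
      rw [← mp.lintegral_comp (f := fun y => H y * k ‖yz e i0 ρ ζ - y‖) (by fun_prop)]
      refine lintegral_congr fun y => ?_
      rw [hinv (T y) y (T.norm_map y) (hTt y), ← hT0, ← map_sub, T.norm_map]
    rw [← e1]
    refine lintegral_mono fun y => ?_
    exact mul_le_mul_right (hk (yz_dist he h0 ρ ζ y)) _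
  calc _ = ∫⁻ ζ in Metric.ball (0 : Eu m') ρ, ∫⁻ y, H y * k ‖EuclideanSpace.single i0 ρ - y‖ := by
        rw [setLIntegral_const]
    _ ≤ ∫⁻ ζ in Metric.ball (0 : Eu m') ρ, ∫⁻ y, H y * k ‖ζ - etaP e y‖ :=
        setLIntegral_mono' measurableSet_ball key
    _ ≤ ∫⁻ ζ : Eu m', ∫⁻ y, H y * k ‖ζ - etaP e y‖ := setLIntegral_le_lintegral _ _
    _ = ∫⁻ y, ∫⁻ ζ : Eu m', H y * k ‖ζ - etaP e y‖ := by
        rw [lintegral_lintegral_swap]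
        refine Measurable.aemeasurable ?_
        have : Measurable (fun z : Eu m' × Eu N => ‖z.1 - etaP e z.2‖) := by
          have : Continuous (fun z : Eu m' × Eu N => ‖z.1 - etaP e z.2‖) := by fun_prop
          exact this.measurable
        exact (hH.comp measurable_snd).mul (hkm.comp this)
    _ = ∫⁻ y, H y * ∫⁻ ζ : Eu m', k ‖ζ‖ := by
        refine lintegral_congr fun y => ?_
        rw [lintegral_const_mul _ (by fun_prop),
          lintegral_sub_right_eq_self (fun z : Eu m' => k ‖z‖) (etaP e y)]
    _ = _ := by rw [lintegral_mul_const _ hH, mul_comm]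

noncomputable def k1 (κ t : ℝ) : ℝ≥0∞ := if t ≤ 1 then (ENNReal.ofReal t) ^ (-κ) else 0

theorem k1_anti {κ : ℝ} (h : 0 ≤ κ) : Antitone (k1 κ) := by
  intro s t hst
  unfold k1
  by_cases h1 : t ≤ 1
  · rw [if_pos h1, if_pos (hst.trans h1), ENNReal.rpow_neg, ENNReal.rpow_neg]
    exact ENNReal.inv_le_inv.2 (ENNReal.rpow_le_rpow (ENNReal.ofReal_le_ofReal hst) h)
  · rw [if_neg h1]; exact bot_le

theorem k1_eq {κ : ℝ} {z : Eu N} (hz : z ≠ 0) : k1 κ ‖z‖ = ENNReal.ofReal (dom 1 κ z) := by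
  unfold k1
  have : 0 < ‖z‖ := norm_pos_iff.2 hz
  by_cases h1 : ‖z‖ ≤ 1
  · rw [if_pos h1, dom_of_le h1, ENNReal.ofReal_rpow_of_pos this]
  · rw [if_neg h1, dom_of_gt (by linarith)]; simp

theorem k1_int {κ : ℝ} (hN : 0 < N) (hκ : κ < N) :
    ∫⁻ z : Eu N, k1 κ ‖z‖ = ENNReal.ofReal (∫ z : Eu N, dom 1 κ z) := by
  rw [ofReal_integral_eq_lintegral_ofReal (dom_integrable hN hκ)
    (Eventually.of_forall fun z => dom_nonneg _ _ _)]
  exact lintegral_congr_ae ((ae_ne_zero hN).mono fun z hz => k1_eq hz)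

theorem ae_sub_ne (hN : 0 < N) (x : Eu N) : ∀ᵐ y : Eu N, x - y ≠ 0 := by
  have : Nonempty (Fin N) := ⟨⟨0, hN⟩⟩
  have : Nontrivial (Eu N) := inferInstance
  exact (Measure.ae_ne volume x).mono fun y hy => sub_ne_zero.2 hy.symm

theorem pt_bound (hN : 3 ≤ N) : ∃ C, 0 < C ∧ ∀ (V : Eu N → ℝ) (L : ℝ) (Θ : Measure (Eu N)), KD N V L Θ →
    ∀ f u, Src f → (∀ x, 0 ≤ f x) → IsK V L Θ f u → ∀ x,
      Integrable (fun y => (u y + f y) * dom 1 (N - 2) (x - y)) ∧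
      u x ≤ C * ∫ y, (u y + f y) * dom 1 (N - 2) (x - y) := by
  obtain ⟨C, hC0, hC⟩ := K_bound (N := N) (r := 1) hN one_pos
  refine ⟨C / cN N, div_pos hC0 (cN_pos hN), fun V L Θ h f u hf hf0 hu x => ?_⟩
  have hu0 := hu.nonneg h hf.bc hf.lla hf0
  have bcs := hu.bc.add hf.bc
  have dI : Integrable (fun y : Eu N => dom 1 ((N : ℝ) - 2) (x - y)) :=
    (dom_integrable (N := N) (r := 1) (by omega) (show (N : ℝ) - 2 < N by linarith)).comp_sub_left x
  have I : Integrable (fun y => (u y + f y) * dom 1 (N - 2) (x - y)) := by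
    obtain ⟨M, hM⟩ := bcs.2
    exact dI.bdd_mul (c := M) bcs.1.aestronglyMeasurable (Eventually.of_forall hM)
  refine ⟨I, ?_⟩
  have hw := hu.weak h hf.bc univ
  obtain ⟨M, hM⟩ := hu.bc.bdm
  have bch : BC (fun x => f x - (1 + V x) * u x) := hf.bc.sub (((BC.const 1).add h.bcV).mul hu.bc)
  obtain ⟨M', hM'⟩ := bch.bdm
  have rep := representation hN one_pos hM hM' hw (hu.bc.1.continuousAt (x := x)) (subset_univ _)
  unfold cv at rep
  have i1 := cv_integrable hM (K_limO hN one_pos).2.1 x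
  have i2 := cv_integrable hM' (K_lim0 hN one_pos).2.1 x
  rw [← integral_add i1 i2] at rep
  rw [div_mul_eq_mul_div, le_div_iff₀ (cN_pos hN), mul_comm, rep, ← integral_const_mul]
  refine integral_mono_ae (i1.add i2) (I.const_mul C) ?_
  have hae : ∀ᵐ y : Eu N, x - y ≠ 0 :=
    ae_sub_ne (by omega) x
  filter_upwards [hae] with y hy
  obtain ⟨b0, -, -, bO⟩ := hC 0 le_rfl (x - y) hy
  have k0 : 0 ≤ K0 N 1 0 (x - y) := mul_nonneg (chi_nonneg _ _) (Real.rpow_nonneg (by positivity) _)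
  have b0' := (le_abs_self _).trans b0
  have bO' := (le_abs_self _).trans bO
  have v0 := h.nn y
  have := hu0 y
  have := hf0 y
  simp only [smul_eq_mul]
  have e1 : u y * Om N 1 0 (x - y) ≤ u y * (C * dom 1 (N - 2) (x - y)) := by gcongr
  have e2 : (f y - (1 + V y) * u y) * K0 N 1 0 (x - y) ≤ f y * (C * dom 1 (N - 2) (x - y)) :=
    calc _ ≤ f y * K0 N 1 0 (x - y) := by
          gcongr; nlinarith [mul_nonneg v0 (hu0 y)]
      _ ≤ _ := by gcongr
  linarith

theorem decay {n : ℕ} (hm : 2 ≤ m) (hn : 2 ≤ n) (hN : N = m + n) {β : ℝ} (hβ : 1 < β)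
    (hβn : (n : ℝ) + 1 < 2 * β) :
    ∃ C, 0 < C ∧ ∀ (V : Eu N → ℝ) (L : ℝ) (Θ : Measure (Eu N)), KD N V L Θ →
    ∀ f u, Src f → (∀ x, 0 ≤ f x) → Cone m f → IsK V L Θ f u → ∀ x, x ≠ 0 →
      u x ≤ C * (‖x‖ ^ (m - 1) : ℝ)⁻¹ ^ (1 / β) * (∫ y, f y ^ β) ^ (1 / β) := by
  obtain ⟨C0, hC0, hC⟩ := pt_bound (N := N) (by omega)
  obtain ⟨δ, hδ0, hδ1, hδ⟩ : ∃ δ : ℝ, 0 < δ ∧ δ < 1 ∧ n + 1 + δ < 2 * β := by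
    obtain ⟨δ, h1, h2⟩ := exists_between (lt_min one_pos (sub_pos.2 hβn))
    exact ⟨δ, h1, h2.trans_le (min_le_left _ _), by linarith [h2.trans_le (min_le_right _ _)]⟩
  set m' := m - 1 with hm'
  have hmm : (m : ℝ) = m' + 1 := by rw [hm']; push_cast [Nat.cast_sub (show 1 ≤ m by omega)]; ring
  have hm1 : (1 : ℝ) ≤ m' := by exact_mod_cast (show 1 ≤ m' by omega)
  have hNr : (N : ℝ) = m' + 1 + n := by rw [hN]; push_cast; rw [hmm]
  set κ : ℝ := m' - δ with hκ
  have hβ0 : 0 < β := by linarith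
  set β' := β / (β - 1) with hβ'
  have hconj : β.HolderConjugate β' := Real.HolderConjugate.conjExponent hβ
  have hβ'0 : 0 < β' := hconj.symm.pos
  set ex : ℝ := (N - 2) - κ / β with hex
  have hexN : ex * β' < N := by
    rw [hβ', hex, mul_div_assoc', div_lt_iff₀ (by linarith)]
    have : ((N : ℝ) - 2 - κ / β) * β = (N - 2) * β - κ := by field_simp
    rw [this]; rw [hκ]; linarith
  set I1 := ∫ z : Eu m', dom 1 κ z with hI1
  have hI1' : 0 ≤ I1 := integral_nonneg fun z => dom_nonneg _ _ _
  set I2 := ∫ z : Eu N, dom 1 (ex * β') z with hI2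
  have hI2' : 0 ≤ I2 := integral_nonneg fun z => dom_nonneg _ _ _
  set c := (volume (Metric.ball (0 : Eu m') 1)).toReal with hc
  have hcv : volume (Metric.ball (0 : Eu m') 1) = ENNReal.ofReal c :=
    (ENNReal.ofReal_toReal measure_ball_lt_top.ne).symm
  have hc0 : 0 < c := ENNReal.toReal_pos (Metric.measure_ball_pos _ _ one_pos).ne' measure_ball_lt_top.ne
  set Q : ℝ := I1 / c * (2 ^ (β - 1) * 2) with hQ
  have hQ0 : 0 ≤ Q := by positivity
  refine ⟨C0 * (Q ^ (1 / β) * I2 ^ (1 / β')) + 1, by positivity, fun V L Θ h f u hf hf0 hcf hu x hx => ?_⟩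
  have hu0 := hu.nonneg h hf.bc hf.lla hf0
  have hl : N - 1 < N := by omega
  have : Nonempty (Fin m') := ⟨⟨0, by omega⟩⟩
  have : Nontrivial (Eu m') := inferInstance
  let i0 : Fin N := ⟨0, by omega⟩
  let i1 : Fin N := ⟨N - 1, by omega⟩
  let e : Fin m' → Fin N := fun j => ⟨j + 1, by have := j.2; omega⟩
  have he : Function.Injective e := by
    intro i j hij; have := congrArg Fin.val hij; simp only [e] at this; exact Fin.ext (by omega)
  have hei : ∀ j, e j ≠ i0 := by
    intro j hij; have := congrArg Fin.val hij; simp only [e, i0] at this; omega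
  have hem : ∀ j, (e j : ℕ) < m := by intro j; have := j.2; simp only [e]; omega
  have h0m : (i0 : ℕ) < m := by simp only [i0]; omega
  have h1m : m ≤ (i1 : ℕ) := by simp only [i1]; omega
  have hcu := hu.cone h h0m h1m hf hcf
  set ρ := ‖x‖ with hρ
  have hρ0 : 0 < ρ := norm_pos_iff.2 hx
  set y0 : Eu N := EuclideanSpace.single i0 ρ with hy0
  have hxy : u x ≤ u y0 := by
    refine hcu x y0 (by simp [y0, abs_of_nonneg hρ0.le, hρ]) ?_
    have : tVar m y0 = 0 := by
      have := tVar_pl h0m h1m ρ le_rfl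
      have e0 : pl i0 i1 ρ 0 = y0 := by ext i; simp [pl, y0]
      rwa [e0] at this
    rw [this]; exact tVar_nonneg x
  obtain ⟨I, hI⟩ := hC V L Θ h f u hf hf0 hu y0
  set S := ∫ y, f y ^ β with hS
  have hS0 : 0 ≤ S := integral_nonneg fun y => Real.rpow_nonneg (hf0 y) _
  set F : Eu N → ℝ≥0∞ := fun y => ENNReal.ofReal (u y + f y) with hF
  have hFm : Measurable F := ENNReal.measurable_ofReal.comp (hu.bc.1.add hf.cont).measurable
  have hFinv : ∀ x y, ‖x‖ = ‖y‖ → tVar m x = tVar m y → F x ^ β = F y ^ β := by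
    intro x y h1 h2
    simp only [hF]
    rw [hcu.eq h1 h2, hcf.eq h1 h2]
  have hkm := (k1_anti (κ := κ) (by linarith)).measurable
  -- total power integral
  have hFtot : ∫⁻ y, F y ^ β ≤ ENNReal.ofReal (2 ^ (β - 1) * 2 * S) := by
    have iu := int_rpow hu.bc hu0 (hu.integrable h hf hf0) hβ.le
    have if' := int_rpow hf.bc hf0 hf.int hβ.le
    have e1 : ∀ y, F y ^ β ≤ ENNReal.ofReal (2 ^ (β - 1) * (u y ^ β + f y ^ β)) := by
      intro y
      simp only [hF]
      have := ENNReal.rpow_add_le_mul_rpow_add_rpow (ENNReal.ofReal (u y)) (ENNReal.ofReal (f y)) hβ.le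
      rw [ENNReal.ofReal_add (hu0 y) (hf0 y)]
      refine this.trans_eq ?_
      rw [ENNReal.ofReal_mul (by positivity), ENNReal.ofReal_add (Real.rpow_nonneg (hu0 y) _) (Real.rpow_nonneg (hf0 y) _),
        ENNReal.ofReal_rpow_of_nonneg (hu0 y) hβ0.le, ENNReal.ofReal_rpow_of_nonneg (hf0 y) hβ0.le,
        ← ENNReal.ofReal_rpow_of_pos two_pos, ENNReal.ofReal_ofNat]
    refine (lintegral_mono e1).trans ?_
    have iuf : Integrable (fun y => 2 ^ (β - 1) * (u y ^ β + f y ^ β)) := (iu.add if').const_mul _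
    rw [← ofReal_integral_eq_lintegral_ofReal iuf
      (Eventually.of_forall fun y => mul_nonneg (by positivity)
        (add_nonneg (Real.rpow_nonneg (hu0 y) _) (Real.rpow_nonneg (hf0 y) _)))]
    refine ENNReal.ofReal_le_ofReal ?_
    rw [integral_const_mul, mul_assoc]
    have e2 := hu.integral_rpow_le h hf hf0 hβ.le
    have e3 : ∫ y, (u y ^ β + f y ^ β) ≤ 2 * S := by
      rw [integral_add iu if']; linarith
    gcongr
  have hA := avg he hei h0m hem (H := fun y => F y ^ β) (hFm.pow_const β) hFinv
    (k1_anti (κ := κ) (by linarith)) hρ0.le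
  rw [k1_int (by omega) (by linarith), Measure.addHaar_ball _ _ hρ0.le, finrank_euclideanSpace_fin, hcv,
    ← ENNReal.ofReal_mul (by positivity)] at hA
  have hA2 : ∫⁻ y, F y ^ β * k1 κ ‖y0 - y‖ ≤ ENNReal.ofReal (Q * (ρ ^ m')⁻¹ * S) := by
    have : 0 < ρ ^ m' * c := by positivity
    rw [← ENNReal.le_div_iff_mul_le (Or.inl (by simpa using this)) (Or.inl ENNReal.ofReal_ne_top)] at hA
    refine hA.trans ?_
    rw [ENNReal.div_le_iff (by simpa using this) ENNReal.ofReal_ne_top, ← ENNReal.ofReal_mul (by positivity)]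
    refine (mul_le_mul_right hFtot _).trans_eq ?_
    rw [← ENNReal.ofReal_mul (by positivity)]
    congr 1
    rw [hQ, ← hI1]; field_simp
  -- Hoelder
  have hH := ENNReal.lintegral_mul_le_Lp_mul_Lq volume hconj
    (f := fun y => F y * (k1 κ ‖y0 - y‖) ^ (1 / β))
    (g := fun y => ENNReal.ofReal (dom 1 ex (y0 - y)))
    (by fun_prop) (ENNReal.measurable_ofReal.comp_aemeasurable (by
      have : Measurable (dom (N := N) 1 ex) := by
        unfold dom
        exact Measurable.indicator (by fun_prop) (measurableSet_le (by fun_prop) (by fun_prop))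
      exact (this.comp (by fun_prop)).aemeasurable))
  have hae : ∀ᵐ y : Eu N, y0 - y ≠ 0 :=
    ae_sub_ne (by omega) y0
  have l1 : ∫⁻ y, ENNReal.ofReal ((u y + f y) * dom 1 (N - 2) (y0 - y)) ≤
      ∫⁻ y, ((fun y : Eu N => F y * (k1 κ ‖y0 - y‖) ^ (1 / β)) * (fun y : Eu N => ENNReal.ofReal (dom 1 ex (y0 - y))) : Eu N → ℝ≥0∞) y := by
    refine lintegral_mono_ae ?_
    filter_upwards [hae] with y hy
    have hy' : 0 < ‖y0 - y‖ := norm_pos_iff.2 hy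
    simp only [Pi.mul_apply]
    rw [ENNReal.ofReal_mul (add_nonneg (hu0 y) (hf0 y)), mul_assoc, k1_eq hy]
    refine mul_le_mul_right (le_of_eq ?_) _
    rw [ENNReal.ofReal_rpow_of_nonneg (dom_nonneg _ _ _) (by positivity), ← ENNReal.ofReal_mul
      (Real.rpow_nonneg (dom_nonneg _ _ _) _)]
    congr 1
    rcases le_or_gt ‖y0 - y‖ 1 with h1 | h1
    · rw [dom_of_le h1, dom_of_le h1, dom_of_le h1, ← Real.rpow_mul hy'.le, ← Real.rpow_add hy']
      congr 1; rw [hex]; ring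
    · rw [dom_of_gt h1, dom_of_gt h1, dom_of_gt h1, mul_zero]
  have l2 : ∫⁻ y, (F y * (k1 κ ‖y0 - y‖) ^ (1 / β)) ^ β = ∫⁻ y, F y ^ β * k1 κ ‖y0 - y‖ := by
    refine lintegral_congr fun y => ?_
    rw [ENNReal.mul_rpow_of_nonneg _ _ hβ0.le, ← ENNReal.rpow_mul, one_div_mul_cancel hβ0.ne', ENNReal.rpow_one]
  have l3 : ∫⁻ y, ENNReal.ofReal (dom 1 ex (y0 - y)) ^ β' = ENNReal.ofReal I2 := by
    rw [hI2, ofReal_integral_eq_lintegral_ofReal (dom_integrable (by omega) hexN)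
      (Eventually.of_forall fun z => dom_nonneg _ _ _),
      ← lintegral_sub_left_eq_self (fun z => ENNReal.ofReal (dom 1 (ex * β') z)) y0]
    refine lintegral_congr_ae ?_
    filter_upwards [hae] with y hy
    have hy' : 0 < ‖y0 - y‖ := norm_pos_iff.2 hy
    rw [ENNReal.ofReal_rpow_of_nonneg (dom_nonneg _ _ _) hβ'0.le]
    congr 1
    rcases le_or_gt ‖y0 - y‖ 1 with h1 | h1
    · rw [dom_of_le h1, dom_of_le h1, ← Real.rpow_mul hy'.le]; congr 1; ring
    · rw [dom_of_gt h1, dom_of_gt h1, Real.zero_rpow hβ'0.ne']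
  have hfin : ∫ y, (u y + f y) * dom 1 (N - 2) (y0 - y) ≤
      (Q * (ρ ^ m')⁻¹ * S) ^ (1 / β) * I2 ^ (1 / β') := by
    rw [← ENNReal.ofReal_le_ofReal_iff (by positivity), ofReal_integral_eq_lintegral_ofReal I
      (Eventually.of_forall fun y => mul_nonneg (add_nonneg (hu0 y) (hf0 y)) (dom_nonneg _ _ _))]
    refine (l1.trans hH).trans ?_
    rw [l2, l3, ENNReal.ofReal_mul (by positivity), ← ENNReal.ofReal_rpow_of_nonneg (by positivity) (by positivity),
      ← ENNReal.ofReal_rpow_of_nonneg (by positivity) (by positivity)]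
    gcongr
  have hp : (Q * (ρ ^ m')⁻¹ * S) ^ (1 / β) = Q ^ (1 / β) * (ρ ^ m')⁻¹ ^ (1 / β) * S ^ (1 / β) := by
    rw [Real.mul_rpow (by positivity) hS0, Real.mul_rpow hQ0 (by positivity)]
  have hpos : 0 ≤ (ρ ^ m')⁻¹ ^ (1 / β) * S ^ (1 / β) := by positivity
  calc u x ≤ C0 * ((Q * (ρ ^ m')⁻¹ * S) ^ (1 / β) * I2 ^ (1 / β')) :=
        hxy.trans (hI.trans (by gcongr))
    _ = C0 * (Q ^ (1 / β) * I2 ^ (1 / β')) * ((ρ ^ m')⁻¹ ^ (1 / β) * S ^ (1 / β)) := by rw [hp]; ring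
    _ ≤ _ := by rw [mul_assoc (_ + _)]; gcongr; linarith
end B6


open Set Filter Topology MeasureTheory
open scoped NNReal ContDiff ENNReal

/-- Young defect -/
noncomputable def yd (q a b : ℝ) : ℝ := a ^ q / q + b ^ q / (q / (q - 1)) - a * b ^ (q - 1)

theorem conj_rpow {q b : ℝ} (hq : 2 < q) (hb : 0 ≤ b) : (b ^ (q - 1)) ^ (q / (q - 1)) = b ^ q := by
  have h1 : q - 1 ≠ 0 := by linarith
  rw [← Real.rpow_mul hb]; congr 1; field_simp

theorem yd_nonneg {q a b : ℝ} (hq : 2 < q) (ha : 0 ≤ a) (hb : 0 ≤ b) : 0 ≤ yd q a b := by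
  have h := Real.young_inequality_of_nonneg ha (Real.rpow_nonneg hb (q - 1))
    (Real.HolderConjugate.conjExponent (show 1 < q by linarith))
  rw [Real.conjExponent, conj_rpow hq hb] at h
  unfold yd; linarith

theorem yd_zero {q a b : ℝ} (hq : 2 < q) (ha : 0 ≤ a) (hb : 0 ≤ b) (h0 : yd q a b ≤ 0) : a = b := by
  have h := Real.young_inequality_eq_iff_of_nonneg ha (Real.rpow_nonneg hb (q - 1))
    (Real.HolderConjugate.conjExponent (show 1 < q by linarith))
  rw [Real.conjExponent, conj_rpow hq hb] at h
  have h1 := yd_nonneg hq ha hb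
  unfold yd at h0 h1
  have h2 := h.1 (by linarith)
  exact (Real.rpow_left_inj ha hb (by linarith)).1 h2

section B7
variable {N : ℕ} {Θ : Measure (Eu N)} {V : Eu N → ℝ} {L : ℝ} {m : ℕ} {R C0 : ℝ}

structure Adm (m : ℕ) (u : Eu N → ℝ) : Prop where
  lla : ∀ x, LLA u x
  bc : BC u
  nn : ∀ x, 0 ≤ u x
  cone : Cone m u

structure Wgt (m : ℕ) (R C0 : ℝ) (γ : Eu N → ℝ) : Prop where
  src : Src γ
  nn : ∀ x, 0 ≤ γ x
  le : ∀ x, γ x ≤ C0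
  cone : Cone m γ
  zero : ∀ x, ‖x‖ ≤ R → γ x = 0

noncomputable def nm (γ : Eu N → ℝ) (q : ℝ) (u : Eu N → ℝ) : ℝ := (∫ x, γ x * u x ^ q) ^ (1 / q)

noncomputable def sg (γ : Eu N → ℝ) (q : ℝ) (u : Eu N → ℝ) (x : Eu N) : ℝ :=
  γ x * (u x / nm γ q u) ^ (q - 1)

noncomputable def Tk (V : Eu N → ℝ) (L : ℝ) (Θ : Measure (Eu N)) (γ : Eu N → ℝ) (q : ℝ) (u : Eu N → ℝ) :
    Eu N → ℝ := KK V L Θ (sg γ q u)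

theorem Wgt.C0_nonneg {γ : Eu N → ℝ} (hγ : Wgt m R C0 γ) : 0 ≤ C0 := (hγ.nn 0).trans (hγ.le 0)

theorem Cone.mul {f g : Eu N → ℝ} (hf : Cone m f) (hg : Cone m g) (hf0 : ∀ x, 0 ≤ f x)
    (hg0 : ∀ x, 0 ≤ g x) : Cone m (fun x => f x * g x) := fun x y h t =>
  mul_le_mul (hf x y h t) (hg x y h t) (hg0 x) (hf0 y)

theorem nm_nonneg {γ u : Eu N → ℝ} (hγ : Wgt m R C0 γ) (hu : Adm m u) (q : ℝ) : 0 ≤ nm γ q u :=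
  Real.rpow_nonneg (integral_nonneg fun x => mul_nonneg (hγ.nn x) (Real.rpow_nonneg (hu.nn x) _)) _

theorem wI {γ u : Eu N → ℝ} (hγ : Wgt m R C0 γ) (hu : Adm m u) {q : ℝ} (hq : 1 ≤ q) :
    Integrable (fun x => γ x * u x ^ q) :=
  (hγ.src.mul_left fun x => (hu.lla x).rpow hq).int

theorem nm_pow {γ u : Eu N → ℝ} (hγ : Wgt m R C0 γ) (hu : Adm m u) {q : ℝ} (hq : 2 < q) :
    nm γ q u ^ q = ∫ x, γ x * u x ^ q := by
  unfold nm
  rw [← Real.rpow_mul (integral_nonneg fun x => mul_nonneg (hγ.nn x) (Real.rpow_nonneg (hu.nn x) _)),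
    one_div_mul_cancel (by linarith), Real.rpow_one]

theorem sg_src {γ u : Eu N → ℝ} (hγ : Wgt m R C0 γ) (hu : Adm m u) {q : ℝ} (hq : 2 < q) :
    Src (sg γ q u) :=
  hγ.src.mul_left fun x => LLA.rpow (by
    have := (hu.lla x).mul (LLA.const (nm γ q u)⁻¹ x)
    simpa only [← div_eq_mul_inv] using this) (by linarith)

theorem sg_nn {γ u : Eu N → ℝ} (hγ : Wgt m R C0 γ) (hu : Adm m u) (q : ℝ) (x : Eu N) :
    0 ≤ sg γ q u x :=
  mul_nonneg (hγ.nn x) (Real.rpow_nonneg (div_nonneg (hu.nn x) (nm_nonneg hγ hu q)) _)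

theorem sg_cone {γ u : Eu N → ℝ} (hγ : Wgt m R C0 γ) (hu : Adm m u) {q : ℝ} (hq : 2 < q) :
    Cone m (sg γ q u) := by
  refine hγ.cone.mul (fun x y h t => ?_) hγ.nn
    (fun x => Real.rpow_nonneg (div_nonneg (hu.nn x) (nm_nonneg hγ hu q)) _)
  exact Real.rpow_le_rpow (div_nonneg (hu.nn x) (nm_nonneg hγ hu q))
    (div_le_div_of_nonneg_right (hu.cone x y h t) (nm_nonneg hγ hu q)) (by linarith)

theorem Tk_spec (h : KD N V L Θ) {γ u : Eu N → ℝ} (hγ : Wgt m R C0 γ) (hu : Adm m u) {q : ℝ} (hq : 2 < q) :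
    IsK V L Θ (sg γ q u) (Tk V L Θ γ q u) := KK_spec h (sg_src hγ hu hq).bc

theorem Tk_adm (hm : 1 ≤ m) (hmN : m < N) (h : KD N V L Θ) {γ u : Eu N → ℝ} (hγ : Wgt m R C0 γ)
    (hu : Adm m u) {q : ℝ} (hq : 2 < q) : Adm m (Tk V L Θ γ q u) := by
  have hs := Tk_spec h hγ hu hq
  have hsrc := sg_src hγ hu hq
  exact ⟨hs.lla h hsrc.bc, hs.bc, hs.nonneg h hsrc.bc hsrc.lla (sg_nn hγ hu q),
    hs.cone h (i0 := ⟨0, by omega⟩) (i1 := ⟨N - 1, by omega⟩) (show 0 < m by omega)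
      (show m ≤ N - 1 by omega) hsrc (sg_cone hγ hu hq)⟩

theorem sg_int {γ u : Eu N → ℝ} (hγ : Wgt m R C0 γ) (hu : Adm m u) {q : ℝ} (hq : 2 < q)
    (hpos : 0 < nm γ q u) : ∫ x, sg γ q u x ^ (q / (q - 1)) ≤ C0 ^ (q / (q - 1) - 1) := by
  have hq1 : 0 < q - 1 := by linarith
  have hq' : 1 ≤ q / (q - 1) := by rw [le_div_iff₀ hq1]; linarith
  have hp := nm_pow hγ hu hq
  have e : ∫ x, C0 ^ (q / (q - 1) - 1) * (nm γ q u ^ q)⁻¹ * (γ x * u x ^ q) = C0 ^ (q / (q - 1) - 1) := by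
    rw [integral_const_mul, ← hp, mul_assoc, inv_mul_cancel₀ (Real.rpow_pos_of_pos hpos _).ne', mul_one]
  rw [← e]
  refine integral_mono (int_rpow (sg_src hγ hu hq).bc (sg_nn hγ hu q) (sg_src hγ hu hq).int hq')
    ((wI hγ hu (by linarith)).const_mul _) fun x => ?_
  have hx := hu.nn x
  have hd : 0 ≤ u x / nm γ q u := div_nonneg hx hpos.le
  simp only [sg]
  rw [Real.mul_rpow (hγ.nn x) (Real.rpow_nonneg hd _), conj_rpow hq hd, Real.div_rpow hx hpos.le]
  have e1 : γ x ^ (q / (q - 1)) ≤ C0 ^ (q / (q - 1) - 1) * γ x := by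
    rcases (hγ.nn x).eq_or_lt with h0 | h0
    · rw [← h0, Real.zero_rpow (by positivity)]; simp
    · calc γ x ^ (q / (q - 1)) = γ x ^ (q / (q - 1) - 1) * γ x := by
            rw [Real.rpow_sub_one h0.ne']; field_simp
        _ ≤ _ := by
            have := hγ.le x
            gcongr
  calc _ ≤ (C0 ^ (q / (q - 1) - 1) * γ x) * (u x ^ q / nm γ q u ^ q) := by gcongr
    _ = _ := by ring

/-- the key identity -/
theorem id_nu (hm : 1 ≤ m) (hmN : m < N) (h : KD N V L Θ) {α γ u : Eu N → ℝ} (hα : Wgt m R C0 α)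
    (hγ : Wgt m R C0 γ) (hu : Adm m u) {p q : ℝ} (hp : 2 < p) (hq : 2 < q)
    (hν : 0 < nm α p (Tk V L Θ γ q u)) :
    ∫ x, sg γ q u x * Tk V L Θ α p (Tk V L Θ γ q u) x = nm α p (Tk V L Θ γ q u) := by
  set v := Tk V L Θ γ q u with hv
  have hva : Adm m v := Tk_adm hm hmN h hγ hu hq
  rw [← IsK.symm h (sg_src hγ hu hq) (sg_nn hγ hu q) (sg_src hα hva hp) (sg_nn hα hva p)
    (Tk_spec h hγ hu hq) (Tk_spec h hα hva hp)]
  have hp1 := nm_pow hα hva hp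
  have e : ∀ x, v x * sg α p v x = (nm α p v ^ (p - 1))⁻¹ * (α x * v x ^ p) := by
    intro x
    simp only [sg]
    rw [Real.div_rpow (hva.nn x) hν.le]
    have : v x ^ p = v x * v x ^ (p - 1) := by
      rcases (hva.nn x).eq_or_lt with h0 | h0
      · rw [← h0, Real.zero_rpow (by linarith)]; simp
      · rw [Real.rpow_sub_one h0.ne']; field_simp
    rw [this]; ring
  rw [← hv]
  simp_rw [e]
  rw [integral_const_mul, ← hp1, Real.rpow_sub_one hν.ne']
  have := Real.rpow_pos_of_pos hν p
  field_simp

theorem yd_int {γ u w : Eu N → ℝ} (hγ : Wgt m R C0 γ) (hu : Adm m u) (hw : Adm m w)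
    {q : ℝ} (hq : 2 < q) :
    Integrable (fun x => γ x * yd q (w x) (u x)) ∧ ∫ x, γ x * yd q (w x) (u x) =
      nm γ q w ^ q / q + nm γ q u ^ q / (q / (q - 1)) - ∫ x, γ x * (u x) ^ (q - 1) * w x := by
  have i1 := (wI hγ hw (q := q) (by linarith)).div_const q
  have i2 := (wI hγ hu (q := q) (by linarith)).div_const (q / (q - 1))
  have i3 : Integrable (fun x => γ x * (u x) ^ (q - 1) * w x) :=
    ((hγ.src.mul_left fun x => (hu.lla x).rpow (b := q - 1) (by linarith)).mul_left hw.lla).int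
  have e : ∀ x, γ x * yd q (w x) (u x) = γ x * w x ^ q / q + γ x * u x ^ q / (q / (q - 1)) -
      γ x * (u x) ^ (q - 1) * w x := by
    intro x; unfold yd; ring
  have i12 : Integrable (fun x => γ x * w x ^ q / q + γ x * u x ^ q / (q / (q - 1))) := i1.add i2
  simp_rw [e]
  refine ⟨i12.sub i3, ?_⟩
  rw [integral_sub i12 i3, integral_add i1 i2, integral_div, integral_div, nm_pow hγ hw hq, nm_pow hγ hu hq]

theorem sg_mul {γ u w : Eu N → ℝ} (hγ : Wgt m R C0 γ) (hu : Adm m u)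
    {q : ℝ} (hμ : 0 < nm γ q u) :
    ∫ x, γ x * (u x) ^ (q - 1) * w x = nm γ q u ^ (q - 1) * ∫ x, sg γ q u x * w x := by
  rw [← integral_const_mul]
  refine integral_congr_ae (Eventually.of_forall fun x => ?_)
  simp only [sg]
  rw [Real.div_rpow (hu.nn x) hμ.le]
  have := Real.rpow_pos_of_pos hμ (q - 1)
  field_simp

theorem nm_mono (hm : 1 ≤ m) (hmN : m < N) (h : KD N V L Θ) {α γ u : Eu N → ℝ} (hα : Wgt m R C0 α)
    (hγ : Wgt m R C0 γ) (hu : Adm m u) {p q : ℝ} (hp : 2 < p) (hq : 2 < q)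
    (hμ : 0 < nm γ q u) (hν : 0 < nm α p (Tk V L Θ γ q u)) :
    nm α p (Tk V L Θ γ q u) ≤ nm γ q (Tk V L Θ α p (Tk V L Θ γ q u)) := by
  set v := Tk V L Θ γ q u with hv
  set ν := nm α p v with hνd
  have hva : Adm m v := Tk_adm hm hmN h hγ hu hq
  set w := Tk V L Θ α p v with hw
  have hwa : Adm m w := Tk_adm hm hmN h hα hva hp
  have h1 : ∫ x, sg γ q u x * w x = ν := id_nu hm hmN h hα hγ hu hp hq hν
  set μ := nm γ q u with hμd
  have hq0 : 0 < q := by linarith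
  have hq1 : 0 < q - 1 := by linarith
  have i1 := (wI hγ hwa (q := q) (by linarith)).const_mul ((ν ^ q)⁻¹ / q)
  have i2 := (wI hγ hu (q := q) (by linarith)).const_mul ((μ ^ q)⁻¹ / (q / (q - 1)))
  have i3 : Integrable (fun x => sg γ q u x * w x) := ((sg_src hγ hu hq).mul_left hwa.lla).int
  have key : ∫ x, ν⁻¹ * (sg γ q u x * w x) ≤
      ∫ x, ((ν ^ q)⁻¹ / q * (γ x * w x ^ q) + (μ ^ q)⁻¹ / (q / (q - 1)) * (γ x * u x ^ q)) := by
    refine integral_mono (i3.const_mul _) (i1.add i2) fun x => ?_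
    have hy := yd_nonneg hq (div_nonneg (hwa.nn x) hν.le) (div_nonneg (hu.nn x) hμ.le)
    unfold yd at hy
    rw [Real.div_rpow (hwa.nn x) hν.le, Real.div_rpow (hu.nn x) hμ.le q] at hy
    have hz := mul_nonneg (hγ.nn x) hy
    simp only [sg]
    have e : γ x * (w x ^ q / ν ^ q / q + u x ^ q / μ ^ q / (q / (q - 1)) - w x / ν * (u x / μ) ^ (q - 1)) =
      ((ν ^ q)⁻¹ / q * (γ x * w x ^ q) + (μ ^ q)⁻¹ / (q / (q - 1)) * (γ x * u x ^ q)) -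
       ν⁻¹ * (γ x * (u x / μ) ^ (q - 1) * w x) := by ring
    rw [e] at hz
    linarith
  rw [integral_const_mul, h1, integral_add i1 i2, integral_const_mul, integral_const_mul,
    ← nm_pow hγ hwa hq, ← nm_pow hγ hu hq, inv_mul_cancel₀ hν.ne'] at key
  have hμq := Real.rpow_pos_of_pos hμ q
  have hνq := Real.rpow_pos_of_pos hν q
  have e2 : (μ ^ q)⁻¹ / (q / (q - 1)) * nm γ q u ^ q = 1 - 1 / q := by
    rw [← hμd]; field_simp
  rw [e2] at key
  have e3 : 1 ≤ (ν ^ q)⁻¹ * nm γ q w ^ q := by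
    have : (ν ^ q)⁻¹ / q * nm γ q w ^ q = ((ν ^ q)⁻¹ * nm γ q w ^ q) / q := by ring
    rw [this] at key
    have : 1 / q ≤ ((ν ^ q)⁻¹ * nm γ q w ^ q) / q := by linarith
    rwa [div_le_div_iff_of_pos_right hq0] at this
  have e4 : ν ^ q ≤ nm γ q w ^ q := by
    rw [← div_eq_inv_mul, le_div_iff₀ hνq, one_mul] at e3; exact e3
  exact (Real.rpow_le_rpow_iff hν.le (nm_nonneg hγ hwa q) hq0).1 e4

/-- decay weight -/
noncomputable def rh (m : ℕ) (β : ℝ) (x : Eu N) : ℝ := (‖x‖ ^ (m - 1))⁻¹ ^ (1 / β)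

theorem rh_le {β : ℝ} (hR : 0 < R) (hβ : 0 < β) {x : Eu N} (hx : R ≤ ‖x‖) :
    rh m β x ≤ (R ^ (m - 1))⁻¹ ^ (1 / β) := by
  unfold rh
  gcongr

theorem sg_le {γ u : Eu N → ℝ} (hγ : Wgt m R C0 γ) (hu : Adm m u) {q c0 S : ℝ} (hq : 2 < q)
    (hc0 : 0 < c0) (hμ : c0 ≤ nm γ q u) (hS : ∀ x, R < ‖x‖ → u x ≤ S) (hS0 : 0 ≤ S) (x : Eu N) :
    sg γ q u x ≤ C0 * (S / c0) ^ (q - 1) := by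
  have hC0 := hγ.C0_nonneg
  have h1 : 0 ≤ (S / c0) ^ (q - 1) := Real.rpow_nonneg (by positivity) _
  rcases le_or_gt ‖x‖ R with h | h
  · rw [sg, hγ.zero x h, zero_mul]; positivity
  · unfold sg
    have := hγ.le x
    have := hu.nn x
    have := hS x h
    have : 0 < nm γ q u := hc0.trans_le hμ
    gcongr
    linarith

/-- one step of the sup iteration -/
theorem step_bound {n : ℕ} (hm : 2 ≤ m) (hn : 2 ≤ n) (hN : N = m + n) {β : ℝ} (hβ : 1 < β)
    (hβn : (n : ℝ) + 1 < 2 * β) (hR : 0 < R) {c0 : ℝ} (hc0 : 0 < c0) {q : ℝ} (hq : 2 < q)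
    (hβq : q / (q - 1) ≤ β) (hC0 : 0 < C0) :
    ∃ C, 0 < C ∧ ∀ (V : Eu N → ℝ) (L : ℝ) (Θ : Measure (Eu N)), KD N V L Θ →
      ∀ γ u, Wgt m R C0 γ → Adm m u → c0 ≤ nm γ q u → ∀ S, 0 < S → (∀ x, R < ‖x‖ → u x ≤ S) →
        ∀ x, R < ‖x‖ → Tk V L Θ γ q u x ≤ C * S ^ (q * (1 - 1 / β) - 1) * rh m β x := by
  obtain ⟨C, hC, hd⟩ := decay hm hn hN hβ hβn
  have hβ0 : 0 < β := by linarith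
  have hq1 : 0 < q - 1 := by linarith
  set q' := q / (q - 1) with hq'
  set G : ℝ := C0 * (1 / c0) ^ (q - 1) with hG
  have hG0 : 0 < G := by positivity
  refine ⟨C * ((G ^ (β - q') * C0 ^ (q' - 1)) ^ (1 / β)), by positivity,
    fun V L Θ h γ u hγ hu hμ S hS hSu x hx => ?_⟩
  have hx0 : x ≠ 0 := norm_pos_iff.1 (hR.trans hx)
  have hμ0 := hc0.trans_le hμ
  have h1 := hd V L Θ h _ _ (sg_src hγ hu hq) (sg_nn hγ hu q) (sg_cone hγ hu hq) (Tk_spec h hγ hu hq) x hx0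
  have hle : ∀ x, sg γ q u x ≤ G * S ^ (q - 1) := by
    intro x
    refine (sg_le hγ hu hq hc0 hμ hSu hS.le x).trans_eq ?_
    rw [hG, div_eq_mul_one_div, Real.mul_rpow hS.le (by positivity)]; ring
  have hq'1 : 1 ≤ q' := by rw [hq', le_div_iff₀ hq1]; linarith
  have hsI := int_rpow (sg_src hγ hu hq).bc (sg_nn hγ hu q) (sg_src hγ hu hq).int hq'1
  have h2 : ∫ x, sg γ q u x ^ β ≤ (G * S ^ (q - 1)) ^ (β - q') * C0 ^ (q' - 1) := by
    calc _ ≤ ∫ x, (G * S ^ (q - 1)) ^ (β - q') * sg γ q u x ^ q' := by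
          refine integral_mono (int_rpow (sg_src hγ hu hq).bc (sg_nn hγ hu q) (sg_src hγ hu hq).int hβ.le)
            (hsI.const_mul _) fun x => ?_
          have hs := sg_nn hγ hu q x
          dsimp only
          rcases hs.eq_or_lt with h0 | h0
          · rw [← h0, Real.zero_rpow hβ0.ne', Real.zero_rpow (by linarith)]; simp
          · calc sg γ q u x ^ β = sg γ q u x ^ (β - q') * sg γ q u x ^ q' := by
                  rw [← Real.rpow_add h0]; congr 1; ring
              _ ≤ _ := by
                have := hle x
                have : 0 ≤ β - q' := by linarith
                gcongr
      _ = (G * S ^ (q - 1)) ^ (β - q') * ∫ x, sg γ q u x ^ q' := integral_const_mul _ _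
      _ ≤ _ := by
        have := sg_int hγ hu hq hμ0
        gcongr
  have e : ((G * S ^ (q - 1)) ^ (β - q') * C0 ^ (q' - 1)) ^ (1 / β) =
      (G ^ (β - q') * C0 ^ (q' - 1)) ^ (1 / β) * S ^ (q * (1 - 1 / β) - 1) := by
    rw [Real.mul_rpow hG0.le (by positivity), ← Real.rpow_mul hS.le, mul_right_comm,
      Real.mul_rpow (by positivity) (by positivity), ← Real.rpow_mul hS.le]
    congr 2
    rw [hq']; field_simp; ring
  have hi0 : 0 ≤ ∫ x, sg γ q u x ^ β := integral_nonneg fun x => Real.rpow_nonneg (sg_nn hγ hu q x) _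
  calc _ ≤ _ := h1
    _ ≤ C * rh m β x * ((G * S ^ (q - 1)) ^ (β - q') * C0 ^ (q' - 1)) ^ (1 / β) := by
        unfold rh; gcongr
    _ = _ := by rw [e]; ring
end B7


open Set Filter Topology MeasureTheory
open scoped NNReal ContDiff ENNReal

section B8
variable {N : ℕ} {Θ : Measure (Eu N)} {V : Eu N → ℝ} {L : ℝ} {m : ℕ} {R C0 : ℝ}

theorem norm_sq_contDiff : ContDiff ℝ ∞ (fun x : Eu N => ‖x‖ ^ 2) := contDiff_norm_sq ℝ

theorem cs_of_norm {f : Eu N → ℝ} (r : ℝ) (h : ∀ x, r < ‖x‖ → f x = 0) : HasCompactSupport f :=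
  HasCompactSupport.intro (isCompact_closedBall (0 : Eu N) r) fun x hx => h x (by simpa using hx)

theorem bump_exists (hR : 0 < R) (r1 r2 : ℝ) (h1 : 0 < r1) (h2 : r1 < r2) :
    ∃ φ : Eu N → ℝ, ContDiff ℝ ∞ φ ∧ HasCompactSupport φ ∧ (∀ x, 0 ≤ φ x) ∧ (∀ x, φ x ≤ 1) ∧
      (∀ x, |‖x‖ ^ 2 - 10 * R ^ 2| ≤ r1 → φ x = 1) ∧ (∀ x, φ x ≠ 0 → |‖x‖ ^ 2 - 10 * R ^ 2| < r2) ∧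
      (∀ x y, ‖x‖ = ‖y‖ → φ x = φ y) := by
  let B : ContDiffBump (10 * R ^ 2 : ℝ) := ⟨r1, r2, h1, h2⟩
  have hsupp : ∀ x : Eu N, B (‖x‖ ^ 2) ≠ 0 → |‖x‖ ^ 2 - 10 * R ^ 2| < r2 := by
    intro x hx
    by_contra h
    exact hx (B.zero_of_le_dist (by rw [Real.dist_eq]; exact not_lt.1 h))
  refine ⟨fun x => B (‖x‖ ^ 2), B.contDiff.comp norm_sq_contDiff, ?_, fun x => B.nonneg, fun x => B.le_one,
    fun x hx => B.one_of_mem_closedBall (by rw [mem_closedBall_iff_norm]; exact hx), hsupp,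
    fun x y h => by simp only [h]⟩
  refine cs_of_norm (10 * R ^ 2 + r2 + 1) fun x hx => ?_
  by_contra h
  have := (abs_lt.1 (hsupp x h)).2
  nlinarith [sq_nonneg (‖x‖ - 1), sq_nonneg R]

theorem low (hm : 1 ≤ m) (hmN : m < N) (hR : 0 < R) {p q c1 : ℝ} (hp : 2 < p) (hq : 2 < q) (hc1 : 0 < c1)
    (hC0 : 0 < C0) : ∃ u0 : Eu N → ℝ, Adm m u0 ∧ (∀ x, u0 x ≤ 1) ∧ ∃ c0, 0 < c0 ∧
      ∀ (V : Eu N → ℝ) (L : ℝ) (Θ : Measure (Eu N)) (α γ : Eu N → ℝ), KD N V L Θ →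
      Wgt m R C0 α → Wgt m R C0 γ → (∀ x, R < ‖x‖ → V x = 0) →
      (∀ x, 6 * R ^ 2 ≤ ‖x‖ ^ 2 → ‖x‖ ^ 2 ≤ 14 * R ^ 2 → c1 ≤ α x ∧ c1 ≤ γ x) →
      c0 ≤ nm γ q u0 ∧ c0 ≤ nm α p (Tk V L Θ γ q u0) := by
  have hR2 : 0 < R ^ 2 := by positivity
  obtain ⟨u0, us, uc, u0n, u0l, u01, u0s, u0r⟩ := bump_exists (N := N) hR (3 * R ^ 2) (4 * R ^ 2) (by positivity) (by linarith)
  obtain ⟨φ, fs, fc, f0n, f0l, f01, f0s, f0r⟩ := bump_exists (N := N) hR (R ^ 2) (2 * R ^ 2) (by positivity) (by linarith)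
  have hA : Adm m u0 := ⟨fun x => LLA.of_contDiffAt (us.of_le (by simp)).contDiffAt,
    ⟨us.continuous, 1, fun x => by rw [Real.norm_of_nonneg (u0n x)]; exact u0l x⟩, u0n,
    fun x y h _ => (u0r x y h).le⟩
  have hu1 : ∀ x, φ x ≠ 0 → u0 x = 1 := fun x hx => u01 x ((f0s x hx).le.trans (by linarith))
  have hpi : ∀ e : ℝ, 2 < e → 0 < ∫ x, φ x ^ e := by
    intro e he
    refine Continuous.integral_pos_of_hasCompactSupport_nonneg_nonzero
      (fs.continuous.rpow_const fun x => Or.inr (by linarith)) ?_ (fun x => Real.rpow_nonneg (f0n x) _)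
      (x := EuclideanSpace.single ⟨0, by omega⟩ (Real.sqrt (10 * R ^ 2))) ?_
    · exact fc.comp_left (g := fun t : ℝ => t ^ e) (Real.zero_rpow (by linarith))
    · rw [f01 _ (by rw [EuclideanSpace.norm_single, Real.norm_eq_abs, sq_abs, Real.sq_sqrt (by positivity), sub_self, abs_zero]; positivity)]; simp
  have hfi : ∀ e : ℝ, 2 < e → Integrable (fun x => φ x ^ e) := fun e he =>
    cd_integrable (fc.comp_left (g := fun t : ℝ => t ^ e) (Real.zero_rpow (by linarith)))
      (fs.continuous.rpow_const fun x => Or.inr (by linarith))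
  have hui : Integrable (fun x => u0 x ^ q) :=
    cd_integrable (uc.comp_left (g := fun t : ℝ => t ^ q) (Real.zero_rpow (by linarith)))
      (us.continuous.rpow_const fun x => Or.inr (by linarith))
  set U := C0 * ∫ x, u0 x ^ q with hU
  have hU0 : 0 < U := by
    refine mul_pos hC0 (lt_of_lt_of_le (hpi q hq) (integral_mono (hfi q hq) hui fun x => ?_))
    by_cases h : φ x = 0
    · simp only [h]; rw [Real.zero_rpow (by linarith)]; exact Real.rpow_nonneg (u0n x) _
    · simp only [hu1 x h]; rw [Real.one_rpow]; exact Real.rpow_le_one (f0n x) (f0l x) (by linarith)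
  obtain ⟨B, hB0, hB⟩ := cs_bound (f := fun x => φ x - lap φ x) (fc.sub (lap_compactSupport fc))
    (fs.continuous.sub (lap_contDiff fs).continuous)
  set c2 : ℝ := c1 * (1 / U ^ (1 / q)) ^ (q - 1) with hc2
  have hc2' : 0 < c2 := by positivity
  set c := c2 / (B + 1) with hc
  have hc' : 0 < c := by positivity
  have hP := hpi p hp
  have hQ := hpi q hq
  refine ⟨u0, hA, u0l, min ((c1 * ∫ x, φ x ^ q) ^ (1 / q)) ((c1 * c ^ p * ∫ x, φ x ^ p) ^ (1 / p)), by positivity, ?_⟩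
  intro V L Θ α γ h hα hγ hV hlow
  have hlo : ∀ x, φ x ≠ 0 → c1 ≤ α x ∧ c1 ≤ γ x ∧ R < ‖x‖ := by
    intro x hx
    obtain ⟨h1, h2⟩ := abs_lt.1 (f0s x hx)
    obtain ⟨h3, h4⟩ := hlow x (by linarith) (by linarith)
    exact ⟨h3, h4, by nlinarith [norm_nonneg x]⟩
  have e1 : (c1 * ∫ x, φ x ^ q) ^ (1 / q) ≤ nm γ q u0 := by
    unfold nm
    refine Real.rpow_le_rpow (by positivity) ?_ (by positivity)
    rw [← integral_const_mul]
    refine integral_mono ((hfi q hq).const_mul _) (wI hγ hA (by linarith)) fun x => ?_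
    by_cases h : φ x = 0
    · simp only [h]; rw [Real.zero_rpow (by linarith), mul_zero]; exact mul_nonneg (hγ.nn x) (Real.rpow_nonneg (u0n x) _)
    · simp only [hu1 x h]; rw [Real.one_rpow]
      have := Real.rpow_le_one (f0n x) (f0l x) (show 0 ≤ q by linarith)
      have := (hlo x h).2.1
      have := hγ.nn x
      have := Real.rpow_nonneg (f0n x) q
      nlinarith
  have hμ0 : 0 < nm γ q u0 := lt_of_lt_of_le (by positivity) e1
  have e2 : nm γ q u0 ≤ U ^ (1 / q) := by
    unfold nm
    refine Real.rpow_le_rpow (integral_nonneg fun x => mul_nonneg (hγ.nn x) (Real.rpow_nonneg (u0n x) _)) ?_ (by positivity)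
    rw [hU, ← integral_const_mul]
    refine integral_mono (wI hγ hA (by linarith)) (hui.const_mul _) fun x => ?_
    exact mul_le_mul_of_nonneg_right (hγ.le x) (Real.rpow_nonneg (u0n x) _)
  have hg : ∀ x, φ x ≠ 0 → c2 ≤ sg γ q u0 x := by
    intro x hx
    rw [sg, hu1 x hx, hc2]
    have := (hlo x hx).2.1
    have : 0 ≤ q - 1 := by linarith
    have := hγ.nn x
    gcongr
  set v := Tk V L Θ γ q u0 with hv
  have hva : Adm m v := Tk_adm hm hmN h hγ hA hq
  have hs := Tk_spec h hγ hA hq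
  have hc2v := hs.c2 h (sg_src hγ hA hq).bc (sg_src hγ hA hq).lla
  have hf2 : ∀ x, ContDiffAt ℝ 2 φ x := fun x => (fs.of_le (WithTop.coe_le_coe.2 le_top)).contDiffAt
  have cmp : ∀ x, 0 ≤ v x - c * φ x := by
    intro x
    refine max_principle (C := univ) (w := fun x => v x - c * φ x) (B := -c) isClosed_univ
      (hva.bc.1.sub (continuous_const.mul fs.continuous)).continuousOn (fun z _ => ?_) (fun z _ hz => ?_) x (mem_univ x)
    · have := hva.nn z
      nlinarith [f0l z]
    · have hcφ : ContDiffAt ℝ 2 (fun x => c * φ x) z := contDiffAt_const.mul (hf2 z)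
      refine ⟨univ_mem, (hc2v z).1.sub hcφ, ?_⟩
      rw [lap_sub (hc2v z).1 hcφ, lap_const_mul c (hf2 z), (hc2v z).2]
      have hz0 : φ z ≠ 0 := by
        intro h0; rw [h0] at hz; have := hva.nn z; simp at hz; linarith
      rw [hV z (hlo z hz0).2.2]
      have h3 := (abs_le.1 (hB z)).2
      have h4 := hg z hz0
      have h5 : c * (φ z - lap φ z) ≤ c2 := by
        calc _ ≤ c * (B + 1) := by gcongr; linarith
          _ = c2 := by rw [hc]; field_simp
      linarith
  refine ⟨(min_le_left _ _).trans e1, (min_le_right _ _).trans ?_⟩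
  unfold nm
  refine Real.rpow_le_rpow (by positivity) ?_ (by positivity)
  rw [← integral_const_mul]
  refine integral_mono ((hfi p hp).const_mul _) (wI hα hva (by linarith)) fun x => ?_
  dsimp only
  by_cases h : φ x = 0
  · rw [h, Real.zero_rpow (by linarith), mul_zero]; exact mul_nonneg (hα.nn x) (Real.rpow_nonneg (hva.nn x) _)
  · have h1 := (hlo x h).1
    rw [mul_assoc, ← Real.mul_rpow hc'.le (f0n x)]
    have h2 : 0 ≤ c * φ x := mul_nonneg hc'.le (f0n x)
    have h3 : c * φ x ≤ v x := by linarith [cmp x]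
    have h4 := hα.nn x
    gcongr
end B8


open Set Filter Topology MeasureTheory
open scoped NNReal ContDiff ENNReal

section B9
variable {N : ℕ} {Θ : Measure (Eu N)} {V : Eu N → ℝ} {L : ℝ} {m : ℕ} {R C0 : ℝ}

structure StageOut (m : ℕ) (R β p q c0 F ε : ℝ) (V : Eu N → ℝ) (L : ℝ) (Θ : Measure (Eu N))
    (α γ u v w : Eu N → ℝ) : Prop where
  hu : Adm m u
  hv : Adm m v
  hw : Adm m w
  mu0 : c0 ≤ nm γ q u
  mu1 : nm γ q u ≤ F
  nu0 : c0 ≤ nm α p v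
  nu1 : nm α p v ≤ F
  kv : IsK V L Θ (sg γ q u) v
  kw : IsK V L Θ (sg α p v) w
  ku : ∃ f, Src f ∧ (∀ x, 0 ≤ f x) ∧ (∀ x, f x ≤ F) ∧ (∀ x, ‖x‖ ≤ R → f x = 0) ∧ IsK V L Θ f u
  sq : ∀ x, sg γ q u x ≤ F
  sp : ∀ x, sg α p v x ≤ F
  du : ∀ x, R < ‖x‖ → u x ≤ F * rh m β x
  dv : ∀ x, R < ‖x‖ → v x ≤ F * rh m β x
  dw : ∀ x, R < ‖x‖ → w x ≤ F * rh m β x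
  iu : ∫ x, u x ^ (p / (p - 1)) ≤ F
  jd : ∫ x, γ x * yd q (w x) (u x) ≤ ε

theorem nm_upper (h : KD N V L Θ) {γ f u : Eu N → ℝ} {p q T : ℝ} (hp : 2 < p) (hpq : p ≤ q)
    (hγ : Wgt m R C0 γ) (hu : Adm m u) (hk : IsK V L Θ f u) (hf : Src f) (hf0 : ∀ x, 0 ≤ f x)
    (hT : 0 < T) (huT : ∀ x, R < ‖x‖ → u x ≤ T) {D : ℝ} (hD : ∫ x, f x ^ (p / (p - 1)) ≤ D) :
    (∫ x, u x ^ (p / (p - 1)) ≤ D) ∧ nm γ q u ≤ (C0 * T ^ (q - p / (p - 1)) * D) ^ (1 / q) := by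
  have hp1 : 0 < p - 1 := by linarith
  have hp'1 : 1 ≤ p / (p - 1) := by rw [le_div_iff₀ hp1]; linarith
  have hp'2 : p / (p - 1) < 2 := by rw [div_lt_iff₀ hp1]; linarith
  have e1 : ∫ x, u x ^ (p / (p - 1)) ≤ D := (hk.integral_rpow_le h hf hf0 hp'1).trans hD
  refine ⟨e1, ?_⟩
  unfold nm
  have h0 := hγ.C0_nonneg
  refine Real.rpow_le_rpow (integral_nonneg fun x => mul_nonneg (hγ.nn x) (Real.rpow_nonneg (hu.nn x) _)) ?_ (one_div_nonneg.2 (by linarith))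
  have hui := int_rpow hu.bc hu.nn (hk.integrable h hf hf0) hp'1
  calc _ ≤ ∫ x, C0 * T ^ (q - p / (p - 1)) * u x ^ (p / (p - 1)) := by
        refine integral_mono (wI hγ hu (by linarith)) (hui.const_mul _) fun x => ?_
        have hx := hu.nn x
        dsimp only
        rcases le_or_gt ‖x‖ R with h1 | h1
        · rw [hγ.zero x h1, zero_mul]; positivity
        · rcases hx.eq_or_lt with h2 | h2
          · rw [← h2, Real.zero_rpow (by linarith), mul_zero]; positivity
          · rw [mul_assoc]
            have : u x ^ q = u x ^ (q - p / (p - 1)) * u x ^ (p / (p - 1)) := by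
              rw [← Real.rpow_add h2]; congr 1; ring
            rw [this]
            have := hγ.le x
            have := huT x h1
            have : 0 ≤ q - p / (p - 1) := by linarith
            gcongr
    _ = C0 * T ^ (q - p / (p - 1)) * ∫ x, u x ^ (p / (p - 1)) := integral_const_mul _ _
    _ ≤ _ := by gcongr

theorem exists_small_step (s : ℕ → ℝ) (hs : ∀ i, s i ≤ s (i + 1)) (K : ℝ) (hK : ∀ i, s i ≤ K) {ε : ℝ} (hε : 0 < ε) :
    ∃ i, s (i + 1) - s i ≤ ε := by
  have hm : Monotone s := monotone_nat_of_le_succ hs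
  have ht := tendsto_atTop_ciSup hm ⟨K, by rintro _ ⟨i, rfl⟩; exact hK i⟩
  have h2 := (ht.comp (tendsto_add_atTop_nat 1)).sub ht
  rw [sub_self] at h2
  obtain ⟨i, hi⟩ := (h2.eventually (eventually_le_nhds hε)).exists
  exact ⟨i, hi⟩

theorem stage {n : ℕ} (hm : 2 ≤ m) (hn : 2 ≤ n) (hN : N = m + n) {β : ℝ} (hβ : 1 < β)
    (hβn : (n : ℝ) + 1 < 2 * β) (hR : 0 < R) {p q c1 : ℝ} (hp : 2 < p) (hpq : p ≤ q) (hc1 : 0 < c1)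
    (hβp : p / (p - 1) ≤ β) (hθ : (p * (1 - 1 / β) - 1) * (q * (1 - 1 / β) - 1) < 1) (hC0 : 0 < C0) :
    ∃ c0 F : ℝ, 0 < c0 ∧ 0 < F ∧ ∀ (V : Eu N → ℝ) (L : ℝ) (Θ : Measure (Eu N)) (α γ : Eu N → ℝ), KD N V L Θ →
      Wgt m R C0 α → Wgt m R C0 γ → (∀ x, R < ‖x‖ → V x = 0) →
      (∀ x, 6 * R ^ 2 ≤ ‖x‖ ^ 2 → ‖x‖ ^ 2 ≤ 14 * R ^ 2 → c1 ≤ α x ∧ c1 ≤ γ x) →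
      ∀ ε, 0 < ε → ∃ u v w, StageOut m R β p q c0 F ε V L Θ α γ u v w := by
  have hq : 2 < q := hp.trans_le hpq
  have hp1 : 0 < p - 1 := by linarith
  have hq1 : 0 < q - 1 := by linarith
  have hm1 : 1 ≤ m := by omega
  have hmN : m < N := by omega
  have hβq : q / (q - 1) ≤ β := by
    refine le_trans ?_ hβp
    rw [div_le_div_iff₀ hq1 hp1]; nlinarith
  obtain ⟨u0, hA0, hu01, c0, hc0, hlow⟩ := low (C0 := C0) hm1 hmN hR hp hq hc1 hC0
  obtain ⟨Cq, hCq, sq⟩ := step_bound hm hn hN hβ hβn hR hc0 hq hβq hC0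
  obtain ⟨Cp, hCp, sp⟩ := step_bound hm hn hN hβ hβn hR hc0 hp hβp hC0
  set θp := p * (1 - 1 / β) - 1 with hθp
  set θq := q * (1 - 1 / β) - 1 with hθq
  set ρ : ℝ := (R ^ (m - 1))⁻¹ ^ (1 / β) with hρ
  have hρ0 : 0 < ρ := by positivity
  set K : ℝ := Cp * (Cq * ρ) ^ θp * ρ with hK
  have hK0 : 0 < K := by positivity
  set T : ℝ := max 1 (K ^ (1 / (1 - θp * θq))) with hT
  have hT1 : 1 ≤ T := le_max_left _ _
  have hT0 : 0 < T := by linarith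
  set Mo : ℝ := Cq * T ^ θq * ρ with hMo
  have hMo0 : 0 < Mo := by positivity
  have hTT : Cp * Mo ^ θp * ρ ≤ T := by
    have e1 : Cp * Mo ^ θp * ρ = K * T ^ (θp * θq) := by
      rw [hMo, show Cq * T ^ θq * ρ = Cq * ρ * T ^ θq by ring, Real.mul_rpow (by positivity) (by positivity), ← Real.rpow_mul hT0.le, hK, mul_comm θq θp]; ring
    have hk : 0 < 1 - θp * θq := by linarith
    have e2 : K ≤ T ^ (1 - θp * θq) := by
      calc K = (K ^ (1 / (1 - θp * θq))) ^ (1 - θp * θq) := by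
            rw [← Real.rpow_mul hK0.le, one_div_mul_cancel hk.ne', Real.rpow_one]
        _ ≤ _ := by
            have := le_max_right 1 (K ^ (1 / (1 - θp * θq)))
            gcongr
    rw [e1]
    calc _ ≤ T ^ (1 - θp * θq) * T ^ (θp * θq) := by gcongr
      _ = T := by rw [← Real.rpow_add hT0]; simp
  set D : ℝ := C0 ^ (p / (p - 1) - 1) with hD
  set Kq : ℝ := (C0 * T ^ (q - p / (p - 1)) * D) ^ (1 / q) with hKq
  have hKq0 : 0 < Kq := by positivity
  have hD0 : 0 < D := by positivity
  set F1 : ℝ := C0 * (T / c0) ^ (q - 1) with hF1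
  set F2 : ℝ := C0 * (Mo / c0) ^ (p - 1) with hF2
  have hF10 : 0 < F1 := by positivity
  have hF20 : 0 < F2 := by positivity
  have hM1 : 0 < Cq * T ^ θq := by positivity
  have hM2 : 0 < Cp * Mo ^ θp := by positivity
  refine ⟨c0, F1 + F2 + Cq * T ^ θq + Cp * Mo ^ θp + Kq + D, hc0, by positivity, ?_⟩
  intro V L Θ α γ h hα hγ hV hcc ε hε
  set F := F1 + F2 + Cq * T ^ θq + Cp * Mo ^ θp + Kq + D with hF
  obtain ⟨l1, l2⟩ := hlow V L Θ α γ h hα hγ hV hcc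
  let S := fun u => Tk V L Θ γ q u
  let P := fun v => Tk V L Θ α p v
  let Inv : (Eu N → ℝ) → Prop := fun u => Adm m u ∧ c0 ≤ nm γ q u ∧ c0 ≤ nm α p (S u) ∧ ∀ x, R < ‖x‖ → u x ≤ T
  have bS : ∀ u, Inv u → Adm m (S u) ∧ (∀ x, R < ‖x‖ → S u x ≤ Cq * T ^ θq * rh m β x) ∧ (∀ x, R < ‖x‖ → S u x ≤ Mo) := by
    rintro u ⟨h1, h2, h3, h4⟩
    have h5 := sq V L Θ h γ u hγ h1 h2 T hT0 h4
    refine ⟨Tk_adm hm1 hmN h hγ h1 hq, h5, fun x hx => (h5 x hx).trans ?_⟩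
    exact mul_le_mul_of_nonneg_left (rh_le hR (by linarith) hx.le) hM1.le
  have bP : ∀ u, Inv u → Adm m (P (S u)) ∧ (∀ x, R < ‖x‖ → P (S u) x ≤ Cp * Mo ^ θp * rh m β x) ∧ (∀ x, R < ‖x‖ → P (S u) x ≤ T) := by
    intro u hu
    obtain ⟨h1, h2, h3⟩ := bS u hu
    have h5 := sp V L Θ h α (S u) hα h1 hu.2.2.1 Mo hMo0 h3
    refine ⟨Tk_adm hm1 hmN h hα h1 hp, h5, fun x hx => (h5 x hx).trans (le_trans ?_ hTT)⟩
    exact mul_le_mul_of_nonneg_left (rh_le hR (by linarith) hx.le) hM2.le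
  have n1 : ∀ u, Inv u → nm α p (S u) ≤ nm γ q (P (S u)) := fun u hu =>
    nm_mono hm1 hmN h hα hγ hu.1 hp hq (hc0.trans_le hu.2.1) (hc0.trans_le hu.2.2.1)
  have n2 : ∀ u, Inv u → nm γ q (P (S u)) ≤ nm α p (S (P (S u))) := fun u hu =>
    nm_mono hm1 hmN h hγ hα (bS u hu).1 hq hp (hc0.trans_le hu.2.2.1) (hc0.trans_le (hu.2.2.1.trans (n1 u hu)))
  have step : ∀ u, Inv u → Inv (P (S u)) := fun u hu =>
    ⟨(bP u hu).1, hu.2.2.1.trans (n1 u hu), (hu.2.2.1.trans (n1 u hu)).trans (n2 u hu), (bP u hu).2.2⟩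
  let X : ℕ → Eu N → ℝ := fun i => Nat.rec u0 (fun _ u => P (S u)) i
  have hX : ∀ i, Inv (X i) := by
    intro i
    induction i with
    | zero => exact ⟨hA0, l1, l2, fun x _ => (hu01 x).trans hT1⟩
    | succ i ih => exact step _ ih
  have up : ∀ u, Inv u → (∫ x, P (S u) x ^ (p / (p - 1)) ≤ D) ∧ nm γ q (P (S u)) ≤ Kq := fun u hu =>
    nm_upper h hp hpq hγ (bP u hu).1 (Tk_spec h hα (bS u hu).1 hp) (sg_src hα (bS u hu).1 hp)
      (sg_nn hα (bS u hu).1 p) hT0 (bP u hu).2.2 (sg_int hα (bS u hu).1 hp (hc0.trans_le hu.2.2.1))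
  have mono1 : ∀ i, nm γ q (X (i + 1)) ≤ nm γ q (X (i + 1 + 1)) := fun i =>
    (n2 _ (hX i)).trans (n1 _ (hX (i + 1)))
  have hq0 : 0 < q := by linarith
  obtain ⟨i, hi⟩ := exists_small_step (fun i => nm γ q (X (i + 1)) ^ q)
    (fun i => Real.rpow_le_rpow (nm_nonneg hγ (hX (i + 1)).1 q) (mono1 i) hq0.le) (Kq ^ q)
    (fun i => Real.rpow_le_rpow (nm_nonneg hγ (hX (i + 1)).1 q) (up _ (hX i)).2 hq0.le) (mul_pos hq0 hε)
  have hI := hX (i + 1)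
  obtain ⟨v1, v2, v3⟩ := bS _ (hX i)
  obtain ⟨b1, b2, b3⟩ := bP _ (hX i)
  obtain ⟨a1, a2, a3⟩ := bS _ hI
  obtain ⟨w1, w2, w3⟩ := bP _ hI
  have hnu := hI.2.2.1
  have hrh : ∀ x : Eu N, 0 ≤ rh m β x := fun x => by unfold rh; positivity
  refine ⟨X (i + 1), S (X (i + 1)), P (S (X (i + 1))), hI.1, a1, w1, hI.2.1, ?_, hnu, ?_, Tk_spec h hγ hI.1 hq,
    Tk_spec h hα a1 hp, ⟨sg α p (S (X i)), sg_src hα v1 hp, sg_nn hα v1 p, ?_, ?_, Tk_spec h hα v1 hp⟩, ?_, ?_, ?_, ?_, ?_, ?_, ?_⟩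
  · have := (up _ (hX i)).2
    refine le_trans this ?_
    linarith
  · have := (n1 _ hI).trans (up _ hI).2
    linarith
  · intro x
    have := sg_le hα v1 hp hc0 (hX i).2.2.1 v3 hMo0.le x
    linarith
  · intro x hx
    rw [sg, hα.zero x hx, zero_mul]
  · intro x
    have := sg_le hγ hI.1 hq hc0 hI.2.1 hI.2.2.2 hT0.le x
    linarith
  · intro x
    have := sg_le hα a1 hp hc0 hnu a3 hMo0.le x
    linarith
  · intro x hx
    exact (b2 x hx).trans (mul_le_mul_of_nonneg_right (by linarith) (hrh x))
  · intro x hx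
    exact (a2 x hx).trans (mul_le_mul_of_nonneg_right (by linarith) (hrh x))
  · intro x hx
    exact (w2 x hx).trans (mul_le_mul_of_nonneg_right (by linarith) (hrh x))
  · refine (up _ (hX i)).1.trans ?_
    linarith
  · have hμ0 := hc0.trans_le hI.2.1
    rw [(yd_int hγ hI.1 w1 hq).2, sg_mul hγ hI.1 hμ0, id_nu hm1 hmN h hα hγ hI.1 hp hq (hc0.trans_le hnu)]
    have hn := n2 _ (hX i)
    change nm γ q (X (i + 1)) ≤ nm α p (S (X (i + 1))) at hn
    have e1 : nm γ q (X (i + 1)) ^ q = nm γ q (X (i + 1)) ^ (q - 1) * nm γ q (X (i + 1)) := by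
      rw [Real.rpow_sub_one hμ0.ne']; field_simp
    have e2 : nm γ q (X (i + 1)) ^ q ≤ nm γ q (X (i + 1)) ^ (q - 1) * nm α p (S (X (i + 1))) := by
      rw [e1]; gcongr
    change nm γ q (X (i + 1 + 1)) ^ q / q + _ - nm γ q (X (i + 1)) ^ (q - 1) * nm α p (S (X (i + 1))) ≤ ε
    have e3 : nm γ q (X (i + 1)) ^ q / (q / (q - 1)) = nm γ q (X (i + 1)) ^ q - nm γ q (X (i + 1)) ^ q / q := by
      field_simp
    have e4 : (nm γ q (X (i + 1 + 1)) ^ q - nm γ q (X (i + 1)) ^ q) / q ≤ ε := by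
      rw [div_le_iff₀ hq0]; linarith
    rw [sub_div] at e4
    linarith
end B9


open Set Filter Topology MeasureTheory
open scoped NNReal ContDiff ENNReal

section C1
variable {N : ℕ} {Θ : Measure (Eu N)} {V : Eu N → ℝ} {L : ℝ} {m : ℕ} {R C0 : ℝ}

structure Coef (m : ℕ) (R c1 C0 : ℝ) (a : Eu N → ℝ) : Prop where
  lla : ∀ x, R < ‖x‖ → LLA a x
  lo : ∀ x, R < ‖x‖ → c1 ≤ a x
  le : ∀ x, R < ‖x‖ → a x ≤ C0
  cone : ∀ x y, R < ‖x‖ → ‖x‖ = ‖y‖ → tVar m y ≤ tVar m x → a x ≤ a y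

noncomputable def ct (k R : ℝ) (x : Eu N) : ℝ :=
  Real.smoothTransition (k * (‖x‖ ^ 2 - R ^ 2) - 1) * Real.smoothTransition (k + 1 - ‖x‖ ^ 2)

noncomputable def pen (k R : ℝ) (x : Eu N) : ℝ := k ^ 4 * Real.smoothTransition (k * (R ^ 2 - ‖x‖ ^ 2))

theorem ct_smooth (k R : ℝ) : ContDiff ℝ ∞ (ct k R : Eu N → ℝ) := by
  have h := norm_sq_contDiff (N := N)
  have hs : ContDiff ℝ ∞ Real.smoothTransition := Real.smoothTransition.contDiff
  exact (hs.comp (((contDiff_const.mul (h.sub contDiff_const))).sub contDiff_const)).mul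
    (hs.comp (contDiff_const.sub h))

theorem ct_nonneg (k R : ℝ) (x : Eu N) : 0 ≤ ct k R x :=
  mul_nonneg (Real.smoothTransition.nonneg _) (Real.smoothTransition.nonneg _)

theorem ct_le (k R : ℝ) (x : Eu N) : ct k R x ≤ 1 :=
  mul_le_one₀ (Real.smoothTransition.le_one _) (Real.smoothTransition.nonneg _) (Real.smoothTransition.le_one _)

theorem ct_one {k : ℝ} (hk : 0 < k) {x : Eu N} (h1 : R ^ 2 + 2 / k ≤ ‖x‖ ^ 2) (h2 : ‖x‖ ^ 2 ≤ k) : ct k R x = 1 := by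
  unfold ct
  rw [Real.smoothTransition.one_of_one_le, Real.smoothTransition.one_of_one_le, one_mul]
  · linarith
  · have : k * (2 / k) = 2 := by field_simp
    nlinarith

theorem ct_zero {k : ℝ} (hk : 0 < k) {x : Eu N} (h1 : ‖x‖ ^ 2 ≤ R ^ 2 + 1 / k) : ct k R x = 0 := by
  unfold ct
  rw [Real.smoothTransition.zero_of_nonpos, zero_mul]
  have : k * (1 / k) = 1 := by field_simp
  nlinarith

theorem ct_cs {k : ℝ} (hk : 0 < k) : HasCompactSupport (ct k R : Eu N → ℝ) := by
  refine cs_of_norm (k + 1) fun x hx => ?_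
  unfold ct
  rw [Real.smoothTransition.zero_of_nonpos (x := k + 1 - ‖x‖ ^ 2), mul_zero]
  nlinarith

theorem Coef.wgt {c1 : ℝ} {a : Eu N → ℝ} (ha : Coef m R c1 C0 a) (hR : 0 < R) (hc1 : 0 < c1) (hC0 : 0 < C0) {k : ℝ} (hk : 0 < k) :
    Wgt m R C0 (fun x => ct k R x * a x) := by
  have hz : ∀ x : Eu N, ‖x‖ ≤ R → ct k R x = 0 := fun x hx => ct_zero hk (by
    have : 0 < 1 / k := by positivity
    have := norm_nonneg x
    nlinarith)
  refine ⟨⟨fun x => ?_, (ct_cs hk).mul_right⟩, fun x => ?_, fun x => ?_, fun x y hxy ht => ?_, fun x hx => ?_⟩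
  · rcases le_or_gt ‖x‖ R with h | h
    · refine (LLA.const 0 x).congr ?_
      have h1 : ‖x‖ ^ 2 < R ^ 2 + 1 / k := by
        have : 0 < 1 / k := by positivity
        have := norm_nonneg x
        nlinarith
      have h2 : ∀ᶠ y in 𝓝 x, ‖y‖ ^ 2 < R ^ 2 + 1 / k :=
        (norm_sq_contDiff (N := N)).continuous.continuousAt.eventually_lt continuousAt_const h1
      filter_upwards [h2] with y hy
      rw [ct_zero hk hy.le, zero_mul]
    · exact (LLA.of_contDiffAt ((ct_smooth k R).of_le (by simp)).contDiffAt).mul (ha.lla x h)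
  · rcases le_or_gt ‖x‖ R with h | h
    · rw [hz x h, zero_mul]
    · exact mul_nonneg (ct_nonneg k R x) (hc1.le.trans (ha.lo x h))
  · rcases le_or_gt ‖x‖ R with h | h
    · rw [hz x h, zero_mul]; exact hC0.le
    · have h1 := ct_nonneg k R x
      have h2 := ct_le k R x
      have h3 := ha.le x h
      have h4 := hc1.le.trans (ha.lo x h)
      nlinarith
  · have e : ct k R x = ct k R y := by unfold ct; rw [hxy]
    rcases le_or_gt ‖x‖ R with h | h
    · simp only [hz x h, hz y (hxy ▸ h), zero_mul, le_refl]
    · simp only [e]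
      exact mul_le_mul_of_nonneg_left (ha.cone x y h hxy ht) (ct_nonneg k R y)
  · simp only [hz x hx, zero_mul]

theorem pen_KD (hN : 3 ≤ N) {k : ℝ} : ∃ Θ, KD N (pen k R) (k ^ 4) Θ := by
  have hk4 : 0 ≤ k ^ 4 := by positivity
  obtain ⟨Θ, hΘ⟩ := resM_exists (N := N) (lam := 1 + k ^ 4) (by positivity)
  refine ⟨Θ, hN, hk4, hΘ, fun x => ?_, fun x => mul_nonneg hk4 (Real.smoothTransition.nonneg _),
    fun x => mul_le_of_le_one_right hk4 (Real.smoothTransition.le_one _), fun x y h => by unfold pen; rw [h]⟩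
  refine LLA.of_contDiffAt (ContDiff.contDiffAt ?_)
  have h := (norm_sq_contDiff (N := N)).of_le (m := 1) (by simp)
  have hs : ContDiff ℝ 1 Real.smoothTransition := Real.smoothTransition.contDiff (n := 1)
  exact contDiff_const.mul (hs.comp (contDiff_const.mul (contDiff_const.sub h)))

theorem pen_zero {k : ℝ} (hR : 0 < R) (hk : 0 < k) {x : Eu N} (h : R ≤ ‖x‖) : pen k R x = 0 := by
  unfold pen
  rw [Real.smoothTransition.zero_of_nonpos, mul_zero]
  have : R ^ 2 ≤ ‖x‖ ^ 2 := by gcongr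
  nlinarith

theorem pen_full {k : ℝ} (hk : 0 < k) {x : Eu N} (h : ‖x‖ ^ 2 ≤ R ^ 2 - 1 / k) : pen k R x = k ^ 4 := by
  unfold pen
  rw [Real.smoothTransition.one_of_one_le, mul_one]
  have : k * (1 / k) = 1 := by field_simp
  nlinarith

/-- the sequence of approximate problems -/
structure StageSeq (m : ℕ) (R β p q c0 F : ℝ) (a b : Eu N → ℝ) (k : ℝ) (Θ : Measure (Eu N))
    (u v w : Eu N → ℝ) : Prop where
  kd : KD N (pen k R) (k ^ 4) Θ
  so : StageOut m R β p q c0 F (1 / k) (pen k R) (k ^ 4) Θ (fun x => ct k R x * a x) (fun x => ct k R x * b x) u v w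

theorem stage_seq {n : ℕ} (hm : 2 ≤ m) (hn : 2 ≤ n) (hN : N = m + n) {β : ℝ} (hβ : 1 < β)
    (hβn : (n : ℝ) + 1 < 2 * β) (hR : 0 < R) {p q c1 : ℝ} (hp : 2 < p) (hpq : p ≤ q) (hc1 : 0 < c1)
    (hβp : p / (p - 1) ≤ β) (hθ : (p * (1 - 1 / β) - 1) * (q * (1 - 1 / β) - 1) < 1) (hC0 : 0 < C0)
    {a b : Eu N → ℝ} (ha : Coef m R c1 C0 a) (hb : Coef m R c1 C0 b) :
    ∃ c0 F : ℝ, 0 < c0 ∧ 0 < F ∧ ∀ k : ℝ, 0 < k → 2 / k ≤ 5 * R ^ 2 → 14 * R ^ 2 ≤ k → ∃ Θ u v w,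
      StageSeq m R β p q c0 F a b k Θ u v w := by
  obtain ⟨c0, F, hc0, hF, hs⟩ := stage (C0 := C0) hm hn hN hβ hβn hR hp hpq hc1 hβp hθ hC0
  refine ⟨c0, F, hc0, hF, fun k hk h1 h2 => ?_⟩
  obtain ⟨Θ, hΘ⟩ := pen_KD (N := N) (R := R) (k := k) (by omega)
  obtain ⟨u, v, w, h⟩ := hs _ _ _ _ _ hΘ (ha.wgt hR hc1 hC0 hk) (hb.wgt hR hc1 hC0 hk)
    (fun x hx => pen_zero hR hk hx.le) (fun x h3 h4 => by
      have hx : R < ‖x‖ := by nlinarith [norm_nonneg x]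
      rw [ct_one hk (by linarith) (by linarith), one_mul, one_mul]
      exact ⟨ha.lo x hx, hb.lo x hx⟩) (1 / k) (by positivity)
  exact ⟨Θ, u, v, w, hΘ, h⟩
end C1


open Set Filter Topology MeasureTheory
open scoped NNReal ContDiff ENNReal

section C2
variable {N : ℕ} {Θ : Measure (Eu N)} {V : Eu N → ℝ} {L : ℝ} {m : ℕ} {R C0 : ℝ}

theorem barrier1 (hR : 0 < R) {F k : ℝ} (hF : 0 < F) (hk : 1 ≤ k) (h : KD N (pen k R) (k ^ 4) Θ)
    {f u : Eu N → ℝ} (hf : Src f) (hf0 : ∀ x, 0 ≤ f x) (hfF : ∀ x, f x ≤ F) (hfz : ∀ x, ‖x‖ ≤ R → f x = 0)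
    (hu : IsK (pen k R) (k ^ 4) Θ f u) {x0 : Eu N} (hx0 : ‖x0‖ ^ 2 ≤ R ^ 2 - 2 / k) :
    u x0 ≤ 2 * N * F * (2 * R + 1) ^ 2 / k ^ 2 := by
  have hk0 : 0 < k := by linarith
  have un := hu.nonneg h hf.bc hf.lla hf0
  have uF := hu.le_const h hf.bc hf.lla hF.le hfF
  have uc := hu.c2 h hf.bc hf.lla
  set ρ : ℝ := 1 / (k * (2 * R + 1)) with hρ
  have hρ0 : 0 < ρ := by positivity
  set g : ℝ := 2 * N * F * (2 * R + 1) ^ 2 / k ^ 2 with hg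
  have hg0 : 0 ≤ g := by positivity
  have hgk : k ^ 4 * g = 2 * N * (F / ρ ^ 2) := by rw [hg, hρ]; field_simp
  have hx0R : ‖x0‖ ≤ R := by
    have : 0 < 2 / k := by positivity
    nlinarith [norm_nonneg x0]
  have hball : ∀ x, ‖x - x0‖ ≤ ρ → ‖x‖ ^ 2 ≤ R ^ 2 - 1 / k := by
    intro x hx
    have h1 : ‖x‖ ≤ ‖x0‖ + ρ := by
      have := norm_add_le x0 (x - x0)
      rw [add_sub_cancel] at this; linarith
    have h2 : ρ ≤ 1 := by
      rw [hρ, div_le_one (by positivity)]; nlinarith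
    have h3 : (2 * R + 1) * ρ = 1 / k := by rw [hρ]; field_simp
    have h4 : 2 / k = 1 / k + 1 / k := by ring
    have h5 : ‖x‖ ^ 2 ≤ (‖x0‖ + ρ) ^ 2 := by gcongr
    nlinarith
  have hG : ∀ z : Eu N, ContDiffAt ℝ 2 (fun x => g + F / ρ ^ 2 * ‖x - x0‖ ^ 2) z := fun z =>
    contDiffAt_const.add (contDiffAt_const.mul (contDiff_normsq x0).contDiffAt)
  have key := max_principle (C := Metric.closedBall x0 ρ) (w := fun x => (g + F / ρ ^ 2 * ‖x - x0‖ ^ 2) - u x) (B := -F)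
    Metric.isClosed_closedBall (fun z _ => ((hG z).sub (uc z).1).continuousAt.continuousWithinAt) (fun z _ => by
      have := uF z
      have : 0 ≤ F / ρ ^ 2 * ‖z - x0‖ ^ 2 := by positivity
      linarith) (fun z hz hw => by
      rw [mem_closedBall_iff_norm] at hz
      have hlt : ‖z - x0‖ < ρ := by
        by_contra hc
        have e : ‖z - x0‖ = ρ := le_antisymm hz (not_lt.1 hc)
        rw [e, div_mul_cancel₀ _ (by positivity)] at hw
        linarith [uF z]
      refine ⟨Metric.closedBall_mem_nhds_of_mem (by rwa [mem_ball_iff_norm]), (hG z).sub (uc z).1, ?_⟩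
      rw [lap_sub (hG z) (uc z).1, (uc z).2, lap_add contDiffAt_const (contDiffAt_const.mul (contDiff_normsq x0).contDiffAt),
        lap_const_mul _ (contDiff_normsq x0).contDiffAt, lap_const, lap_normsq, pen_full hk0 (hball z hz),
        hfz z (by
          have := hball z hz
          have : 0 < 1 / k := by positivity
          nlinarith [norm_nonneg z])]
      have h1 : 0 ≤ F / ρ ^ 2 * ‖z - x0‖ ^ 2 := by positivity
      have h2 : k ^ 4 * g ≤ k ^ 4 * u z := by gcongr; linarith
      linarith) x0 (Metric.mem_closedBall_self hρ0.le)
  simp at key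
  exact key

theorem barrier2 (hR : 0 < R) {F k : ℝ} (hF : 0 < F) (hk : 1 ≤ k) (hk2 : 2 / k ≤ R ^ 2 / (4 * N)) (h : KD N (pen k R) (k ^ 4) Θ)
    {f u : Eu N → ℝ} (hf : Src f) (hf0 : ∀ x, 0 ≤ f x) (hfF : ∀ x, f x ≤ F) (hfz : ∀ x, ‖x‖ ≤ R → f x = 0)
    (hu : IsK (pen k R) (k ^ 4) Θ f u) {x0 : Eu N} (hx0 : R < ‖x0‖) (hx1 : ‖x0‖ ^ 2 ≤ R ^ 2 + R ^ 2 / (4 * N)) :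
    u x0 ≤ 2 * N * F * (2 * R + 1) ^ 2 / k ^ 2 + (4 * N / R ^ 2 * F + F) * (‖x0‖ ^ 2 - R ^ 2 + 2 / k) := by
  have hk0 : 0 < k := by linarith
  have un := hu.nonneg h hf.bc hf.lla hf0
  have uF := hu.le_const h hf.bc hf.lla hF.le hfF
  have uc := hu.c2 h hf.bc hf.lla
  have u1 := fun x => barrier1 hR hF hk h hf hf0 hfF hfz hu (x0 := x)
  have hN : (3 : ℝ) ≤ N := by exact_mod_cast h.hN
  have hN0 : (0 : ℝ) < N := by linarith
  set g : ℝ := 2 * N * F * (2 * R + 1) ^ 2 / k ^ 2 with hg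
  have hg0 : 0 ≤ g := by positivity
  set Bq : ℝ := N / R ^ 2 with hB
  have hB0 : 0 < Bq := by positivity
  set Λ : ℝ := 4 * N / R ^ 2 * F + F with hΛ
  have hΛ1 : F ≤ Λ := by rw [hΛ]; have : 0 ≤ 4 * N / R ^ 2 * F := by positivity
                         linarith
  have hΛ2 : Λ * (1 / (4 * Bq)) ≥ F := by
    have : 4 * Bq * F ≤ Λ := by rw [hΛ, hB]; have : 4 * (N / R ^ 2) * F = 4 * N / R ^ 2 * F := by ring
                                linarith
    calc F = 4 * Bq * F * (1 / (4 * Bq)) := by field_simp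
      _ ≤ _ := by gcongr
  have hBR : R ^ 2 / (4 * N) = 1 / (4 * Bq) := by rw [hB]; field_simp
  rw [hBR] at hk2 hx1
  have hB2 : 1 / (2 * Bq) = 1 / (4 * Bq) + 1 / (4 * Bq) := by field_simp; norm_num
  set r0 : ℝ := R ^ 2 - 2 / k with hr0
  have hr0R : R ^ 2 / 2 ≤ r0 := by
    have : 1 / (4 * Bq) ≤ R ^ 2 / 2 := by
      rw [← hBR]; gcongr; linarith
    linarith
  let G0 : ℝ → ℝ := fun t => (t - r0) - Bq * (t - r0) ^ 2
  have hGc : ContDiff ℝ 2 (fun x : Eu N => G0 (‖x - 0‖ ^ 2)) := by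
    have := contDiff_normsq (0 : Eu N) (n := 2)
    show ContDiff ℝ 2 (fun x : Eu N => (‖x - 0‖ ^ 2 - r0) - Bq * (‖x - 0‖ ^ 2 - r0) ^ 2)
    fun_prop
  have hd1 : ∀ t : ℝ, HasDerivAt G0 (1 - Bq * (2 * (t - r0))) t := by
    intro t
    have h1 : HasDerivAt (fun t : ℝ => t - r0) 1 t := (hasDerivAt_id t).sub_const r0
    exact (h1.fun_sub ((h1.fun_pow 2).const_mul Bq)).congr_deriv (by simp)
  have hd2 : ∀ t : ℝ, HasDerivAt (fun t => 1 - Bq * (2 * (t - r0))) (-(2 * Bq)) t := by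
    intro t
    have h1 : HasDerivAt (fun t : ℝ => t - r0) 1 t := (hasDerivAt_id t).sub_const r0
    exact (((h1.const_mul 2).const_mul Bq).const_sub 1).congr_deriv (by ring)
  have hlapG : ∀ x : Eu N, lap (fun x : Eu N => G0 (‖x - 0‖ ^ 2)) x = 4 * ‖x - 0‖ ^ 2 * (-(2 * Bq)) + 2 * N * (1 - Bq * (2 * (‖x - 0‖ ^ 2 - r0))) :=
    fun x => lap_radial (F1 := fun t => 1 - Bq * (2 * (t - r0))) 0 x (Eventually.of_forall fun t => hd1 t) (hd2 _)
  have hG : ∀ z : Eu N, ContDiffAt ℝ 2 (fun x => g + Λ * G0 (‖x - 0‖ ^ 2)) z := fun z =>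
    contDiffAt_const.add (contDiffAt_const.mul hGc.contDiffAt)
  have hcn : Continuous fun x : Eu N => ‖x‖ ^ 2 := (norm_sq_contDiff (N := N)).continuous
  have hG0n : ∀ t, r0 ≤ t → t ≤ r0 + 1 / (2 * Bq) → 0 ≤ G0 t := by
    intro t h1 h2
    have : Bq * (t - r0) ≤ 1 := by
      calc Bq * (t - r0) ≤ Bq * (1 / (2 * Bq)) := by gcongr; linarith
        _ = 1 / 2 := by field_simp
        _ ≤ 1 := by norm_num
    have : G0 t = (t - r0) * (1 - Bq * (t - r0)) := by simp only [G0]; ring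
    rw [this]
    exact mul_nonneg (by linarith) (by linarith)
  have key := max_principle (C := {x : Eu N | r0 ≤ ‖x‖ ^ 2 ∧ ‖x‖ ^ 2 ≤ r0 + 1 / (2 * Bq)}) (w := fun x => (g + Λ * G0 (‖x - 0‖ ^ 2)) - u x) (B := -F)
    ((isClosed_le continuous_const hcn).inter (isClosed_le hcn continuous_const))
    (fun z _ => ((hG z).sub (uc z).1).continuousAt.continuousWithinAt) (fun z hz => by
      have := uF z
      have : 0 ≤ Λ * G0 (‖z - 0‖ ^ 2) := mul_nonneg (by linarith) (hG0n _ (by rw [sub_zero]; exact hz.1) (by rw [sub_zero]; exact hz.2))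
      linarith) (fun z hz hw => by
      have hGn := mul_nonneg (hF.le.trans hΛ1) (hG0n (‖z - 0‖ ^ 2) (by rw [sub_zero]; exact hz.1) (by rw [sub_zero]; exact hz.2))
      have l1 : r0 < ‖z‖ ^ 2 := by
        rcases hz.1.lt_or_eq with h1 | h1
        · exact h1
        · have := u1 z h1.symm.le
          linarith
      have l2 : ‖z‖ ^ 2 < r0 + 1 / (2 * Bq) := by
        rcases hz.2.lt_or_eq with h1 | h1
        · exact h1
        · have h3 : G0 (‖z - 0‖ ^ 2) = 1 / (4 * Bq) := by
            simp only [G0, sub_zero]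
            rw [h1]; field_simp; norm_num
          rw [h3] at hw
          linarith [uF z]
      have hnb : {x : Eu N | r0 ≤ ‖x‖ ^ 2 ∧ ‖x‖ ^ 2 ≤ r0 + 1 / (2 * Bq)} ∈ 𝓝 z := by
        filter_upwards [continuousAt_const.eventually_lt hcn.continuousAt l1,
          hcn.continuousAt.eventually_lt continuousAt_const l2] with y h1 h2
        exact ⟨h1.le, h2.le⟩
      refine ⟨hnb, (hG z).sub (uc z).1, ?_⟩
      rw [lap_sub (hG z) (uc z).1, (uc z).2, lap_add contDiffAt_const (contDiffAt_const.mul hGc.contDiffAt),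
        lap_const_mul _ hGc.contDiffAt, lap_const, hlapG, sub_zero]
      rw [sub_zero] at hGn
      have hV := mul_nonneg (h.nn z) (un z)
      have hl : 4 * ‖z‖ ^ 2 * (-(2 * Bq)) + 2 * N * (1 - Bq * (2 * (‖z‖ ^ 2 - r0))) ≤ -1 := by
        have h1 : Bq * (R ^ 2 / 2) ≤ Bq * ‖z‖ ^ 2 := by gcongr; linarith
        have h2 : Bq * (R ^ 2 / 2) = N / 2 := by rw [hB]; field_simp
        have h3 : 0 ≤ N * (Bq * (‖z‖ ^ 2 - r0)) := by
          have : 0 ≤ ‖z‖ ^ 2 - r0 := by linarith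
          positivity
        nlinarith
      have h2 := mul_le_mul_of_nonneg_left hl (hF.le.trans hΛ1)
      have := hfF z
      linarith) x0 ⟨by
        have : R ^ 2 ≤ ‖x0‖ ^ 2 := by gcongr
        have : 0 < 2 / k := by positivity
        linarith, by linarith⟩
  rw [sub_zero] at key
  have e : G0 (‖x0‖ ^ 2) ≤ ‖x0‖ ^ 2 - R ^ 2 + 2 / k := by
    simp only [G0]
    have : 0 ≤ Bq * (‖x0‖ ^ 2 - r0) ^ 2 := by positivity
    linarith
  have := mul_le_mul_of_nonneg_left e (hF.le.trans hΛ1)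
  linarith
end C2


open Set Filter Topology MeasureTheory
open scoped NNReal ContDiff ENNReal

section C3
variable {N : ℕ} {Θ : Measure (Eu N)} {V : Eu N → ℝ} {L : ℝ} {m : ℕ} {R C0 : ℝ}

theorem ball_subAR {x : Eu N} {r : ℝ} (h : R + r < ‖x‖) : Metric.closedBall x r ⊆ {x : Eu N | R < ‖x‖} := by
  intro y hy
  rw [mem_closedBall_iff_norm] at hy
  have := norm_sub_norm_le x y
  rw [norm_sub_rev] at this
  show R < ‖y‖
  linarith

theorem conv_sub {ι : Type} [Countable ι] {F : ℝ} (W : ℕ → ι → Eu N → ℝ) (hF : 0 ≤ F)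
    (hB : ∀ j i x, R < ‖x‖ → W j i x ∈ Icc 0 F)
    (hL : ∀ r > 0, ∃ C, 0 < C ∧ ∀ j i x y, Metric.closedBall x r ⊆ {x : Eu N | R < ‖x‖} →
      Metric.closedBall y r ⊆ {x : Eu N | R < ‖x‖} → |W j i x - W j i y| ≤ C * ‖x - y‖) :
    ∃ (φ : ℕ → ℕ) (U : ι → Eu N → ℝ), StrictMono φ ∧
      ∀ i x, R < ‖x‖ → Tendsto (fun j => W (φ j) i x) atTop (𝓝 (U i x)) := by
  classical
  let d := TopologicalSpace.denseSeq (Eu N)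
  let Y : ℕ → (ι × ℕ) → ℝ := fun j il => if R < ‖d il.2‖ then W j il.1 (d il.2) else 0
  have hK : IsCompact (Set.pi univ fun _ : ι × ℕ => Icc (0 : ℝ) F) := isCompact_univ_pi fun _ => isCompact_Icc
  obtain ⟨y, _, φ, hφ, ht⟩ := hK.tendsto_subseq (x := Y) (fun j il _ => by
    simp only [Y]
    split_ifs with h
    · exact hB j il.1 _ h
    · exact ⟨le_rfl, hF⟩)
  have hcau : ∀ i x, R < ‖x‖ → ∃ l, Tendsto (fun j => W (φ j) i x) atTop (𝓝 l) := by
    intro i x hx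
    refine cauchySeq_tendsto_of_complete (Metric.cauchySeq_iff'.2 fun ε hε => ?_)
    set r := (‖x‖ - R) / 3 with hr
    have hr0 : 0 < r := by rw [hr]; linarith
    obtain ⟨C, hC, hLip⟩ := hL r hr0
    have hδ : 0 < min r (ε / (3 * C)) := by positivity
    obtain ⟨l, hl⟩ := (TopologicalSpace.denseRange_denseSeq (Eu N)).exists_dist_lt x hδ
    rw [dist_eq_norm, lt_min_iff] at hl
    have hdn : R + r < ‖d l‖ := by
      have := norm_sub_norm_le x (d l)
      have h1 := hl.1
      change ‖x - d l‖ < r at h1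
      linarith
    have hYt : Tendsto (fun j => W (φ j) i (d l)) atTop (𝓝 (y (i, l))) := by
      have := (tendsto_pi_nhds.1 ht) (i, l)
      refine this.congr fun j => ?_
      simp only [Function.comp, Y]
      rw [if_pos (by linarith)]
    obtain ⟨n0, hn0⟩ := Metric.cauchySeq_iff'.1 hYt.cauchySeq (ε / 3) (by positivity)
    refine ⟨n0, fun j hj => ?_⟩
    have h1 := hn0 j hj
    have hb1 := ball_subAR (N := N) (R := R) (x := x) (r := r) (by linarith)
    have hb2 := ball_subAR hdn
    have h2 := hLip (φ j) i x (d l) hb1 hb2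
    have h3 := hLip (φ n0) i x (d l) hb1 hb2
    have h4 : C * ‖x - d l‖ < ε / 3 := by
      have := (mul_lt_mul_iff_right₀ hC).2 hl.2
      calc _ < C * (ε / (3 * C)) := this
        _ = ε / 3 := by field_simp
    rw [Real.dist_eq] at h1 ⊢
    rw [abs_lt] at h1 ⊢
    rw [abs_le] at h2 h3
    constructor <;> linarith [h1.1, h1.2, h2.1, h2.2, h3.1, h3.2]
  refine ⟨φ, fun i x => if h : R < ‖x‖ then (hcau i x h).choose else 0, hφ, fun i x hx => ?_⟩
  simp only [dif_pos hx]
  exact (hcau i x hx).choose_spec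

theorem AR_open : IsOpen {x : Eu N | R < ‖x‖} := isOpen_lt continuous_const continuous_norm

theorem lip_stage (hN : 3 ≤ N) (hR : 0 < R) {F : ℝ} (hF : 0 < F) {r : ℝ} (hr : 0 < r) :
    ∃ C, 0 < C ∧ ∀ (k : ℝ) (Θ : Measure (Eu N)) (f u : Eu N → ℝ), 0 < k → KD N (pen k R) (k ^ 4) Θ →
      Src f → (∀ x, 0 ≤ f x) → (∀ x, f x ≤ F) → IsK (pen k R) (k ^ 4) Θ f u →
      ∀ x y, Metric.closedBall x r ⊆ {x : Eu N | R < ‖x‖} →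
      Metric.closedBall y r ⊆ {x : Eu N | R < ‖x‖} → |u x - u y| ≤ C * ‖x - y‖ := by
  obtain ⟨C, hC, hl⟩ := weyl_lip hN hr
  refine ⟨C * F, by positivity, fun k Θ f u hk h hf hf0 hfF hu x y hx hy => ?_⟩
  have un := hu.nonneg h hf.bc hf.lla hf0
  have uF := hu.le_const h hf.bc hf.lla hF.le hfF
  have hw := hu.weak h hf.bc {x : Eu N | R < ‖x‖}
  have hw2 : Wk {x : Eu N | R < ‖x‖} u (fun x => f x - u x) := by
    refine hw.mono subset_rfl fun x hx => ?_
    rw [pen_zero hR hk (le_of_lt hx)]; ring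
  refine hl _ u _ F AR_open ⟨hu.bc.1.aestronglyMeasurable, fun x => ?_⟩ ⟨(hf.cont.sub hu.bc.1).aestronglyMeasurable, fun x => ?_⟩ hw2
    hu.bc.1.continuousOn x y hx hy
  · rw [Real.norm_of_nonneg (un x)]; exact uF x
  · show |f x - u x| ≤ F
    rw [abs_le]
    have := un x
    have := uF x
    have := hf0 x
    have := hfF x
    constructor <;> linarith

theorem wk_stage (hR : 0 < R) {k : ℝ} (hk : 0 < k) (h : KD N (pen k R) (k ^ 4) Θ) {f u : Eu N → ℝ}
      (hf : Src f) (hu : IsK (pen k R) (k ^ 4) Θ f u) : Wk {x : Eu N | R < ‖x‖} u (fun x => f x - u x) := by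
  refine (hu.weak h hf.bc {x : Eu N | R < ‖x‖}).mono subset_rfl fun x hx => ?_
  rw [pen_zero hR hk (le_of_lt hx)]; ring

theorem Wk_lim {Ω : Set (Eu N)} {F : ℝ} {uj hj : ℕ → Eu N → ℝ} {u h : Eu N → ℝ}
    (hw : ∀ j, Wk Ω (uj j) (hj j)) (cu : ∀ j, Continuous (uj j)) (ch : ∀ j, Continuous (hj j))
    (bu : ∀ j x, |uj j x| ≤ F) (bh : ∀ j x, |hj j x| ≤ F)
    (tu : ∀ x ∈ Ω, Tendsto (fun j => uj j x) atTop (𝓝 (u x)))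
    (th : ∀ x ∈ Ω, Tendsto (fun j => hj j x) atTop (𝓝 (h x))) : Wk Ω u h := by
  intro φ hφ hc hs
  have hz : ∀ x, x ∉ Ω → φ x = 0 ∧ lap φ x = 0 := by
    intro x hx
    have : x ∉ tsupport φ := fun h => hx (hs h)
    have he := notMem_tsupport_iff_eventuallyEq.1 this
    refine ⟨he.eq_of_nhds, ?_⟩
    have h2 : lap φ x = lap (fun _ => (0 : ℝ)) x := lap_congr he
    rw [h2, lap_const]
  have e1 : Tendsto (fun j => ∫ x, uj j x * lap φ x) atTop (𝓝 (∫ x, u x * lap φ x)) := by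
    refine tendsto_integral_of_dominated_convergence (fun x => F * |lap φ x|)
      (fun j => ((cu j).mul (lap_contDiff hφ).continuous).aestronglyMeasurable)
      (((cd_integrable (lap_compactSupport hc) (lap_contDiff hφ).continuous).abs).const_mul F)
      (fun j => Eventually.of_forall fun x => ?_) (Eventually.of_forall fun x => ?_)
    · rw [norm_mul]; exact mul_le_mul_of_nonneg_right (bu j x) (abs_nonneg _)
    · by_cases hx : x ∈ Ω
      · exact (tu x hx).mul_const _
      · simp [(hz x hx).2]
  have e2 : Tendsto (fun j => ∫ x, hj j x * φ x) atTop (𝓝 (∫ x, h x * φ x)) := by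
    refine tendsto_integral_of_dominated_convergence (fun x => F * |φ x|)
      (fun j => ((ch j).mul hφ.continuous).aestronglyMeasurable)
      (((cd_integrable hc hφ.continuous).abs).const_mul F)
      (fun j => Eventually.of_forall fun x => ?_) (Eventually.of_forall fun x => ?_)
    · rw [norm_mul]; exact mul_le_mul_of_nonneg_right (bh j x) (abs_nonneg _)
    · by_cases hx : x ∈ Ω
      · exact (th x hx).mul_const _
      · simp [(hz x hx).1]
  exact tendsto_nhds_unique e1 (e2.neg.congr fun j => (hw j φ hφ hc hs).symm)
end C3


open Set Filter Topology MeasureTheory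
open scoped NNReal ContDiff ENNReal

section C4
variable {N : ℕ} {Θ : Measure (Eu N)} {V : Eu N → ℝ} {L : ℝ} {m : ℕ} {R C0 : ℝ}

structure GoodF (R F k : ℝ) (Θ : Measure (Eu N)) (f z : Eu N → ℝ) : Prop where
  kd : KD N (pen k R) (k ^ 4) Θ
  src : Src f
  nn : ∀ x, 0 ≤ f x
  le : ∀ x, f x ≤ F
  zero : ∀ x, ‖x‖ ≤ R → f x = 0
  isk : IsK (pen k R) (k ^ 4) Θ f z

theorem GoodF.znn {F k : ℝ} {f z : Eu N → ℝ} (h : GoodF R F k Θ f z) (x : Eu N) : 0 ≤ z x :=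
  h.isk.nonneg h.kd h.src.bc h.src.lla h.nn x

theorem GoodF.zle {F k : ℝ} {f z : Eu N → ℝ} (hF : 0 ≤ F) (h : GoodF R F k Θ f z) (x : Eu N) : z x ≤ F :=
  h.isk.le_const h.kd h.src.bc h.src.lla hF h.le x

theorem good_lim (hN : 3 ≤ N) (hR : 0 < R) {F : ℝ} (hF : 0 < F) {k : ℕ → ℝ} (hk : Tendsto k atTop atTop) (hk0 : ∀ j, 0 < k j)
    {Θ : ℕ → Measure (Eu N)} {f z : ℕ → Eu N → ℝ} (hg : ∀ j, GoodF R F (k j) (Θ j) (f j) (z j)) {Z : Eu N → ℝ}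
    (ht : ∀ x, R < ‖x‖ → Tendsto (fun j => z j x) atTop (𝓝 (Z x))) :
    (∀ x, R < ‖x‖ → 0 ≤ Z x ∧ Z x ≤ F) ∧ (∀ x, R < ‖x‖ → LLA Z x) ∧
    (∀ x, R < ‖x‖ → ‖x‖ ^ 2 ≤ R ^ 2 + R ^ 2 / (4 * N) → Z x ≤ (4 * N / R ^ 2 * F + F) * (‖x‖ ^ 2 - R ^ 2)) := by
  refine ⟨fun x hx => ⟨ge_of_tendsto' (ht x hx) fun j => (hg j).znn x, le_of_tendsto' (ht x hx) fun j => (hg j).zle hF.le x⟩,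
    fun x hx => ?_, fun x hx hx2 => ?_⟩
  · set r := (‖x‖ - R) / 3 with hr
    have hr0 : 0 < r := by rw [hr]; linarith
    obtain ⟨C, hC, hl⟩ := lip_stage hN hR hF hr0
    refine ⟨⟨C, hC.le⟩, Metric.ball x r, Metric.ball_mem_nhds x hr0, LipschitzOnWith.of_dist_le_mul fun y hy y' hy' => ?_⟩
    have hb : ∀ y ∈ Metric.ball x r, R + r < ‖y‖ := by
      intro y hy
      rw [mem_ball_iff_norm, norm_sub_rev] at hy
      have := norm_sub_norm_le x y
      linarith
    rw [Real.dist_eq, dist_eq_norm]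
    have h1 := hb y hy
    have h2 := hb y' hy'
    refine le_of_tendsto' (((ht y (by linarith)).sub (ht y' (by linarith))).abs) fun j => ?_
    exact hl _ _ _ _ (hk0 j) (hg j).kd (hg j).src (hg j).nn (hg j).le (hg j).isk y y' (ball_subAR h1) (ball_subAR h2)
  · have hN0 : (0 : ℝ) < N := by exact_mod_cast (by omega : 0 < N)
    have hi : Tendsto (fun j => (k j)⁻¹) atTop (𝓝 0) := hk.inv_tendsto_atTop
    have h1 : Tendsto (fun j => 2 * N * F * (2 * R + 1) ^ 2 * ((k j)⁻¹) ^ 2 + (4 * N / R ^ 2 * F + F) * (‖x‖ ^ 2 - R ^ 2 + 2 * (k j)⁻¹))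
        atTop (𝓝 (2 * N * F * (2 * R + 1) ^ 2 * 0 ^ 2 + (4 * N / R ^ 2 * F + F) * (‖x‖ ^ 2 - R ^ 2 + 2 * 0))) :=
      ((hi.pow 2).const_mul _).add (((hi.const_mul 2).const_add _).const_mul _)
    have h2 : Tendsto (fun j => 2 / k j) atTop (𝓝 0) := by
      have := hi.const_mul 2
      rw [mul_zero] at this
      exact this
    have h3 := h2.eventually (eventually_le_nhds (show 0 < R ^ 2 / (4 * N) by positivity))
    have h4 := le_of_tendsto_of_tendsto (ht x hx) h1 (by
      filter_upwards [h3, hk.eventually_ge_atTop 1] with j e1 e2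
      have := barrier2 hR hF e2 e1 (hg j).kd (hg j).src (hg j).nn (hg j).le (hg j).zero (hg j).isk hx hx2
      rwa [div_eq_mul_inv _ (k j ^ 2), div_eq_mul_inv 2 (k j), ← inv_pow] at this)
    simpa using h4

theorem bdm_ind {g : Eu N → ℝ} {M : ℝ} (hM : 0 ≤ M) (hc : ContinuousOn g {x : Eu N | R < ‖x‖})
    (hb : ∀ x, R < ‖x‖ → |g x| ≤ M) (hz : ∀ x, ‖x‖ ≤ R → g x = 0) : Bdm g M := by
  refine ⟨?_, fun x => ?_⟩
  · have e : g = indicator {x : Eu N | R < ‖x‖} g := by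
      ext x
      by_cases hx : R < ‖x‖
      · rw [indicator_of_mem (show x ∈ {x : Eu N | R < ‖x‖} from hx)]
      · rw [indicator_of_notMem (show x ∉ {x : Eu N | R < ‖x‖} from hx), hz x (not_lt.1 hx)]
    rw [e, aestronglyMeasurable_indicator_iff AR_open.measurableSet]
    exact hc.aestronglyMeasurable AR_open.measurableSet
  · by_cases hx : R < ‖x‖
    · exact hb x hx
    · rw [hz x (not_lt.1 hx), norm_zero]; exact hM

theorem lim_solve (hN : 3 ≤ N) (hR : 0 < R) {F : ℝ} (hF : 0 < F) {k : ℕ → ℝ} (hk : Tendsto k atTop atTop) (hk0 : ∀ j, 0 < k j)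
    {Θ : ℕ → Measure (Eu N)} {f z : ℕ → Eu N → ℝ} (hg : ∀ j, GoodF R F (k j) (Θ j) (f j) (z j)) {Z Fl : Eu N → ℝ}
    (ht : ∀ x, R < ‖x‖ → Tendsto (fun j => z j x) atTop (𝓝 (Z x)))
    (hZ0 : ∀ x, ‖x‖ ≤ R → Z x = 0)
    (htf : ∀ x, R < ‖x‖ → Tendsto (fun j => f j x) atTop (𝓝 (Fl x))) (hfl : ∀ x, R < ‖x‖ → LLA Fl x)
    {x : Eu N} (hx : R < ‖x‖) : ContDiffAt ℝ 2 Z x ∧ -lap Z x + Z x = Fl x := by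
  obtain ⟨g1, g2, -⟩ := good_lim hN hR hF hk hk0 hg ht
  have hf1 : ∀ x, R < ‖x‖ → 0 ≤ Fl x ∧ Fl x ≤ F := fun x hx =>
    ⟨ge_of_tendsto' (htf x hx) fun j => (hg j).nn x, le_of_tendsto' (htf x hx) fun j => (hg j).le x⟩
  let h : Eu N → ℝ := fun x => if R < ‖x‖ then Fl x - Z x else 0
  have he : ∀ x, R < ‖x‖ → h x = Fl x - Z x := fun x hx => if_pos hx
  have hL : ∀ x, R < ‖x‖ → LLA h x := fun x hx => ((hfl x hx).sub (g2 x hx)).congr (by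
    filter_upwards [AR_open.mem_nhds hx] with y hy
    exact (he y hy).symm)
  have hw : Wk {x : Eu N | R < ‖x‖} Z h := by
    refine Wk_lim (F := F) (fun j => wk_stage hR (hk0 j) (hg j).kd (hg j).src (hg j).isk) (fun j => (hg j).isk.bc.1)
      (fun j => (hg j).src.cont.sub (hg j).isk.bc.1) (fun j x => ?_) (fun j x => ?_) ht (fun x hx => ?_)
    · rw [abs_of_nonneg ((hg j).znn x)]; exact (hg j).zle hF.le x
    · have := (hg j).znn x
      have := (hg j).zle hF.le x
      have := (hg j).nn x
      have := (hg j).le x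
      rw [abs_le]; constructor <;> linarith
    · rw [he x hx]; exact (htf x hx).sub (ht x hx)
  have := weyl hN AR_open (bdm_ind (R := R) hF.le (fun x hx => (g2 x hx).continuousAt.continuousWithinAt) (fun x hx => by
      rw [abs_of_nonneg (g1 x hx).1]; exact (g1 x hx).2) hZ0)
    (bdm_ind (R := R) hF.le (fun x hx => (hL x hx).continuousAt.continuousWithinAt) (fun x hx => by
      rw [he x hx, abs_le]
      have := g1 x hx
      have := hf1 x hx
      constructor <;> linarith) (fun x hx => if_neg (not_lt.2 hx))) hw (fun x hx => (g2 x hx).continuousAt.continuousWithinAt) hx (hL x hx)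
  refine ⟨this.1, ?_⟩
  rw [this.2, he x hx]; ring

theorem yd_cont {q : ℝ} (hq : 2 < q) : Continuous fun s : ℝ × ℝ => yd q s.1 s.2 := by
  unfold yd
  have h1 : Continuous fun s : ℝ × ℝ => s.1 ^ q := continuous_fst.rpow_const fun x => Or.inr (by linarith)
  have h2 : Continuous fun s : ℝ × ℝ => s.2 ^ q := continuous_snd.rpow_const fun x => Or.inr (by linarith)
  have h3 : Continuous fun s : ℝ × ℝ => s.2 ^ (q - 1) := continuous_snd.rpow_const fun x => Or.inr (by linarith)
  exact ((h1.div_const _).add (h2.div_const _)).sub (continuous_fst.mul h3)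

/-- the defect vanishes in the limit -/
theorem defect_lim {g : ℕ → Eu N → ℝ} {G : Eu N → ℝ} {M : ℝ} {e : ℕ → ℝ} (he : Tendsto e atTop (𝓝 0))
    (hgi : ∀ j, Integrable (g j)) (hg0 : ∀ j x, 0 ≤ g j x) (hgM : ∀ j x, g j x ≤ M) (hge : ∀ j, ∫ x, g j x ≤ e j)
    (hGc : ∀ x, R < ‖x‖ → ContinuousAt G x) (ht : ∀ x, R < ‖x‖ → Tendsto (fun j => g j x) atTop (𝓝 (G x)))
    {x : Eu N} (hx : R < ‖x‖) : G x ≤ 0 := by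
  by_contra hc
  have hc := not_le.1 hc
  have h1 : ∀ᶠ y in 𝓝 x, G x / 2 < G y := (hGc x hx).eventually (lt_mem_nhds (by linarith))
  obtain ⟨r, hr, hball⟩ := Metric.nhds_basis_closedBall.mem_iff.1 (h1.and (AR_open.mem_nhds hx))
  have hfin : volume (Metric.closedBall x r) ≠ ⊤ := (isCompact_closedBall x r).measure_ne_top
  have hms := (Metric.isClosed_closedBall (x := x) (ε := r)).measurableSet
  have hlim : Tendsto (fun j => ∫ y in Metric.closedBall x r, g j y) atTop (𝓝 (∫ y in Metric.closedBall x r, G y)) := by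
    refine tendsto_integral_of_dominated_convergence (fun _ => M) (fun j => (hgi j).aestronglyMeasurable.restrict)
      (integrableOn_const hfin) (fun j => Eventually.of_forall fun y => ?_) ?_
    · rw [Real.norm_of_nonneg (hg0 j y)]; exact hgM j y
    · refine (ae_restrict_iff' hms).2 (Eventually.of_forall fun y hy => ht y (hball hy).2)
  have h2 : ∫ y in Metric.closedBall x r, G y ≤ 0 := by
    refine le_of_tendsto_of_tendsto' hlim he fun j => le_trans ?_ (hge j)
    exact setIntegral_le_integral (hgi j) (Eventually.of_forall (hg0 j))
  have h3 : G x / 2 * volume.real (Metric.closedBall x r) ≤ ∫ y in Metric.closedBall x r, G y := by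
    refine setIntegral_ge_of_const_le_real hms hfin (fun y hy => (hball hy).1.le) ?_
    exact ContinuousOn.integrableOn_compact (isCompact_closedBall x r) fun y hy => (hGc y (hball hy).2).continuousWithinAt
  have h4 : 0 < volume.real (Metric.closedBall x r) :=
    ENNReal.toReal_pos (Metric.measure_closedBall_pos volume x hr).ne' hfin
  have : 0 < G x / 2 * volume.real (Metric.closedBall x r) := by positivity
  linarith
end C4


open Set Filter Topology MeasureTheory
open scoped NNReal ContDiff ENNReal

section C5
variable {N : ℕ} {Θ : Measure (Eu N)} {V : Eu N → ℝ} {L : ℝ} {m : ℕ} {R C0 : ℝ}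

theorem nontriv (hm : 2 ≤ m) (hR : 0 < R) {β : ℝ} (hβ : 0 < β) {p q c0 F : ℝ} (hp : 2 < p) (hpq : p ≤ q) (hc0 : 0 < c0)
    (hF : 0 < F) (hC0 : 0 < C0) {γ u : ℕ → Eu N → ℝ} (hγ : ∀ j, Wgt m R C0 (γ j)) (hu : ∀ j, Adm m (u j))
    (hμ : ∀ j, c0 ≤ nm (γ j) q (u j)) (hdu : ∀ j x, R < ‖x‖ → u j x ≤ F * rh m β x) (huF : ∀ j x, u j x ≤ F)
    (hintg : ∀ j, Integrable fun x => u j x ^ (p / (p - 1))) (hi : ∀ j, ∫ x, u j x ^ (p / (p - 1)) ≤ F)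
    (ht : ∀ x, R < ‖x‖ → Tendsto (fun j => u j x) atTop (𝓝 0)) : False := by
  have hq : 2 < q := by linarith
  have hp1 : 0 < p - 1 := by linarith
  have hp'2 : p / (p - 1) < 2 := by rw [div_lt_iff₀ hp1]; linarith
  have hp'0 : 0 < p / (p - 1) := by positivity
  have hqp : 0 < q - p / (p - 1) := by linarith
  let τ : ℝ → ℝ := fun ρ => (F * (ρ ^ (m - 1))⁻¹ ^ (1 / β)) ^ (q - p / (p - 1))
  have hτ : Tendsto τ atTop (𝓝 0) := by
    have h1 : Tendsto (fun ρ : ℝ => (ρ ^ (m - 1))⁻¹) atTop (𝓝 0) := (tendsto_pow_atTop (by omega)).inv_tendsto_atTop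
    have h2 := h1.rpow_const (p := 1 / β) (Or.inr (by positivity))
    rw [Real.zero_rpow (by positivity)] at h2
    have h3 := (h2.const_mul F).rpow_const (p := q - p / (p - 1)) (Or.inr hqp.le)
    rwa [mul_zero, Real.zero_rpow hqp.ne'] at h3
  have key : ∀ ρ, R ≤ ρ → c0 ^ q ≤ C0 * 0 + C0 * τ ρ * F := by
    intro ρ hρ
    have hρ0 : 0 < ρ := hR.trans_le hρ
    set S : Set (Eu N) := Metric.closedBall 0 ρ ∩ {x | R < ‖x‖} with hS
    have hSm : MeasurableSet S := (Metric.isClosed_closedBall).measurableSet.inter AR_open.measurableSet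
    have hSf : volume S ≠ ⊤ := ne_top_of_le_ne_top (isCompact_closedBall (0 : Eu N) ρ).measure_ne_top (measure_mono inter_subset_left)
    have hτ0 : 0 ≤ τ ρ := by positivity
    have hcq : ∀ j, Continuous fun x => u j x ^ q := fun j => (hu j).bc.1.rpow_const fun x => Or.inr (by linarith)
    have hbq : ∀ j x, ‖u j x ^ q‖ ≤ F ^ q := fun j x => by
      rw [Real.norm_of_nonneg (Real.rpow_nonneg ((hu j).nn x) _)]
      have := huF j x
      have := (hu j).nn x
      gcongr
    have hSi : ∀ j, IntegrableOn (fun x => u j x ^ q) S := fun j =>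
      Measure.integrableOn_of_bounded hSf (hcq j).aestronglyMeasurable (Eventually.of_forall (hbq j))
    have hlim : Tendsto (fun j => ∫ x in S, u j x ^ q) atTop (𝓝 (∫ x in S, (0 : ℝ))) := by
      refine tendsto_integral_of_dominated_convergence (fun _ => F ^ q) (fun j => (hcq j).aestronglyMeasurable)
        (integrableOn_const hSf) (fun j => Eventually.of_forall (hbq j)) ?_
      refine (ae_restrict_iff' hSm).2 (Eventually.of_forall fun x hx => ?_)
      have := (ht x hx.2).rpow_const (p := q) (Or.inr (by linarith))
      rwa [Real.zero_rpow (by linarith)] at this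
    rw [integral_zero] at hlim
    refine ge_of_tendsto' ((hlim.const_mul C0).add_const (C0 * τ ρ * F)) fun j => ?_
    have hi1 : Integrable (S.indicator fun x => u j x ^ q) := (integrable_indicator_iff hSm).2 (hSi j)
    have e0 : c0 ^ q ≤ nm (γ j) q (u j) ^ q := by
      have := hμ j
      gcongr
    rw [nm_pow (hγ j) (hu j) hq] at e0
    refine e0.trans ?_
    calc ∫ x, γ j x * u j x ^ q ≤ ∫ x, (C0 * S.indicator (fun x => u j x ^ q) x + C0 * τ ρ * u j x ^ (p / (p - 1))) := by
          refine integral_mono (wI (hγ j) (hu j) (by linarith)) ((hi1.const_mul _).add ((hintg j).const_mul _)) fun x => ?_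
          dsimp only
          have hx0 := (hu j).nn x
          have hind : 0 ≤ S.indicator (fun x => u j x ^ q) x := indicator_nonneg (fun x _ => Real.rpow_nonneg ((hu j).nn x) _) x
          have hup : 0 ≤ u j x ^ (p / (p - 1)) := Real.rpow_nonneg hx0 _
          rcases le_or_gt ‖x‖ R with h1 | h1
          · rw [(hγ j).zero x h1, zero_mul]; positivity
          · have hγ1 := (hγ j).le x
            rcases le_or_gt ‖x‖ ρ with h2 | h2
            · rw [indicator_of_mem (show x ∈ S from ⟨by simpa using h2, h1⟩)]
              have : 0 ≤ C0 * τ ρ * u j x ^ (p / (p - 1)) := by positivity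
              have : γ j x * u j x ^ q ≤ C0 * u j x ^ q := by gcongr
              linarith
            · have e1 : u j x ^ q ≤ τ ρ * u j x ^ (p / (p - 1)) := by
                rcases hx0.eq_or_lt with h3 | h3
                · rw [← h3, Real.zero_rpow (by linarith)]
                  exact mul_nonneg hτ0 (Real.rpow_nonneg le_rfl _)
                · have : u j x ^ q = u j x ^ (q - p / (p - 1)) * u j x ^ (p / (p - 1)) := by
                    rw [← Real.rpow_add h3]; congr 1; ring
                  rw [this]
                  have h4 : u j x ≤ F * (ρ ^ (m - 1))⁻¹ ^ (1 / β) :=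
                    (hdu j x h1).trans (mul_le_mul_of_nonneg_left (rh_le hρ0 hβ h2.le) hF.le)
                  simp only [τ]
                  gcongr
              have : γ j x * u j x ^ q ≤ C0 * (τ ρ * u j x ^ (p / (p - 1))) := by gcongr
              have : 0 ≤ C0 * S.indicator (fun x => u j x ^ q) x := by positivity
              linarith
      _ = C0 * (∫ x in S, u j x ^ q) + C0 * τ ρ * ∫ x, u j x ^ (p / (p - 1)) := by
          rw [integral_add (hi1.const_mul _) ((hintg j).const_mul _), integral_const_mul, integral_const_mul, integral_indicator hSm]
      _ ≤ _ := by
          have := hi j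
          gcongr
  have h1 := (((hτ.const_mul C0).mul_const F).const_add (C0 * 0))
  have h2 : c0 ^ q ≤ C0 * 0 + C0 * 0 * F := ge_of_tendsto h1 ((eventually_ge_atTop R).mono key)
  have : 0 < c0 ^ q := by positivity
  simp at h2
  linarith

theorem ct_tendsto {k : ℕ → ℝ} (hk : Tendsto k atTop atTop) {x : Eu N} (hR : 0 < R) (hx : R < ‖x‖) :
    Tendsto (fun j => ct (k j) R x) atTop (𝓝 1) := by
  have h2 : Tendsto (fun j => 2 / k j) atTop (𝓝 0) := hk.const_div_atTop 2
  have h3 : 0 < ‖x‖ ^ 2 - R ^ 2 := by nlinarith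
  refine tendsto_const_nhds.congr' ?_
  filter_upwards [h2.eventually (eventually_le_nhds h3), hk.eventually_ge_atTop (‖x‖ ^ 2), hk.eventually_gt_atTop 0] with j e1 e2 e3
  rw [ct_one e3 (by linarith) e2]
end C5


open Set Filter Topology MeasureTheory
open scoped NNReal ContDiff ENNReal

section C6
variable {N : ℕ} {Θ : Measure (Eu N)} {V : Eu N → ℝ} {L : ℝ} {m : ℕ} {R C0 : ℝ}

/-- the output of the limiting procedure -/
structure Sol (m : ℕ) (R F p q μ ν : ℝ) (a b u v : Eu N → ℝ) : Prop where
  zu : ∀ x, ‖x‖ ≤ R → u x = 0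
  zv : ∀ x, ‖x‖ ≤ R → v x = 0
  nu : ∀ x, 0 ≤ u x
  nv : ∀ x, 0 ≤ v x
  cu : ∀ x, R < ‖x‖ → ContDiffAt ℝ 2 u x
  cv : ∀ x, R < ‖x‖ → ContDiffAt ℝ 2 v x
  eu : ∀ x, R < ‖x‖ → -lap u x + u x = a x * (v x / ν) ^ (p - 1)
  ev : ∀ x, R < ‖x‖ → -lap v x + v x = b x * (u x / μ) ^ (q - 1)
  bu : ∀ x, R < ‖x‖ → ‖x‖ ^ 2 ≤ R ^ 2 + R ^ 2 / (4 * N) → u x ≤ (4 * N / R ^ 2 * F + F) * (‖x‖ ^ 2 - R ^ 2)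
  bv : ∀ x, R < ‖x‖ → ‖x‖ ^ 2 ≤ R ^ 2 + R ^ 2 / (4 * N) → v x ≤ (4 * N / R ^ 2 * F + F) * (‖x‖ ^ 2 - R ^ 2)
  uF : ∀ x, u x ≤ F
  coneu : Cone m u
  conev : Cone m v
  ntu : ∃ x, R < ‖x‖ ∧ u x ≠ 0

theorem exists_pt (hN : 3 ≤ N) (hR : 0 < R) : ∃ x : Eu N, R < ‖x‖ := by
  refine ⟨EuclideanSpace.single (⟨0, by omega⟩ : Fin N) (R + 1), ?_⟩
  rw [PiLp.norm_single, Real.norm_of_nonneg (by linarith)]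
  linarith

theorem zero_ext_cone {U : Eu N → ℝ} {z : ℕ → Eu N → ℝ} (hz : ∀ j, Cone m (z j))
    (ht : ∀ x, R < ‖x‖ → Tendsto (fun j => z j x) atTop (𝓝 (U x))) (h0 : ∀ x, ‖x‖ ≤ R → U x = 0) : Cone m U := by
  intro x y hxy htv
  rcases le_or_gt ‖x‖ R with h | h
  · rw [h0 x h, h0 y (hxy ▸ h)]
  · exact le_of_tendsto_of_tendsto' (ht x h) (ht y (hxy ▸ h)) fun j => hz j x y hxy htv

theorem sg_zero {γ : Eu N → ℝ} (hγ : Wgt m R C0 γ) {x : Eu N} (hx : ‖x‖ ≤ R) (q : ℝ) (u : Eu N → ℝ) : sg γ q u x = 0 := by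
  unfold sg; rw [hγ.zero x hx, zero_mul]

set_option maxHeartbeats 1000000 in
theorem main_lim {n : ℕ} (hm : 2 ≤ m) (hn : 2 ≤ n) (hN : N = m + n) {β : ℝ} (hβ : 1 < β)
    (hβn : (n : ℝ) + 1 < 2 * β) (hR : 0 < R) {p q c1 : ℝ} (hp : 2 < p) (hpq : p ≤ q) (hc1 : 0 < c1)
    (hβp : p / (p - 1) ≤ β) (hθ : (p * (1 - 1 / β) - 1) * (q * (1 - 1 / β) - 1) < 1) (hC0 : 0 < C0)
    {a b : Eu N → ℝ} (ha : Coef m R c1 C0 a) (hb : Coef m R c1 C0 b) :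
    ∃ F μ ν : ℝ, ∃ u v : Eu N → ℝ, 0 < F ∧ 0 < μ ∧ 0 < ν ∧ Sol m R F p q μ ν a b u v := by
  have hN3 : 3 ≤ N := by omega
  have hq : 2 < q := by linarith
  obtain ⟨c0, F, hc0, hF, hs⟩ := stage_seq hm hn hN hβ hβn hR hp hpq hc1 hβp hθ hC0 ha hb
  obtain ⟨K, hK1, hK2, hK3⟩ : ∃ K, 1 ≤ K ∧ 14 * R ^ 2 ≤ K ∧ 2 / (5 * R ^ 2) ≤ K :=
    ⟨max 1 (max (14 * R ^ 2) (2 / (5 * R ^ 2))), le_max_left _ _, (le_max_left _ _).trans (le_max_right _ _),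
      (le_max_right _ _).trans (le_max_right _ _)⟩
  have hR2 : 0 < R ^ 2 := by positivity
  have hst : ∀ j : ℕ, ∃ Θ u v w, StageSeq m R β p q c0 F a b ((j : ℝ) + K) Θ u v w := by
    intro j
    have hj : (0 : ℝ) ≤ j := Nat.cast_nonneg j
    refine hs ((j : ℝ) + K) (by linarith) ?_ (by linarith)
    rw [div_le_iff₀ (by linarith)]
    rw [div_le_iff₀ (by positivity)] at hK3
    nlinarith
  choose Θ0 u0 v0 w0 hS0 using hst
  have hku : ∀ j : ℕ, ∃ f, Src f ∧ (∀ x, 0 ≤ f x) ∧ (∀ x, f x ≤ F) ∧ (∀ x, ‖x‖ ≤ R → f x = 0) ∧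
      IsK (pen ((j : ℝ) + K) R) (((j : ℝ) + K) ^ 4) (Θ0 j) f (u0 j) := fun j => (hS0 j).so.ku
  choose f0 hf0 using hku
  have k0pos : ∀ j : ℕ, (0 : ℝ) < (j : ℝ) + K := fun j => by
    have hj : (0 : ℝ) ≤ j := Nat.cast_nonneg j
    linarith
  have wα : ∀ j : ℕ, Wgt m R C0 (fun x => ct ((j : ℝ) + K) R x * a x) := fun j => ha.wgt hR hc1 hC0 (k0pos j)
  have wγ : ∀ j : ℕ, Wgt m R C0 (fun x => ct ((j : ℝ) + K) R x * b x) := fun j => hb.wgt hR hc1 hC0 (k0pos j)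
  have gu0 : ∀ j : ℕ, GoodF R F ((j : ℝ) + K) (Θ0 j) (f0 j) (u0 j) := fun j =>
    ⟨(hS0 j).kd, (hf0 j).1, (hf0 j).2.1, (hf0 j).2.2.1, (hf0 j).2.2.2.1, (hf0 j).2.2.2.2⟩
  have gv0 : ∀ j : ℕ, GoodF R F ((j : ℝ) + K) (Θ0 j) (sg (fun x => ct ((j : ℝ) + K) R x * b x) q (u0 j)) (v0 j) := fun j =>
    ⟨(hS0 j).kd, sg_src (wγ j) (hS0 j).so.hu hq, sg_nn (wγ j) (hS0 j).so.hu q, (hS0 j).so.sq,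
      fun x hx => sg_zero (wγ j) hx _ _, (hS0 j).so.kv⟩
  have gw0 : ∀ j : ℕ, GoodF R F ((j : ℝ) + K) (Θ0 j) (sg (fun x => ct ((j : ℝ) + K) R x * a x) p (v0 j)) (w0 j) := fun j =>
    ⟨(hS0 j).kd, sg_src (wα j) (hS0 j).so.hv hp, sg_nn (wα j) (hS0 j).so.hv p, (hS0 j).so.sp,
      fun x hx => sg_zero (wα j) hx _ _, (hS0 j).so.kw⟩
  obtain ⟨φ, U, hφ, hU⟩ := conv_sub (R := R) (F := F) (ι := Fin 5)
    (fun j i x => (![u0 j x, v0 j x, w0 j x, nm (fun x => ct ((j : ℝ) + K) R x * b x) q (u0 j),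
      nm (fun x => ct ((j : ℝ) + K) R x * a x) p (v0 j)] : Fin 5 → ℝ) i) hF.le (by
      intro j i x hx
      fin_cases i
      · exact ⟨(gu0 j).znn x, (gu0 j).zle hF.le x⟩
      · exact ⟨(gv0 j).znn x, (gv0 j).zle hF.le x⟩
      · exact ⟨(gw0 j).znn x, (gw0 j).zle hF.le x⟩
      · exact ⟨hc0.le.trans (hS0 j).so.mu0, (hS0 j).so.mu1⟩
      · exact ⟨hc0.le.trans (hS0 j).so.nu0, (hS0 j).so.nu1⟩) (by
      intro r hr
      obtain ⟨C, hC, hl⟩ := lip_stage hN3 hR hF hr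
      have hl' : ∀ {k Θ f u}, 0 < k → GoodF R F k Θ f u → ∀ x y, Metric.closedBall x r ⊆ {x : Eu N | R < ‖x‖} →
        Metric.closedBall y r ⊆ {x : Eu N | R < ‖x‖} → |u x - u y| ≤ C * ‖x - y‖ := fun hk g =>
          hl _ _ _ _ hk g.kd g.src g.nn g.le g.isk
      use C, hC
      intro j i x y hx hy
      have h0 : ∀ z : ℝ, |z - z| ≤ C * ‖x - y‖ := fun z => by rw [sub_self, abs_zero]; positivity
      fin_cases i
      · exact hl' (k0pos j) (gu0 j) x y hx hy
      · exact hl' (k0pos j) (gv0 j) x y hx hy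
      · exact hl' (k0pos j) (gw0 j) x y hx hy
      · exact h0 _
      · exact h0 _)
  obtain ⟨xp, hxp⟩ := exists_pt hN3 hR
  have hk : Tendsto (fun j => ((φ j : ℕ) : ℝ) + K) atTop atTop :=
    tendsto_atTop_add_const_right _ _ (tendsto_natCast_atTop_atTop.comp hφ.tendsto_atTop)
  have hk0 : ∀ j, 0 < ((φ j : ℕ) : ℝ) + K := fun j => k0pos _
  set μ := U 3 xp with hμ
  set ν := U 4 xp with hν
  have tμ : Tendsto (fun j => nm (fun x => ct ((φ j : ℝ) + K) R x * b x) q (u0 (φ j))) atTop (𝓝 μ) := hU 3 xp hxp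
  have tν : Tendsto (fun j => nm (fun x => ct ((φ j : ℝ) + K) R x * a x) p (v0 (φ j))) atTop (𝓝 ν) := hU 4 xp hxp
  have hμ0 : 0 < μ := hc0.trans_le (ge_of_tendsto' tμ fun j => (hS0 (φ j)).so.mu0)
  have hν0 : 0 < ν := hc0.trans_le (ge_of_tendsto' tν fun j => (hS0 (φ j)).so.nu0)
  let ext : (Eu N → ℝ) → Eu N → ℝ := fun g x => if R < ‖x‖ then g x else 0
  have ext0 : ∀ (g : Eu N → ℝ) x, ‖x‖ ≤ R → ext g x = 0 := fun g x hx => if_neg (not_lt.2 hx)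
  have ext1 : ∀ (g : Eu N → ℝ) x, R < ‖x‖ → ext g x = g x := fun g x hx => if_pos hx
  have tu : ∀ x, R < ‖x‖ → Tendsto (fun j => u0 (φ j) x) atTop (𝓝 (ext (U 0) x)) := fun x hx => by
    rw [ext1 _ x hx]; exact hU 0 x hx
  have tv : ∀ x, R < ‖x‖ → Tendsto (fun j => v0 (φ j) x) atTop (𝓝 (ext (U 1) x)) := fun x hx => by
    rw [ext1 _ x hx]; exact hU 1 x hx
  have tw : ∀ x, R < ‖x‖ → Tendsto (fun j => w0 (φ j) x) atTop (𝓝 (ext (U 2) x)) := fun x hx => by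
    rw [ext1 _ x hx]; exact hU 2 x hx
  generalize hu : ext (U 0) = u at tu
  generalize hv : ext (U 1) = v at tv
  generalize hw : ext (U 2) = w at tw
  have zu : ∀ x, ‖x‖ ≤ R → u x = 0 := hu ▸ ext0 (U 0)
  have zv : ∀ x, ‖x‖ ≤ R → v x = 0 := hv ▸ ext0 (U 1)
  have zw : ∀ x, ‖x‖ ≤ R → w x = 0 := hw ▸ ext0 (U 2)
  obtain ⟨u1, u2, u3⟩ := good_lim hN3 hR hF hk hk0 (fun j => gu0 (φ j)) tu
  obtain ⟨v1, v2, v3⟩ := good_lim hN3 hR hF hk hk0 (fun j => gv0 (φ j)) tv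
  obtain ⟨w1, w2, w3⟩ := good_lim hN3 hR hF hk hk0 (fun j => gw0 (φ j)) tw
  have tγ : ∀ x, R < ‖x‖ → Tendsto (fun j => ct ((φ j : ℝ) + K) R x * b x) atTop (𝓝 (b x)) := fun x hx => by
    simpa using (ct_tendsto hk hR hx).mul_const (b x)
  have tα : ∀ x, R < ‖x‖ → Tendsto (fun j => ct ((φ j : ℝ) + K) R x * a x) atTop (𝓝 (a x)) := fun x hx => by
    simpa using (ct_tendsto hk hR hx).mul_const (a x)
  have hwu : ∀ x, R < ‖x‖ → w x = u x := by
    intro x hx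
    have hgM : ∀ j y, (fun x => ct ((φ j : ℝ) + K) R x * b x) y * yd q (w0 (φ j) y) (u0 (φ j) y) ≤ C0 * (F ^ q / q + F ^ q / (q / (q - 1))) := by
      intro j y
      have h1 := (gw0 (φ j)).znn y
      have h2 := (gw0 (φ j)).zle hF.le y
      have h3 := (gu0 (φ j)).znn y
      have h4 := (gu0 (φ j)).zle hF.le y
      have h5 := yd_nonneg hq h1 h3
      have hq1 : 0 < q - 1 := by linarith
      have h6 : yd q (w0 (φ j) y) (u0 (φ j) y) ≤ F ^ q / q + F ^ q / (q / (q - 1)) := by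
        unfold yd
        have : 0 ≤ w0 (φ j) y * u0 (φ j) y ^ (q - 1) := by positivity
        have e1 : w0 (φ j) y ^ q / q ≤ F ^ q / q := by gcongr
        have e2 : u0 (φ j) y ^ q / (q / (q - 1)) ≤ F ^ q / (q / (q - 1)) := by gcongr
        linarith
      exact mul_le_mul ((wγ (φ j)).le y) h6 h5 hC0.le
    let g : ℕ → Eu N → ℝ := fun j y => (fun x => ct ((φ j : ℝ) + K) R x * b x) y * yd q (w0 (φ j) y) (u0 (φ j) y)
    have g1 : ∀ j, Integrable (g j) := fun j => (yd_int (wγ (φ j)) (hS0 (φ j)).so.hu (hS0 (φ j)).so.hw hq).1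
    have g2 : ∀ j y, 0 ≤ g j y := fun j y => mul_nonneg ((wγ (φ j)).nn y) (yd_nonneg hq ((gw0 (φ j)).znn y) ((gu0 (φ j)).znn y))
    have g3 : ∀ j, ∫ y, g j y ≤ 1 / ((φ j : ℝ) + K) := fun j => (hS0 (φ j)).so.jd
    have g4 : ∀ y, R < ‖y‖ → ContinuousAt (fun y => b y * yd q (w y) (u y)) y := fun y hy => (hb.lla y hy).continuousAt.mul
        ((yd_cont hq).continuousAt.comp (f := fun y => (w y, u y)) ((w2 y hy).continuousAt.prodMk (u2 y hy).continuousAt))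
    have g5 : ∀ y, R < ‖y‖ → Tendsto (fun j => g j y) atTop (𝓝 (b y * yd q (w y) (u y))) := by
      intro y hy
      have e1 : Tendsto (fun j => yd q (w0 (φ j) y) (u0 (φ j) y)) atTop (𝓝 (yd q (w y) (u y))) := by
        have e2 := (yd_cont hq).tendsto (w y, u y)
        have e3 := (tw y hy).prodMk_nhds (tu y hy)
        simpa only [Function.comp_def] using e2.comp e3
      exact (tγ y hy).mul e1
    have := defect_lim (R := R) (hk.const_div_atTop 1) g1 g2 hgM g3 g4 g5 hx
    suffices hyd : yd q (w x) (u x) ≤ 0 from yd_zero hq (w1 x hx).1 (u1 x hx).1 hyd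
    have h2 := hb.lo x hx
    by_contra hcon
    have := mul_pos (hc1.trans_le h2) (not_le.1 hcon)
    linarith
  have tsq : ∀ x, R < ‖x‖ → Tendsto (fun j => sg (fun x => ct ((φ j : ℝ) + K) R x * b x) q (u0 (φ j)) x) atTop
      (𝓝 (b x * (u x / μ) ^ (q - 1))) := fun x hx =>
    (tγ x hx).mul (((tu x hx).div tμ hμ0.ne').rpow_const (Or.inr (by linarith)))
  have tsp : ∀ x, R < ‖x‖ → Tendsto (fun j => sg (fun x => ct ((φ j : ℝ) + K) R x * a x) p (v0 (φ j)) x) atTop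
      (𝓝 (a x * (v x / ν) ^ (p - 1))) := fun x hx =>
    (tα x hx).mul (((tv x hx).div tν hν0.ne').rpow_const (Or.inr (by linarith)))
  have tu' : ∀ x, R < ‖x‖ → Tendsto (fun j => w0 (φ j) x) atTop (𝓝 (u x)) := fun x hx => hwu x hx ▸ tw x hx
  have sv : ∀ x, R < ‖x‖ → ContDiffAt ℝ 2 v x ∧ -lap v x + v x = b x * (u x / μ) ^ (q - 1) := fun x hx =>
    lim_solve (Fl := fun x => b x * (u x / μ) ^ (q - 1)) hN3 hR hF hk hk0 (fun j => gv0 (φ j)) tv zv tsq (fun y hy => (hb.lla y hy).mul (LLA.rpow (by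
      simpa only [← div_eq_mul_inv] using (u2 y hy).mul (LLA.const μ⁻¹ y)) (by linarith))) hx
  have su : ∀ x, R < ‖x‖ → ContDiffAt ℝ 2 u x ∧ -lap u x + u x = a x * (v x / ν) ^ (p - 1) := fun x hx =>
    lim_solve (Fl := fun x => a x * (v x / ν) ^ (p - 1)) hN3 hR hF hk hk0 (fun j => gw0 (φ j)) tu' zu tsp (fun y hy => (ha.lla y hy).mul (LLA.rpow (by
      simpa only [← div_eq_mul_inv] using (v2 y hy).mul (LLA.const ν⁻¹ y)) (by linarith))) hx
  have hp' : 1 ≤ p / (p - 1) := by rw [le_div_iff₀ (by linarith)]; linarith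
  have nt : ∃ x, R < ‖x‖ ∧ u x ≠ 0 := by
    by_contra hcon
    push Not at hcon
    have z1 : ∀ j, c0 ≤ nm ((fun (j : ℕ) x => ct ((φ j : ℝ) + K) R x * b x) j) q ((fun j => u0 (φ j)) j) := fun j => (hS0 (φ j)).so.mu0
    have z2 : ∀ j, Integrable fun x => (fun j => u0 (φ j)) j x ^ (p / (p - 1)) := fun j => int_rpow (hS0 (φ j)).so.hu.bc (hS0 (φ j)).so.hu.nn ((gu0 (φ j)).isk.integrable (gu0 (φ j)).kd (gu0 (φ j)).src (gu0 (φ j)).nn) hp'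
    have z3 : ∀ j x, R < ‖x‖ → (fun j => u0 (φ j)) j x ≤ F * rh m β x := fun j => (hS0 (φ j)).so.du
    have z4 : ∀ j x, (fun j => u0 (φ j)) j x ≤ F := fun j => (gu0 (φ j)).zle hF.le
    have z5 : ∀ j, ∫ x, (fun j => u0 (φ j)) j x ^ (p / (p - 1)) ≤ F := fun j => (hS0 (φ j)).so.iu
    have z6 : ∀ x, R < ‖x‖ → Tendsto (fun j => (fun j => u0 (φ j)) j x) atTop (𝓝 0) := fun x hx => by have := tu x hx; rwa [hcon x hx] at this
    have z7 : ∀ j, Wgt m R C0 ((fun (j : ℕ) x => ct ((φ j : ℝ) + K) R x * b x) j) := fun j => wγ (φ j)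
    exact nontriv hm hR (by linarith) hp hpq hc0 hF hC0 z7 (fun j => (hS0 (φ j)).so.hu) z1 z3 z4 z2 z5 z6
  have nn' : ∀ {z : Eu N → ℝ}, (∀ x, R < ‖x‖ → 0 ≤ z x ∧ z x ≤ F) → (∀ x, ‖x‖ ≤ R → z x = 0) → ∀ x, 0 ≤ z x ∧ z x ≤ F := by
    intro z h1 h2 x
    rcases le_or_gt ‖x‖ R with h | h
    · rw [h2 x h]; exact ⟨le_rfl, hF.le⟩
    · exact h1 x h
  exact ⟨F, μ, ν, u, v, hF, hμ0, hν0, zu, zv, fun x => (nn' u1 zu x).1, fun x => (nn' v1 zv x).1, fun x hx => (su x hx).1,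
    fun x hx => (sv x hx).1, fun x hx => (su x hx).2, fun x hx => (sv x hx).2, u3, v3, fun x => (nn' u1 zu x).2,
    zero_ext_cone (fun j => (hS0 (φ j)).so.hu.cone) tu zu, zero_ext_cone (fun j => (hS0 (φ j)).so.hv.cone) tv zv, nt⟩
end C6


open Set Filter Topology MeasureTheory
open scoped NNReal ContDiff ENNReal

section D1
variable {N : ℕ} {Θ : Measure (Eu N)} {V : Eu N → ℝ} {L : ℝ} {m : ℕ} {R C0 : ℝ}

theorem AR_conn (hN : 2 ≤ N) (hR : 0 < R) : IsPreconnected {x : Eu N | R < ‖x‖} := by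
  have hr : 1 < Module.rank ℝ (Eu N) := by
    rw [← Module.finrank_eq_rank, finrank_euclideanSpace_fin]
    exact_mod_cast (by omega : 1 < N)
  have h1 : IsPreconnected (Metric.sphere (0 : Eu N) 1) := isPreconnected_sphere hr 0 1
  have h2 : IsPreconnected ((fun z : ℝ × Eu N => z.1 • z.2) '' (Ioi R ×ˢ Metric.sphere (0 : Eu N) 1)) :=
    (isPreconnected_Ioi.prod h1).image _ (by fun_prop)
  convert h2 using 1
  ext x
  simp only [mem_ofPred_eq, mem_image, mem_prod, mem_Ioi, mem_sphere_zero_iff_norm, Prod.exists]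
  constructor
  · intro hx
    have h0 : 0 < ‖x‖ := hR.trans hx
    refine ⟨‖x‖, ‖x‖⁻¹ • x, ⟨hx, ?_⟩, ?_⟩
    · rw [norm_smul, norm_inv, norm_norm, inv_mul_cancel₀ h0.ne']
    · rw [smul_smul, mul_inv_cancel₀ h0.ne', one_smul]
  · rintro ⟨t, y, ⟨ht, hy⟩, rfl⟩
    rw [norm_smul, hy, mul_one, Real.norm_of_nonneg (by linarith)]
    exact ht

theorem cont_bd {z : Eu N → ℝ} {D δ : ℝ} (hR : 0 < R) (hδ : 0 < δ) (h0 : ∀ x, ‖x‖ ≤ R → z x = 0) (hn : ∀ x, 0 ≤ z x)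
    (hc : ∀ x, R < ‖x‖ → ContinuousAt z x) (hD : 0 ≤ D)
    (hb : ∀ x, R < ‖x‖ → ‖x‖ ^ 2 ≤ R ^ 2 + δ → z x ≤ D * (‖x‖ ^ 2 - R ^ 2)) : Continuous z := by
  refine continuous_iff_continuousAt.2 fun x => ?_
  rcases lt_trichotomy ‖x‖ R with h | h | h
  · have : z =ᶠ[𝓝 x] fun _ => 0 := by
      filter_upwards [(isOpen_lt continuous_norm continuous_const).mem_nhds (show x ∈ {y : Eu N | ‖y‖ < R} from h)] with y hy
      exact h0 y (le_of_lt hy)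
    exact (continuousAt_const (y := (0 : ℝ))).congr this.symm
  · have hz : z x = 0 := h0 x h.le
    unfold ContinuousAt
    rw [hz]
    have h1 : Continuous fun y : Eu N => D * |‖y‖ ^ 2 - R ^ 2| := by fun_prop
    have h2 : Tendsto (fun y : Eu N => D * |‖y‖ ^ 2 - R ^ 2|) (𝓝 x) (𝓝 0) := by
      have := h1.tendsto x
      simpa [h] using this
    have h3 : ∀ᶠ y in 𝓝 x, ‖y‖ ^ 2 < R ^ 2 + δ :=
      (isOpen_lt (by fun_prop) continuous_const).mem_nhds (show x ∈ {y : Eu N | ‖y‖ ^ 2 < R ^ 2 + δ} by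
        rw [mem_ofPred_eq, h]; linarith)
    refine squeeze_zero' (Eventually.of_forall hn) ?_ h2
    filter_upwards [h3] with y hy
    rcases le_or_gt ‖y‖ R with h4 | h4
    · rw [h0 y h4]; positivity
    · refine (hb y h4 hy.le).trans ?_
      have := le_abs_self (‖y‖ ^ 2 - R ^ 2)
      gcongr
  · exact hc x h

theorem local_pos {w : Eu N → ℝ} (h0 : ∀ x, 0 ≤ w x) {x1 : Eu N} {d : ℝ} (hd : 0 < d)
    (hc : ∀ x ∈ Metric.closedBall x1 d, ContDiffAt ℝ 2 w x) (hs : ∀ x ∈ Metric.closedBall x1 d, lap w x ≤ w x)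
    (h1 : 0 < w x1) {y : Eu N} (hy : ‖y - x1‖ < d) : 0 < w y := by
  have hcx : ContinuousAt w x1 := (hc x1 (Metric.mem_closedBall_self hd.le)).continuousAt
  have hev : ∀ᶠ z in 𝓝 x1, w x1 / 2 < w z := hcx.eventually (lt_mem_nhds (by linarith))
  obtain ⟨ρ, hρ, hρb⟩ := Metric.nhds_basis_closedBall.mem_iff.1 hev
  have hρb' : ∀ z, ‖z - x1‖ ≤ ρ → w x1 / 2 < w z := fun z hz => hρb (mem_closedBall_iff_norm.2 hz)
  set c := w x1 / 2 with hcdef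
  have hc0 : 0 < c := by positivity
  obtain ⟨α, hα1, hα⟩ : ∃ α : ℝ, 1 ≤ α ∧ 2 * N + 1 ≤ 4 * ρ ^ 2 * α := by
    refine ⟨max 1 ((2 * N + 1) / (4 * ρ ^ 2)), le_max_left _ _, ?_⟩
    have : (2 * N + 1) / (4 * ρ ^ 2) ≤ max 1 ((2 * N + 1) / (4 * ρ ^ 2)) := le_max_right _ _
    rw [div_le_iff₀ (by positivity)] at this
    linarith
  let ψ : Eu N → ℝ := fun z => (fun t => Real.exp (-α * t) - Real.exp (-α * d ^ 2)) (‖z - x1‖ ^ 2)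
  have hψc : ContDiff ℝ 2 ψ := by
    have := contDiff_normsq (N := N) (n := 2) x1
    exact (Real.contDiff_exp.comp (contDiff_const.mul this)).sub contDiff_const
  have hψl : ∀ z, ρ ≤ ‖z - x1‖ → ψ z ≤ lap ψ z := by
    intro z hz
    have hd1 : ∀ t : ℝ, HasDerivAt (fun t => Real.exp (-α * t) - Real.exp (-α * d ^ 2)) (-α * Real.exp (-α * t)) t := fun t => by
      have : HasDerivAt (fun t => -α * t) (-α) t := by simpa using (hasDerivAt_id t).const_mul (-α)
      exact (this.exp.sub_const _).congr_deriv (by ring)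
    have hd2 : ∀ t : ℝ, HasDerivAt (fun t => -α * Real.exp (-α * t)) (α ^ 2 * Real.exp (-α * t)) t := fun t => by
      have : HasDerivAt (fun t => -α * t) (-α) t := by simpa using (hasDerivAt_id t).const_mul (-α)
      exact (this.exp.const_mul (-α)).congr_deriv (by ring)
    have e := lap_radial x1 z (Eventually.of_forall hd1) (hd2 _)
    rw [show lap ψ z = _ from e]
    simp only [ψ]
    have hE := Real.exp_pos (-α * ‖z - x1‖ ^ 2)
    have hE2 := Real.exp_pos (-α * d ^ 2)
    have h3 : ρ ^ 2 ≤ ‖z - x1‖ ^ 2 := by gcongr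
    have h4 : 1 ≤ α * (4 * ‖z - x1‖ ^ 2 * α - 2 * N) := by
      have : 1 ≤ 4 * ‖z - x1‖ ^ 2 * α - 2 * N := by nlinarith
      nlinarith
    nlinarith
  have hψ1 : ∀ z, ψ z ≤ 1 := fun z => by
    simp only [ψ]
    have := Real.exp_pos (-α * d ^ 2)
    have : Real.exp (-α * ‖z - x1‖ ^ 2) ≤ 1 := Real.exp_le_one_iff.2 (by nlinarith [sq_nonneg ‖z - x1‖])
    linarith
  rcases le_or_gt ‖y - x1‖ ρ with hyρ | hyρ
  · exact hc0.trans (hρb' y hyρ)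
  set C : Set (Eu N) := {z | ρ ≤ ‖z - x1‖ ∧ ‖z - x1‖ ≤ d} with hC
  have hcn : Continuous fun z : Eu N => ‖z - x1‖ := by fun_prop
  have hCc : IsClosed C := (isClosed_le (f := fun _ => ρ) continuous_const hcn).and (isClosed_le (g := fun _ => d) hcn continuous_const)
  have hcb : ∀ z ∈ C, z ∈ Metric.closedBall x1 d := fun z hz => mem_closedBall_iff_norm.2 hz.2
  have hmp := max_principle hCc (w := fun z => w z - c * ψ z) (B := -c)
    (fun z hz => ((hc z (hcb z hz)).continuousAt.sub (continuousAt_const.mul hψc.continuous.continuousAt)).continuousWithinAt)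
    (fun z hz => by have := h0 z; have := hψ1 z; nlinarith)
    (fun z hz hneg => by
      have e1 : ‖z - x1‖ ≠ ρ := fun e => by
        have := hρb' z e.le
        have := hψ1 z
        nlinarith
      have e2 : ‖z - x1‖ ≠ d := fun e => by
        have : ψ z = 0 := by simp only [ψ]; rw [e, sub_self]
        rw [this] at hneg
        have := h0 z
        linarith
      have hz1 : ρ < ‖z - x1‖ := lt_of_le_of_ne hz.1 (Ne.symm e1)
      have hz2 : ‖z - x1‖ < d := lt_of_le_of_ne hz.2 e2
      have hψa := (hψc.contDiffAt (x := z))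
      refine ⟨?_, (hc z (hcb z hz)).sub (contDiffAt_const.mul hψa), ?_⟩
      · have ho : IsOpen {z : Eu N | ρ < ‖z - x1‖ ∧ ‖z - x1‖ < d} :=
          (isOpen_lt (f := fun _ => ρ) continuous_const hcn).and (isOpen_lt (g := fun _ => d) hcn continuous_const)
        exact mem_of_superset (ho.mem_nhds ⟨hz1, hz2⟩) fun z' h' => ⟨h'.1.le, h'.2.le⟩
      · rw [lap_sub (hc z (hcb z hz)) (contDiffAt_const.mul hψa), lap_const_mul c hψa]
        have := hs z (hcb z hz)
        have := hψl z hz.1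
        nlinarith) y ⟨hyρ.le, hy.le⟩
  have hψy : 0 < ψ y := by
    simp only [ψ]
    have : Real.exp (-α * d ^ 2) < Real.exp (-α * ‖y - x1‖ ^ 2) := by
      rw [Real.exp_lt_exp]
      have : ‖y - x1‖ ^ 2 < d ^ 2 := by gcongr
      nlinarith
    linarith
  have : 0 < c * ψ y := by positivity
  have hmp : 0 ≤ w y - c * ψ y := hmp
  linarith

theorem strong_pos (hN : 2 ≤ N) (hR : 0 < R) {w : Eu N → ℝ} (h0 : ∀ x, 0 ≤ w x) (hc : ∀ x, R < ‖x‖ → ContDiffAt ℝ 2 w x)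
    (hs : ∀ x, R < ‖x‖ → lap w x ≤ w x) (h1 : ∃ x, R < ‖x‖ ∧ w x ≠ 0) : ∀ x, R < ‖x‖ → 0 < w x := by
  obtain ⟨x1, hx1, hw1⟩ := h1
  by_contra hcon
  push Not at hcon
  obtain ⟨x2, hx2, hw2⟩ := hcon
  have hlp : ∀ x y : Eu N, ∀ d, 0 < d → R + d < ‖x‖ → 0 < w x → ‖y - x‖ < d → 0 < w y := fun x y d hd hx hw hy =>
    local_pos h0 hd (fun z hz => hc z (ball_subAR hx hz)) (fun z hz => hs z (ball_subAR hx hz)) hw hy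
  have o1 : IsOpen {x : Eu N | R < ‖x‖ ∧ 0 < w x} := by
    rw [Metric.isOpen_iff]
    rintro x ⟨hx, hw⟩
    have hd : 0 < (‖x‖ - R) / 2 := by linarith
    refine ⟨(‖x‖ - R) / 2, hd, fun y hy => ?_⟩
    have hx' : R + (‖x‖ - R) / 2 < ‖x‖ := by linarith
    exact ⟨ball_subAR hx' (Metric.ball_subset_closedBall hy), hlp x y _ hd hx' hw (mem_ball_iff_norm.1 hy)⟩
  have o2 : IsOpen {x : Eu N | R < ‖x‖ ∧ w x ≤ 0} := by
    rw [Metric.isOpen_iff]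
    rintro x ⟨hx, hw⟩
    have hd : 0 < (‖x‖ - R) / 3 := by linarith
    refine ⟨(‖x‖ - R) / 3, hd, fun y hy => ?_⟩
    have hy' := mem_ball_iff_norm.1 hy
    have hxy : ‖x - y‖ < (‖x‖ - R) / 3 := by rwa [norm_sub_rev]
    have h2 := norm_sub_norm_le x y
    refine ⟨show R < ‖y‖ by linarith, ?_⟩
    by_contra hw'
    have := hlp y x _ hd (by linarith) (not_le.1 hw') hxy
    linarith
  obtain ⟨z, -, hz1, hz2⟩ := AR_conn hN hR _ _ o1 o2 (fun x hx => by
    rcases le_or_gt (w x) 0 with h | h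
    · exact Or.inr ⟨hx, h⟩
    · exact Or.inl ⟨hx, h⟩) ⟨x1, hx1, hx1, lt_of_le_of_ne (h0 x1) (Ne.symm hw1)⟩ ⟨x2, hx2, hx2, hw2⟩
  linarith [hz1.2, hz2.2]

theorem Sol.cont_u {F p q μ ν : ℝ} {a b u v : Eu N → ℝ} (hN : 3 ≤ N) (hR : 0 < R) (hF : 0 < F)
    (h : Sol m R F p q μ ν a b u v) : Continuous u := by
  have hN0 : (0 : ℝ) < N := by exact_mod_cast (by omega : 0 < N)
  exact cont_bd hR (by positivity) h.zu h.nu (fun x hx => (h.cu x hx).continuousAt) (by positivity) h.bu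

theorem Sol.cont_v {F p q μ ν : ℝ} {a b u v : Eu N → ℝ} (hN : 3 ≤ N) (hR : 0 < R) (hF : 0 < F)
    (h : Sol m R F p q μ ν a b u v) : Continuous v := by
  have hN0 : (0 : ℝ) < N := by exact_mod_cast (by omega : 0 < N)
  exact cont_bd hR (by positivity) h.zv h.nv (fun x hx => (h.cv x hx).continuousAt) (by positivity) h.bv

theorem Sol.pos {F p q μ ν : ℝ} {a b u v : Eu N → ℝ} (hN : 3 ≤ N) (hR : 0 < R) (hF : 0 < F) (hp : 2 < p) (hμ : 0 < μ) (hν : 0 < ν)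
    (ha : ∀ x, R < ‖x‖ → 0 < a x) (hb : ∀ x, R < ‖x‖ → 0 < b x)
    (h : Sol m R F p q μ ν a b u v) : (∀ x, R < ‖x‖ → 0 < u x) ∧ (∀ x, R < ‖x‖ → 0 < v x) := by
  have hv : ∃ x, R < ‖x‖ ∧ v x ≠ 0 := by
    by_contra hcon
    push Not at hcon
    have hmp := max_principle (C := {x : Eu N | R ≤ ‖x‖}) (isClosed_le continuous_const continuous_norm)
      (w := fun x => - u x) (B := -F) (h.cont_u hN hR hF).neg.continuousOn (fun z _ => neg_le_neg (h.uF z))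
      (fun z hz hneg => by
        have hz' : R < ‖z‖ := by
          by_contra h1
          rw [h.zu z (not_lt.1 h1)] at hneg
          simp at hneg
        refine ⟨mem_of_superset (AR_open.mem_nhds hz') fun y hy => show R ≤ ‖y‖ from le_of_lt (show R < ‖y‖ from hy), (h.cu z hz').neg, ?_⟩
        have e := h.eu z hz'
        rw [hcon z hz', zero_div, Real.zero_rpow (by linarith), mul_zero] at e
        rw [lap_neg (h.cu z hz')]
        linarith)
    obtain ⟨x, hx, hx0⟩ := h.ntu
    have h1 : 0 ≤ - u x := hmp x (le_of_lt hx)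
    exact hx0 (le_antisymm (by linarith) (h.nu x))
  refine ⟨strong_pos (by omega) hR h.nu h.cu (fun x hx => ?_) h.ntu, strong_pos (by omega) hR h.nv h.cv (fun x hx => ?_) hv⟩
  · have e := h.eu x hx
    have : 0 ≤ a x * (v x / ν) ^ (p - 1) := mul_nonneg (ha x hx).le (Real.rpow_nonneg (div_nonneg (h.nv x) hν.le) _)
    linarith
  · have e := h.ev x hx
    have : 0 ≤ b x * (u x / μ) ^ (q - 1) := mul_nonneg (hb x hx).le (Real.rpow_nonneg (div_nonneg (h.nu x) hμ.le) _)
    linarith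
end D1


open Set Filter Topology MeasureTheory
open scoped NNReal ContDiff ENNReal

section D2
variable {N : ℕ} {m : ℕ} {R : ℝ}

def SH (R : ℝ) : Set (ℝ × ℝ) := {st : ℝ × ℝ | 0 ≤ st.1 ∧ 0 ≤ st.2 ∧ R ^ 2 < st.1 ^ 2 + st.2 ^ 2}

theorem polar_mem {r θ : ℝ} (hR : 0 < R) (hr : R < r) (hθ : θ ∈ Icc 0 (Real.pi / 2)) :
    (r * Real.cos θ, r * Real.sin θ) ∈ SH R := by
  have hr0 : 0 < r := hR.trans hr
  have hpi := Real.pi_pos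
  refine ⟨mul_nonneg hr0.le (Real.cos_nonneg_of_mem_Icc ⟨by linarith [hθ.1], hθ.2⟩),
    mul_nonneg hr0.le (Real.sin_nonneg_of_mem_Icc ⟨hθ.1, by linarith [hθ.2]⟩), ?_⟩
  have : (r * Real.cos θ) ^ 2 + (r * Real.sin θ) ^ 2 = r ^ 2 := by
    have := Real.sin_sq_add_cos_sq θ
    linear_combination r ^ 2 * this
  show R ^ 2 < (r * Real.cos θ) ^ 2 + (r * Real.sin θ) ^ 2
  rw [this]
  gcongr

theorem polar_exists {s t r : ℝ} (hr : 0 < r) (hs : 0 ≤ s) (ht : 0 ≤ t) (h : s ^ 2 + t ^ 2 = r ^ 2) :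
    Real.arcsin (t / r) ∈ Icc 0 (Real.pi / 2) ∧ s = r * Real.cos (Real.arcsin (t / r)) ∧
      t = r * Real.sin (Real.arcsin (t / r)) := by
  have h0 : 0 ≤ t / r := by positivity
  have htr : t ≤ r := by nlinarith
  have h1 : t / r ≤ 1 := by rw [div_le_one hr]; exact htr
  refine ⟨⟨Real.arcsin_nonneg.2 h0, Real.arcsin_le_pi_div_two _⟩, ?_, ?_⟩
  · rw [Real.cos_arcsin]
    have : 1 - (t / r) ^ 2 = (s / r) ^ 2 := by
      field_simp
      linarith
    rw [this, Real.sqrt_sq (by positivity)]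
    field_simp
  · rw [Real.sin_arcsin (by linarith) h1]
    field_simp

theorem curve_deriv {g : ℝ × ℝ → ℝ} {r θ : ℝ} (hR : 0 < R) (hr : R < r) (hθ : θ ∈ Icc 0 (Real.pi / 2))
    (hg : DifferentiableWithinAt ℝ g (SH R) (r * Real.cos θ, r * Real.sin θ)) :
    HasDerivWithinAt (fun θ => g (r * Real.cos θ, r * Real.sin θ))
      (r * Real.cos θ * fderivWithin ℝ g (SH R) (r * Real.cos θ, r * Real.sin θ) (0, 1)
        - r * Real.sin θ * fderivWithin ℝ g (SH R) (r * Real.cos θ, r * Real.sin θ) (1, 0))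
      (Icc 0 (Real.pi / 2)) θ := by
  have h1 : HasDerivAt (fun θ : ℝ => (r * Real.cos θ, r * Real.sin θ)) (r * (-Real.sin θ), r * Real.cos θ) θ :=
    ((Real.hasDerivAt_cos θ).const_mul r).prodMk ((Real.hasDerivAt_sin θ).const_mul r)
  have h2 := hg.hasFDerivWithinAt.comp_hasDerivWithinAt θ (h1.hasDerivWithinAt (s := Icc 0 (Real.pi / 2)))
    (fun x hx => polar_mem hR hr hx)
  refine h2.congr_deriv ?_
  have e : ((r * (-Real.sin θ), r * Real.cos θ) : ℝ × ℝ) = (r * Real.cos θ) • ((0, 1) : ℝ × ℝ) - (r * Real.sin θ) • ((1, 0) : ℝ × ℝ) := by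
    ext <;> simp
  rw [e, map_sub, map_smul, map_smul, smul_eq_mul, smul_eq_mul]

theorem ang_anti {g : ℝ × ℝ → ℝ} {r : ℝ} (hR : 0 < R) (hr : R < r) (hg : DifferentiableOn ℝ g (SH R))
    (hm : ∀ st ∈ SH R, st.1 * fderivWithin ℝ g (SH R) st (0, 1) - st.2 * fderivWithin ℝ g (SH R) st (1, 0) ≤ 0) :
    AntitoneOn (fun θ => g (r * Real.cos θ, r * Real.sin θ)) (Icc 0 (Real.pi / 2)) := by
  have hd : ∀ θ ∈ Icc 0 (Real.pi / 2), _ := fun θ hθ => curve_deriv hR hr hθ (hg _ (polar_mem hR hr hθ))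
  refine antitoneOn_of_hasDerivWithinAt_nonpos (convex_Icc _ _) (fun θ hθ => (hd θ hθ).continuousWithinAt)
    (fun θ hθ => (hd θ (interior_subset hθ)).mono interior_subset) (fun θ hθ => hm _ (polar_mem hR hr (interior_subset hθ)))

theorem sVar_norm (x : Eu N) : sVar m x = ‖(WithLp.toLp 2 (fun i : Fin N => if (i : ℕ) < m then x i else 0) : Eu N)‖ := by
  rw [EuclideanSpace.norm_eq]
  unfold sVar
  congr 1
  refine Finset.sum_congr rfl fun i _ => ?_
  by_cases h : (i : ℕ) < m <;> simp [h]

theorem tVar_norm (x : Eu N) : tVar m x = ‖(WithLp.toLp 2 (fun i : Fin N => if (i : ℕ) < m then 0 else x i) : Eu N)‖ := by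
  rw [EuclideanSpace.norm_eq]
  unfold tVar
  congr 1
  refine Finset.sum_congr rfl fun i _ => ?_
  by_cases h : (i : ℕ) < m <;> simp [h]

theorem sVar_lip (x y : Eu N) : |sVar m x - sVar m y| ≤ ‖x - y‖ := by
  have h1 : sVar m (x - y) ≤ ‖x - y‖ := by
    have := st_sq (m := m) (x - y)
    have := sVar_nonneg (m := m) (x - y)
    have := norm_nonneg (x - y)
    nlinarith [sq_nonneg (tVar m (x - y))]
  refine le_trans ?_ h1
  rw [sVar_norm, sVar_norm, sVar_norm]
  refine (abs_norm_sub_norm_le _ _).trans (le_of_eq ?_)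
  congr 1
  ext i
  by_cases h : (i : ℕ) < m <;> simp [h]

theorem tVar_lip (x y : Eu N) : |tVar m x - tVar m y| ≤ ‖x - y‖ := by
  have h1 : tVar m (x - y) ≤ ‖x - y‖ := by
    have := st_sq (m := m) (x - y)
    have := tVar_nonneg (m := m) (x - y)
    have := norm_nonneg (x - y)
    nlinarith [sq_nonneg (sVar m (x - y))]
  refine le_trans ?_ h1
  rw [tVar_norm, tVar_norm, tVar_norm]
  refine (abs_norm_sub_norm_le _ _).trans (le_of_eq ?_)
  congr 1
  ext i
  by_cases h : (i : ℕ) < m <;> simp [h]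

theorem st_lip : LipschitzWith 1 (fun x : Eu N => (sVar m x, tVar m x)) := by
  refine LipschitzWith.of_dist_le_mul fun x y => ?_
  rw [Prod.dist_eq, NNReal.coe_one, one_mul, Real.dist_eq, Real.dist_eq, dist_eq_norm]
  exact max_le (sVar_lip x y) (tVar_lip x y)

theorem st_mem (hR : 0 < R) {x : Eu N} (hx : R < ‖x‖) : (sVar m x, tVar m x) ∈ SH R := by
  refine ⟨sVar_nonneg x, tVar_nonneg x, ?_⟩
  show R ^ 2 < sVar m x ^ 2 + tVar m x ^ 2
  rw [st_sq]
  gcongr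

theorem coef_of {a : Eu N → ℝ} {g : ℝ × ℝ → ℝ} {c1 C0 : ℝ} (hR : 0 < R)
    (hrep : ∀ x, a x = g (sVar m x, tVar m x)) (hC : ContDiffOn ℝ 1 g (SH R))
    (hm : ∀ st ∈ SH R, st.1 * fderivWithin ℝ g (SH R) st (0, 1) - st.2 * fderivWithin ℝ g (SH R) st (1, 0) ≤ 0)
    (hlo : ∀ x, R < ‖x‖ → c1 ≤ a x) (hle : ∀ x, R < ‖x‖ → a x ≤ C0) : Coef m R c1 C0 a := by
  refine ⟨fun x hx => ?_, hlo, hle, fun x y hx hxy ht => ?_⟩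
  · have hcv : Convex ℝ {st : ℝ × ℝ | 0 ≤ st.1 ∧ 0 ≤ st.2} := by
      have : {st : ℝ × ℝ | 0 ≤ st.1 ∧ 0 ≤ st.2} = Ici 0 ×ˢ Ici 0 := by ext; exact Iff.rfl
      rw [this]
      exact (convex_Ici 0).prod (convex_Ici 0)
    have ho : IsOpen {st : ℝ × ℝ | R ^ 2 < st.1 ^ 2 + st.2 ^ 2} := isOpen_lt continuous_const (by fun_prop)
    have hmem := st_mem (m := m) hR hx
    have h1 := hC _ hmem
    have e : SH R = {st : ℝ × ℝ | 0 ≤ st.1 ∧ 0 ≤ st.2} ∩ {st : ℝ × ℝ | R ^ 2 < st.1 ^ 2 + st.2 ^ 2} := by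
      ext st
      simp only [SH, mem_inter_iff, mem_ofPred_eq, and_assoc]
    rw [e, contDiffWithinAt_inter (ho.mem_nhds hmem.2.2)] at h1
    obtain ⟨K, t, ht, hl⟩ := h1.exists_lipschitzOnWith hcv
    have hcont : Continuous fun x : Eu N => (sVar m x, tVar m x) := st_lip.continuous
    refine ⟨K * 1, (fun x : Eu N => (sVar m x, tVar m x)) ⁻¹' t, ?_, ?_⟩
    · have : Tendsto (fun x : Eu N => (sVar m x, tVar m x)) (𝓝 x) (𝓝[{st : ℝ × ℝ | 0 ≤ st.1 ∧ 0 ≤ st.2}] (sVar m x, tVar m x)) :=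
        tendsto_nhdsWithin_iff.2 ⟨hcont.tendsto x, Eventually.of_forall fun y => ⟨sVar_nonneg y, tVar_nonneg y⟩⟩
      exact this ht
    · have : a = g ∘ (fun x : Eu N => (sVar m x, tVar m x)) := funext hrep
      rw [this]
      exact hl.comp st_lip.lipschitzOnWith (mapsTo_preimage _ _)
  · have hr : 0 < ‖x‖ := hR.trans hx
    obtain ⟨x1, x2, x3⟩ := polar_exists hr (sVar_nonneg (m := m) x) (tVar_nonneg x) (st_sq x)
    obtain ⟨y1, y2, y3⟩ := polar_exists hr (sVar_nonneg (m := m) y) (tVar_nonneg y) (by rw [st_sq, hxy])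
    have := ang_anti hR hx (hC.differentiableOn (by simp)) hm y1 x1 (Real.monotone_arcsin (by gcongr))
    dsimp only at this
    rw [← x2, ← x3, ← y2, ← y3] at this
    rwa [hrep, hrep]

theorem hat_of {i0 i1 : Fin N} (h0 : (i0 : ℕ) < m) (h1 : m ≤ (i1 : ℕ)) (hR : 0 < R) {u : Eu N → ℝ} (hu : Cone m u) :
    ∃ g : ℝ × ℝ → ℝ, (∀ x, u x = g (sVar m x, tVar m x)) ∧
      ∀ st ∈ SH R, st.1 * fderivWithin ℝ g (SH R) st (0, 1) - st.2 * fderivWithin ℝ g (SH R) st (1, 0) ≤ 0 := by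
  have hne := idx_ne h0 h1
  refine ⟨fun st => u (pl i0 i1 st.1 st.2), fun x => hu.eq ?_ ?_, ?_⟩
  · have e := norm_pl hne (sVar m x) (tVar m x)
    rw [st_sq] at e
    exact ((sq_eq_sq₀ (norm_nonneg _) (norm_nonneg _)).1 e).symm
  · rw [tVar_pl h0 h1 _ (tVar_nonneg x)]
  · intro st hst
    by_cases hd : DifferentiableWithinAt ℝ (fun st : ℝ × ℝ => u (pl i0 i1 st.1 st.2)) (SH R) st
    · set r := Real.sqrt (st.1 ^ 2 + st.2 ^ 2) with hr
      have hr2 : st.1 ^ 2 + st.2 ^ 2 = r ^ 2 := by rw [hr, Real.sq_sqrt (by positivity)]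
      have hRr : R < r := Real.lt_sqrt_of_sq_lt hst.2.2
      have hr0 : 0 < r := hR.trans hRr
      obtain ⟨x1, x2, x3⟩ := polar_exists hr0 hst.1 hst.2.1 hr2
      set θ := Real.arcsin (st.2 / r)
      have hst' : st = (r * Real.cos θ, r * Real.sin θ) := Prod.ext x2 x3
      rw [hst'] at hd
      have hder := curve_deriv hR hRr x1 hd
      have hanti : AntitoneOn (fun θ => (fun st : ℝ × ℝ => u (pl i0 i1 st.1 st.2)) (r * Real.cos θ, r * Real.sin θ)) (Icc 0 (Real.pi / 2)) := by
        intro θ1 h1' θ2 h2' h12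
        have m1 := polar_mem hR hRr h1'
        have m2 := polar_mem hR hRr h2'
        refine hu _ _ ?_ ?_
        · refine (sq_eq_sq₀ (norm_nonneg _) (norm_nonneg _)).1 ?_
          rw [norm_pl hne, norm_pl hne]
          have e1 := Real.sin_sq_add_cos_sq θ1
          have e2 := Real.sin_sq_add_cos_sq θ2
          linear_combination r ^ 2 * (e2 - e1)
        · rw [tVar_pl h0 h1 _ m1.2.1, tVar_pl h0 h1 _ m2.2.1]
          have := Real.sin_le_sin_of_le_of_le_pi_div_two (by linarith [h1'.1, Real.pi_pos]) h2'.2 h12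
          show r * Real.sin θ1 ≤ r * Real.sin θ2
          gcongr
      have hdw := hder.derivWithin (uniqueDiffOn_Icc (by linarith [Real.pi_pos]) θ x1)
      have := hanti.derivWithin_nonpos (x := θ)
      rw [hdw] at this
      rw [hst']
      exact this
    · rw [fderivWithin_zero_of_not_differentiableWithinAt hd]
      simp
end D2


open Set Filter Topology MeasureTheory
open scoped NNReal ContDiff ENNReal

section D3

theorem exp_choice {n : ℕ} {p q : ℝ} (hn : 1 < n) (hp : 2 < p) (hpq : p ≤ q)
    (hexp : (n : ℝ) ≤ (p + 1) / (p - 1) ∨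
      ((p + 1) / (p - 1) < (n : ℝ) ∧ 1 - 2 / ((n : ℝ) + 1) < 1 / p + 1 / q)) :
    ∃ β : ℝ, 1 < β ∧ (n : ℝ) + 1 < 2 * β ∧ p / (p - 1) ≤ β ∧ (p * (1 - 1 / β) - 1) * (q * (1 - 1 / β) - 1) < 1 := by
  have hn0 : (0 : ℝ) < (n : ℝ) + 1 := by positivity
  have hp0 : 0 < p := by linarith
  have hq0 : 0 < q := by linarith
  have hp1 : 0 < p - 1 := by linarith
  have h1 : 1 - 2 / ((n : ℝ) + 1) < 1 / p + 1 / q := by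
    rcases hexp with h | h
    · rw [le_div_iff₀ hp1] at h
      have : 1 - 2 / ((n : ℝ) + 1) ≤ 1 / p := by
        rw [sub_le_iff_le_add, div_add_div _ _ hp0.ne' hn0.ne', le_div_iff₀ (by positivity)]
        nlinarith
      have : 0 < 1 / q := by positivity
      linarith
    · exact h.2
  have hpinv : 1 / p < 1 / 2 := one_div_lt_one_div_of_lt (by norm_num) hp
  have hqinv : 1 / q < 1 / 2 := one_div_lt_one_div_of_lt (by norm_num) (by linarith)
  have hq' : 0 < 1 / q := by positivity
  have hp' : 0 < 1 / p := by positivity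
  obtain ⟨d, hd1, hd2⟩ := exists_between (max_lt h1 (show 1 / p < 1 / p + 1 / q by linarith))
  obtain ⟨hd3, hd4⟩ := max_lt_iff.1 hd1
  have hd : 0 < 1 - d := by linarith
  refine ⟨1 / (1 - d), ?_, ?_, ?_, ?_⟩
  · rw [lt_div_iff₀ hd]; linarith
  · have : 1 - d < 2 / ((n : ℝ) + 1) := by linarith
    rw [lt_div_iff₀ hn0] at this
    rw [mul_one_div, lt_div_iff₀ hd]; linarith
  · rw [div_le_div_iff₀ hp1 hd]
    have : 1 < d * p := by rwa [div_lt_iff₀ hp0] at hd4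
    linarith
  · rw [one_div_one_div, sub_sub_cancel]
    have e : d * (p * q) < q + p := by
      rw [div_add_div _ _ hp0.ne' hq0.ne', lt_div_iff₀ (by positivity)] at hd2
      linarith
    have hd0 : 0 < d := by linarith
    nlinarith

theorem scale_choice {p q μ ν : ℝ} (hp : 2 < p) (hpq : p ≤ q) (hμ : 0 < μ) (hν : 0 < ν) :
    ∃ l k : ℝ, 0 < l ∧ 0 < k ∧ (∀ v, 0 ≤ v → l * (v / ν) ^ (p - 1) = (k * v) ^ (p - 1)) ∧
      (∀ u, 0 ≤ u → k * (u / μ) ^ (q - 1) = (l * u) ^ (q - 1)) := by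
  have hden : (p - 1) * (q - 1) - 1 ≠ 0 := by nlinarith
  obtain ⟨A, hA⟩ : ∃ A, A = -((p - 1) * Real.log ν) := ⟨_, rfl⟩
  obtain ⟨B, hB⟩ : ∃ B, B = -((q - 1) * Real.log μ) := ⟨_, rfl⟩
  obtain ⟨k, hk⟩ : ∃ k, k * ((p - 1) * (q - 1) - 1) = B + (q - 1) * A :=
    ⟨(B + (q - 1) * A) / ((p - 1) * (q - 1) - 1), div_mul_cancel₀ _ hden⟩
  obtain ⟨l, hl⟩ : ∃ l, l = (p - 1) * k - A := ⟨_, rfl⟩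
  refine ⟨Real.exp l, Real.exp k, Real.exp_pos _, Real.exp_pos _, fun v hv => ?_, fun u hu => ?_⟩
  · rw [Real.div_rpow hv hν.le, Real.mul_rpow (Real.exp_pos _).le hv, ← Real.exp_mul, Real.rpow_def_of_pos hν,
      div_eq_mul_inv, ← Real.exp_neg, mul_left_comm, ← Real.exp_add, mul_comm]
    congr 2
    linarith
  · rw [Real.div_rpow hu hμ.le, Real.mul_rpow (Real.exp_pos _).le hu, ← Real.exp_mul, Real.rpow_def_of_pos hμ,
      div_eq_mul_inv, ← Real.exp_neg, mul_left_comm, ← Real.exp_add, mul_comm]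
    congr 2
    subst hl
    linarith
end D3

/-- existence, for the supercritical Hamiltonian system on the exterior
domain `A_R = {|x| > R} ⊆ ℝ^N` (`N = m + n > 3`, `1 < n ≤ m`), of a positive classical
solution `(u, v)` which is invariant under `O(m) × O(n)` and nonincreasing in the polar
angle, under the symmetry/monotonicity hypothesis `(H)` on the weights `a, b` and the
exponent condition (Theorem 1.1 of the paper). -/
theorem stmt_0
    (m n N : ℕ) (hN : N = m + n) (hn : 1 < n) (hnm : n ≤ m) (hN3 : 3 < N)
    (R : ℝ) (hR : 0 < R)
    (p q : ℝ) (hp : 2 < p) (hpq : p ≤ q)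
    (AR : Set (EuclideanSpace ℝ (Fin N))) (hAR : AR = {x | R < ‖x‖})
    (Shat : Set (ℝ × ℝ))
    (hShat : Shat = {st : ℝ × ℝ | 0 ≤ st.1 ∧ 0 ≤ st.2 ∧ R ^ 2 < st.1 ^ 2 + st.2 ^ 2})
    (a b : EuclideanSpace ℝ (Fin N) → ℝ) (ahat bhat : ℝ × ℝ → ℝ)
    (ha_cont : ContinuousOn a (closure AR)) (hb_cont : ContinuousOn b (closure AR))
    (a₀ A₀ b₀ B₀ : ℝ) (ha₀ : 0 < a₀) (hb₀ : 0 < b₀)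
    (ha_bd : ∀ x ∈ closure AR, a₀ ≤ a x ∧ a x ≤ A₀)
    (hb_bd : ∀ x ∈ closure AR, b₀ ≤ b x ∧ b x ≤ B₀)
    (ha_rep : ∀ x, a x = ahat (sVar m x, tVar m x))
    (hb_rep : ∀ x, b x = bhat (sVar m x, tVar m x))
    (ha_C1 : ContDiffOn ℝ 1 ahat Shat) (hb_C1 : ContDiffOn ℝ 1 bhat Shat)
    (ha_mono : ∀ st ∈ Shat,
      st.1 * fderivWithin ℝ ahat Shat st (0, 1)
        - st.2 * fderivWithin ℝ ahat Shat st (1, 0) ≤ 0)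
    (hb_mono : ∀ st ∈ Shat,
      st.1 * fderivWithin ℝ bhat Shat st (0, 1)
        - st.2 * fderivWithin ℝ bhat Shat st (1, 0) ≤ 0)
    (hexp : (n : ℝ) ≤ (p + 1) / (p - 1) ∨
      ((p + 1) / (p - 1) < (n : ℝ) ∧ 1 - 2 / ((n : ℝ) + 1) < 1 / p + 1 / q)) :
    ∃ u v : EuclideanSpace ℝ (Fin N) → ℝ,
      ContDiffOn ℝ 2 u AR ∧ ContDiffOn ℝ 2 v AR ∧
      ContinuousOn u (closure AR) ∧ ContinuousOn v (closure AR) ∧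
      (∀ x ∈ AR, 0 < u x) ∧ (∀ x ∈ AR, 0 < v x) ∧
      (∀ x : EuclideanSpace ℝ (Fin N), ‖x‖ = R → u x = 0) ∧
      (∀ x : EuclideanSpace ℝ (Fin N), ‖x‖ = R → v x = 0) ∧
      (∀ x ∈ AR, -lap u x + u x = a x * v x ^ (p - 1)) ∧
      (∀ x ∈ AR, -lap v x + v x = b x * u x ^ (q - 1)) ∧
      (∃ uhat : ℝ × ℝ → ℝ, (∀ x, u x = uhat (sVar m x, tVar m x)) ∧
        ∀ st ∈ Shat,
          st.1 * fderivWithin ℝ uhat Shat st (0, 1)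
            - st.2 * fderivWithin ℝ uhat Shat st (1, 0) ≤ 0) ∧
      (∃ vhat : ℝ × ℝ → ℝ, (∀ x, v x = vhat (sVar m x, tVar m x)) ∧
        ∀ st ∈ Shat,
          st.1 * fderivWithin ℝ vhat Shat st (0, 1)
            - st.2 * fderivWithin ℝ vhat Shat st (1, 0) ≤ 0) := by
  have hAR' : ∀ x, x ∈ AR ↔ R < ‖x‖ := fun x => by rw [hAR]; rfl
  have hSH : Shat = SH R := hShat
  have hcl : ∀ x : Eu N, R < ‖x‖ → x ∈ closure AR := fun x hx => subset_closure ((hAR' x).2 hx)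
  have hN' : 3 ≤ N := by omega
  rw [hSH] at ha_C1 hb_C1 ha_mono hb_mono
  have hc1 : 0 < min a₀ b₀ := lt_min ha₀ hb₀
  have ca : Coef m R (min a₀ b₀) (max A₀ B₀) a := coef_of hR ha_rep ha_C1 ha_mono
    (fun x hx => (min_le_left _ _).trans (ha_bd x (hcl x hx)).1) (fun x hx => (ha_bd x (hcl x hx)).2.trans (le_max_left _ _))
  have cb : Coef m R (min a₀ b₀) (max A₀ B₀) b := coef_of hR hb_rep hb_C1 hb_mono
    (fun x hx => (min_le_right _ _).trans (hb_bd x (hcl x hx)).1) (fun x hx => (hb_bd x (hcl x hx)).2.trans (le_max_right _ _))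
  obtain ⟨xp, hxp⟩ := exists_pt hN' hR
  have hC0 : 0 < max A₀ B₀ := hc1.trans_le ((ca.lo xp hxp).trans (ca.le xp hxp))
  obtain ⟨β, hβ1, hβ2, hβ3, hβ4⟩ := exp_choice hn hp hpq hexp
  obtain ⟨F, μ, ν, u, v, hF, hμ, hν, hS⟩ := main_lim (by omega) hn hN hβ1 hβ2 hR hp hpq hc1 hβ3 hβ4 hC0 ca cb
  obtain ⟨pu, pv⟩ := hS.pos hN' hR hF hp hμ hν (fun x hx => hc1.trans_le (ca.lo x hx)) (fun x hx => hc1.trans_le (cb.lo x hx))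
  obtain ⟨l, k, hl, hk, s1, s2⟩ := scale_choice hp hpq hμ hν
  have i0 : ((⟨0, by omega⟩ : Fin N) : ℕ) < m := by show 0 < m; omega
  have i1 : m ≤ ((⟨m, by omega⟩ : Fin N) : ℕ) := le_rfl
  have coneu : Cone m (fun x => l * u x) := fun x y h1 h2 => mul_le_mul_of_nonneg_left (hS.coneu x y h1 h2) hl.le
  have conev : Cone m (fun x => k * v x) := fun x y h1 h2 => mul_le_mul_of_nonneg_left (hS.conev x y h1 h2) hk.le
  refine ⟨fun x => l * u x, fun x => k * v x, fun x hx => ?_, fun x hx => ?_, (continuous_const.mul (hS.cont_u hN' hR hF)).continuousOn,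
    (continuous_const.mul (hS.cont_v hN' hR hF)).continuousOn, fun x hx => mul_pos hl (pu x ((hAR' x).1 hx)),
    fun x hx => mul_pos hk (pv x ((hAR' x).1 hx)), fun x hx => ?_, fun x hx => ?_, fun x hx => ?_, fun x hx => ?_, ?_, ?_⟩
  · exact (contDiffAt_const.mul (hS.cu x ((hAR' x).1 hx))).contDiffWithinAt
  · exact (contDiffAt_const.mul (hS.cv x ((hAR' x).1 hx))).contDiffWithinAt
  · show l * u x = 0
    rw [hS.zu x hx.le, mul_zero]
  · show k * v x = 0
    rw [hS.zv x hx.le, mul_zero]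
  · have hx' := (hAR' x).1 hx
    dsimp only
    rw [lap_const_mul l (hS.cu x hx'), ← s1 (v x) (hS.nv x)]
    have := hS.eu x hx'
    linear_combination l * this
  · have hx' := (hAR' x).1 hx
    dsimp only
    rw [lap_const_mul k (hS.cv x hx'), ← s2 (u x) (hS.nu x)]
    have := hS.ev x hx'
    linear_combination k * this
  · rw [hSH]
    exact hat_of i0 i1 hR coneu
  · rw [hSH]
    exact hat_of i0 i1 hR conev
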